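/- arXiv:1011.4776 — 2 statements merged into one kernel-verified Lean document; each statement's English description precedes it below -/
import Mathlib

section
/- For every natural number k ≥ 2 there exist an infinite-dimensional separable real Banach space X and a bounded linear operator S : X → X with ‖S‖ ≤ 1 such that S^k = 0, S^(k-1) ≠ 0, S is not a compact operator, and S is strictly singular. -/
/-- A bounded linear operator is strictly singular if for every infinite-dimensional
subspace `Y` and every `c > 0` there is `y ∈ Y` with `‖S y‖ < c * ‖y‖`. -/
def StrictlySingular {X : Type*} [NormedAddCommGroup X] [NormedSpace ℝ X]
    (S : X →L[ℝ] X) : Prop :=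
  ∀ Y : Submodule ℝ X, ¬FiniteDimensional ℝ Y → ∀ c : ℝ, 0 < c → ∃ y ∈ Y, ‖S y‖ < c * ‖y‖

open MeasureTheory

section toLp

variable {K : Type*} [TopologicalSpace K] [CompactSpace K]

/-- If a real functional `φ` of norm at most one is applied to the values of functions `v i` on
whose span the sup norm is at most `C` times the Euclidean norm of the coefficients, then the
sum of the squares is at most `C ^ 2`. -/
theorem sum_sq_apply_le {n : ℕ} (v : Fin n → C(K, ℂ)) {C : ℝ} (hC : 0 ≤ C)
    (hv : ∀ a : Fin n → ℝ, ‖∑ i, a i • v i‖ ≤ C * √(∑ i, a i ^ 2))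
    (φ : ℂ →ₗ[ℝ] ℝ) (hφ : ∀ z, φ z ≤ ‖z‖) (t : K) : ∑ i, φ (v i t) ^ 2 ≤ C ^ 2 := by
  set s := ∑ i, φ (v i t) ^ 2 with hs
  have h0 : 0 ≤ s := Finset.sum_nonneg fun i _ => sq_nonneg _
  have h1 : s ≤ C * √s := by
    calc s = φ ((∑ i, φ (v i t) • v i) t) := by
          rw [hs, ContinuousMap.sum_apply, map_sum]
          refine Finset.sum_congr rfl fun i _ => ?_
          rw [ContinuousMap.smul_apply, map_smul, smul_eq_mul, sq]
      _ ≤ ‖(∑ i, φ (v i t) • v i) t‖ := hφ _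
      _ ≤ ‖∑ i, φ (v i t) • v i‖ := ContinuousMap.norm_coe_le_norm _ t
      _ ≤ C * √s := hv _
  have h2 := Real.sq_sqrt h0
  have h3 := Real.sqrt_nonneg s
  have h4 : √s ≤ C := by
    rcases h3.eq_or_lt with h | h
    · rw [← h]; exact hC
    · nlinarith
  nlinarith

variable [MeasurableSpace K] [BorelSpace K] (μ : Measure K) [IsProbabilityMeasure μ]

theorem norm_sq_toLp_two (f : C(K, ℂ)) :
    ‖ContinuousMap.toLp 2 μ ℝ f‖ ^ 2 = ∫ t, ‖f t‖ ^ 2 ∂μ := by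
  rw [← real_inner_self_eq_norm_sq, L2.inner_def]
  refine integral_congr_ae ?_
  filter_upwards [ContinuousMap.coeFn_toLp (𝕜 := ℝ) (p := 2) μ f] with t ht
  rw [ht, real_inner_self_eq_norm_sq]

theorem card_le_of_orthonormal_toLp {n : ℕ} (v : Fin n → C(K, ℂ)) {C : ℝ} (hC : 0 ≤ C)
    (ho : Orthonormal ℝ fun i => ContinuousMap.toLp 2 μ ℝ (v i))
    (hv : ∀ a : Fin n → ℝ,
      ‖∑ i, a i • v i‖ ≤ C * ‖ContinuousMap.toLp 2 μ ℝ (∑ i, a i • v i)‖) :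
    (n : ℝ) ≤ 2 * C ^ 2 := by
  have hv' : ∀ a : Fin n → ℝ, ‖∑ i, a i • v i‖ ≤ C * √(∑ i, a i ^ 2) := by
    intro a
    refine (hv a).trans_eq ?_
    congr 1
    rw [norm_eq_sqrt_real_inner, map_sum]
    simp_rw [map_smul]
    rw [ho.inner_sum]
    simp [sq]
  have hint : ∀ i, Integrable (fun t => ‖v i t‖ ^ 2) μ := fun i =>
    ((map_continuous (v i)).norm.pow 2).integrable_of_hasCompactSupport
      (HasCompactSupport.of_compactSpace _)
  calc (n : ℝ) = ∑ i, ‖ContinuousMap.toLp 2 μ ℝ (v i)‖ ^ 2 := by simp [ho.1]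
    _ = ∫ t, ∑ i, ‖v i t‖ ^ 2 ∂μ := by
        rw [integral_finsetSum _ fun i _ => hint i]
        exact Finset.sum_congr rfl fun i _ => norm_sq_toLp_two μ (v i)
    _ ≤ ∫ _, 2 * C ^ 2 ∂μ := by
        refine integral_mono (integrable_finsetSum _ fun i _ => hint i)
          (integrable_const _) fun t => ?_
        have hre := sum_sq_apply_le v hC hv' Complex.reLm Complex.re_le_norm t
        have him := sum_sq_apply_le v hC hv' Complex.imLm
          (fun z => (le_abs_self _).trans (Complex.abs_im_le_norm z)) t
        calc ∑ i, ‖v i t‖ ^ 2 = ∑ i, Complex.reLm (v i t) ^ 2 + ∑ i, Complex.imLm (v i t) ^ 2 := by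
              rw [← Finset.sum_add_distrib]
              refine Finset.sum_congr rfl fun i _ => ?_
              rw [Complex.sq_norm, Complex.normSq_apply, Complex.reLm_coe, Complex.imLm_coe]
              ring
          _ ≤ 2 * C ^ 2 := by linarith
    _ = 2 * C ^ 2 := by simp

/-- A subspace of `C(K, ℂ)` on which the sup norm is dominated by the `L²` norm is
finite-dimensional. -/
theorem finiteDimensional_of_norm_le_toLp (Y : Submodule ℝ C(K, ℂ)) {C : ℝ} (hC : 0 ≤ C)
    (hY : ∀ y ∈ Y, ‖y‖ ≤ C * ‖ContinuousMap.toLp 2 μ ℝ y‖) : FiniteDimensional ℝ Y := by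
  by_contra hfin
  let J : C(K, ℂ) →ₗ[ℝ] Lp ℂ 2 μ := (ContinuousMap.toLp 2 μ ℝ).toLinearMap
  have hinj : Function.Injective (J.domRestrict Y) := by
    rw [← LinearMap.ker_eq_bot, LinearMap.ker_eq_bot']
    rintro ⟨y, hy⟩ h
    have h' : ContinuousMap.toLp 2 μ ℝ y = 0 := h
    have := hY y hy
    rw [h', norm_zero, mul_zero, norm_le_zero_iff] at this
    exact Subtype.ext this
  obtain ⟨n, hn⟩ := exists_nat_gt (2 * C ^ 2)
  obtain ⟨f, hf⟩ : ∃ f : Fin n → Y, LinearIndependent ℝ f := by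
    have : Module.Free ℝ Y := Module.Free.of_divisionRing ℝ Y
    have : (n : Cardinal) ≤ Module.rank ℝ Y := by
      by_contra! h
      exact hfin (Module.rank_lt_aleph0_iff.1 (h.trans Cardinal.natCast_lt_aleph0))
    exact exists_linearIndependent_of_le_rank this
  have hg := hf.map' _ (LinearMap.ker_eq_bot.2 hinj)
  have ho := InnerProductSpace.gramSchmidtNormed_orthonormal hg
  have hmem : ∀ i, InnerProductSpace.gramSchmidtNormed ℝ (J.domRestrict Y ∘ f) i ∈
      LinearMap.range (J.domRestrict Y) := fun i => by
    have h : InnerProductSpace.gramSchmidtNormed ℝ (J.domRestrict Y ∘ f) i ∈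
        Submodule.span ℝ
          (Set.range (InnerProductSpace.gramSchmidtNormed ℝ (J.domRestrict Y ∘ f))) :=
      Submodule.subset_span ⟨i, rfl⟩
    rw [InnerProductSpace.span_gramSchmidtNormed_range, InnerProductSpace.span_gramSchmidt] at h
    refine Submodule.span_le.2 ?_ h
    rintro _ ⟨j, rfl⟩
    exact ⟨f j, rfl⟩
  choose w hw using hmem
  refine hn.not_ge (card_le_of_orthonormal_toLp μ (fun i => (w i : C(K, ℂ))) hC ?_ fun a => ?_)
  · convert! ho using 1
    exact funext hw
  · exact hY _ (Y.sum_mem fun i _ => Y.smul_mem _ (w i).2)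

end toLp

theorem not_isCompactOperator_toLp_haarAddCircle :
    ¬IsCompactOperator
      (ContinuousMap.toLp 2 AddCircle.haarAddCircle ℝ :
        C(UnitAddCircle, ℂ) →L[ℝ] Lp ℂ 2 AddCircle.haarAddCircle) := by
  intro h
  obtain ⟨K, hK, hsub⟩ := IsCompactOperator.image_closedBall_subset_compact
    (f := (ContinuousMap.toLp 2 AddCircle.haarAddCircle ℝ :
        C(UnitAddCircle, ℂ) →L[ℝ] Lp ℂ 2 AddCircle.haarAddCircle).toLinearMap) h 1
  have hmem : ∀ n : ℕ, fourierLp (T := 1) 2 (n : ℤ) ∈ K := fun n =>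
    hsub ⟨fourier n, by simp [fourier_norm], rfl⟩
  obtain ⟨x, -, φ, hφ, hx⟩ := hK.isSeqCompact hmem
  obtain ⟨N, hN⟩ := Metric.cauchySeq_iff'.1 hx.cauchySeq 1 one_pos
  have hd := hN (N + 1) (Nat.le_succ N)
  have hne : ((φ (N + 1) : ℕ) : ℤ) ≠ (φ N : ℕ) := by
    exact_mod_cast (hφ (Nat.lt_succ_self N)).ne'
  have ho := orthonormal_fourier (T := 1)
  have h2 := @norm_sub_sq ℂ _ _ _ _ (fourierLp (T := 1) 2 ((φ (N + 1) : ℕ) : ℤ))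
    (fourierLp (T := 1) 2 ((φ N : ℕ) : ℤ))
  rw [ho.2 hne, ho.1, ho.1] at h2
  rw [dist_eq_norm] at hd
  simp only [Function.comp_apply] at hd
  simp only [map_zero] at h2
  nlinarith [norm_nonneg (fourierLp (T := 1) 2 ((φ (N + 1) : ℕ) : ℤ) -
    fourierLp (T := 1) 2 ((φ N : ℕ) : ℤ))]

section shift

/-- The nilpotent right shift on `Fin k → ℝ`. -/
noncomputable def finShift (k : ℕ) : (Fin k → ℝ) →L[ℝ] (Fin k → ℝ) :=
  ContinuousLinearMap.pi fun i =>
    if 1 ≤ (i : ℕ) then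
      ContinuousLinearMap.proj (⟨i - 1, (Nat.sub_le _ _).trans_lt i.2⟩ : Fin k)
    else 0

theorem finShift_apply (k : ℕ) (v : Fin k → ℝ) (i : Fin k) :
    finShift k v i = if 1 ≤ (i : ℕ) then v ⟨i - 1, (Nat.sub_le _ _).trans_lt i.2⟩ else 0 := by
  simp only [finShift, ContinuousLinearMap.pi_apply]
  split_ifs <;> rfl

theorem norm_finShift_apply_le (k : ℕ) (v : Fin k → ℝ) : ‖finShift k v‖ ≤ ‖v‖ := by
  refine (pi_norm_le_iff_of_nonneg (norm_nonneg v)).2 fun i => ?_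
  rw [finShift_apply]
  split_ifs
  · exact norm_le_pi_norm v _
  · simp

theorem finShift_pow_apply (k j : ℕ) (v : Fin k → ℝ) (i : Fin k) :
    (finShift k ^ j) v i =
      if j ≤ (i : ℕ) then v ⟨i - j, (Nat.sub_le _ _).trans_lt i.2⟩ else 0 := by
  induction j generalizing i with
  | zero => simp
  | succ j ih =>
    rw [pow_succ', mul_apply_eq_comp, finShift_apply]
    split_ifs with h1 h2 h2
    · rw [ih, if_pos (by simp only; omega)]
      congr 2
      simp only
      omega
    · rw [ih, if_neg (by simp only; omega)]
    · omega
    · rfl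

theorem finShift_pow_self (k : ℕ) : finShift k ^ k = 0 := by
  ext v i
  rw [finShift_pow_apply, if_neg (by omega)]
  rfl

theorem finShift_pow_pred_ne_zero {k : ℕ} (hk : 0 < k) : finShift k ^ (k - 1) ≠ 0 := by
  intro h
  have := congrFun (DFunLike.congr_fun h fun _ => 1) ⟨k - 1, by omega⟩
  rw [finShift_pow_apply, if_pos le_rfl] at this
  simp at this

end shift

section sum

variable {A B E : Type*} [NormedAddCommGroup A] [NormedSpace ℝ A] [NormedAddCommGroup B]
  [NormedSpace ℝ B] [NormedAddCommGroup E] [NormedSpace ℝ E]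

/-- The operator `(a, b, e) ↦ (0, J a, N e)`. -/
noncomputable def offDiagSum (J : A →L[ℝ] B) (N : E →L[ℝ] E) : A × B × E →L[ℝ] A × B × E :=
  (0 : A × B × E →L[ℝ] A).prod ((J.comp (ContinuousLinearMap.fst ℝ A (B × E))).prod
    (N.comp ((ContinuousLinearMap.snd ℝ B E).comp (ContinuousLinearMap.snd ℝ A (B × E)))))

theorem offDiagSum_apply (J : A →L[ℝ] B) (N : E →L[ℝ] E) (x : A × B × E) :
    offDiagSum J N x = (0, J x.1, N x.2.2) := rfl

theorem norm_offDiagSum_le (J : A →L[ℝ] B) (N : E →L[ℝ] E) (hJ : ∀ a, ‖J a‖ ≤ ‖a‖)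
    (hN : ∀ e, ‖N e‖ ≤ ‖e‖) : ‖offDiagSum J N‖ ≤ 1 := by
  refine ContinuousLinearMap.opNorm_le_bound _ zero_le_one fun x => ?_
  rw [one_mul, offDiagSum_apply, norm_prod_le_iff, norm_prod_le_iff]
  refine ⟨by simp, (hJ _).trans (norm_fst_le x), (hN _).trans ?_⟩
  exact (norm_snd_le x.2).trans (norm_snd_le x)

theorem offDiagSum_pow_apply_snd_snd (J : A →L[ℝ] B) (N : E →L[ℝ] E) (j : ℕ) (x : A × B × E) :
    ((offDiagSum J N ^ j) x).2.2 = (N ^ j) x.2.2 := by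
  induction j with
  | zero => simp
  | succ j ih =>
    rw [pow_succ', mul_apply_eq_comp, offDiagSum_apply, pow_succ',
      mul_apply_eq_comp, ih]

theorem offDiagSum_pow_add_two_apply (J : A →L[ℝ] B) (N : E →L[ℝ] E) (j : ℕ) (x : A × B × E) :
    (offDiagSum J N ^ (j + 2)) x = (0, 0, (N ^ (j + 2)) x.2.2) := by
  have h := offDiagSum_pow_apply_snd_snd J N (j + 2) x
  rw [← h, pow_succ', pow_succ', mul_apply_eq_comp, mul_apply_eq_comp,
    offDiagSum_apply _ _ (offDiagSum J N _), offDiagSum_apply, map_zero]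

theorem offDiagSum_not_isCompactOperator {J : A →L[ℝ] B} (N : E →L[ℝ] E)
    (hJ : ¬IsCompactOperator J) : ¬IsCompactOperator (offDiagSum J N) := fun h =>
  hJ ((h.comp_clm (ContinuousLinearMap.inl ℝ A (B × E))).clm_comp
    ((ContinuousLinearMap.fst ℝ B E).comp (ContinuousLinearMap.snd ℝ A (B × E))))

theorem strictlySingular_offDiagSum [FiniteDimensional ℝ E] {J : A →L[ℝ] B} (N : E →L[ℝ] E)
    (hJ : ∀ Y : Submodule ℝ A, ∀ c : ℝ, 0 < c → (∀ y ∈ Y, c * ‖y‖ ≤ ‖J y‖) →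
      FiniteDimensional ℝ Y) : StrictlySingular (offDiagSum J N) := by
  intro Y hY c hc
  by_contra! h
  let q : A × B × E →ₗ[ℝ] E := LinearMap.snd ℝ B E ∘ₗ LinearMap.snd ℝ A (B × E)
  have key : ∀ z ∈ Y ⊓ LinearMap.ker q, c * ‖z‖ ≤ ‖J z.1‖ := by
    rintro z ⟨hzY, hzq⟩
    have hz : z.2.2 = 0 := hzq
    have := h z hzY
    rw [offDiagSum_apply, hz, map_zero] at this
    simpa [Prod.norm_def] using this
  have hfst : FiniteDimensional ℝ ((Y ⊓ LinearMap.ker q).map (LinearMap.fst ℝ A (B × E))) := by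
    refine hJ _ c hc ?_
    rintro _ ⟨z, hz, rfl⟩
    exact (mul_le_mul_of_nonneg_left (norm_fst_le z) hc.le).trans (key z hz)
  have hker : (Y ⊓ LinearMap.ker q) ⊓ LinearMap.ker (LinearMap.fst ℝ A (B × E)) = ⊥ := by
    rw [eq_bot_iff]
    rintro z ⟨hz, hz1⟩
    have hz1 : z.1 = 0 := hz1
    have := key z hz
    rw [hz1, map_zero, norm_zero] at this
    have : ‖z‖ ≤ 0 := by nlinarith
    exact norm_le_zero_iff.1 this
  refine hY (Module.Finite.iff_fg.2 (Submodule.fg_of_fg_map_of_fg_inf_ker q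
    (IsNoetherian.noetherian _) (Submodule.fg_of_fg_map_of_fg_inf_ker
      (LinearMap.fst ℝ A (B × E)) (Module.Finite.iff_fg.1 hfst) ?_)))
  rw [hker]
  exact Submodule.fg_bot

end sum

theorem stmt0 (k : ℕ) (hk : 2 ≤ k) :
    ∃ (X : Type) (_ : NormedAddCommGroup X) (_ : NormedSpace ℝ X),
      CompleteSpace X ∧ TopologicalSpace.SeparableSpace X ∧ ¬FiniteDimensional ℝ X ∧
      ∃ S : X →L[ℝ] X, ‖S‖ ≤ 1 ∧ S ^ k = 0 ∧ S ^ (k - 1) ≠ 0 ∧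
        ¬IsCompactOperator S ∧ StrictlySingular S := by
  let J : C(UnitAddCircle, ℂ) →L[ℝ] Lp ℂ 2 AddCircle.haarAddCircle :=
    ContinuousMap.toLp 2 AddCircle.haarAddCircle ℝ
  have hJ1 : ∀ f, ‖J f‖ ≤ ‖f‖ := fun f => by
    have h : ‖J‖ ≤ 1 := by
      simpa [measureUnivNNReal] using ContinuousMap.toLp_norm_le (𝕜 := ℝ) (p := 2) (E := ℂ)
        (AddCircle.haarAddCircle (T := 1))
    simpa using J.le_of_opNorm_le h f
  have hnc : ¬IsCompactOperator (offDiagSum J (finShift k)) :=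
    offDiagSum_not_isCompactOperator _ not_isCompactOperator_toLp_haarAddCircle
  have : Fact ((2 : ENNReal) ≠ ⊤) := ⟨by simp⟩
  have hsep : TopologicalSpace.SeparableSpace (Lp ℂ 2 (AddCircle.haarAddCircle (T := 1))) :=
    inferInstance
  have hsepC : TopologicalSpace.SeparableSpace C(UnitAddCircle, ℂ) := inferInstance
  refine ⟨C(UnitAddCircle, ℂ) × Lp ℂ 2 (AddCircle.haarAddCircle (T := 1)) × (Fin k → ℝ),
    inferInstance, inferInstance, inferInstance, inferInstance, fun hfin => ?_,
    offDiagSum J (finShift k), norm_offDiagSum_le _ _ hJ1 (norm_finShift_apply_le k), ?_,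
    fun h => finShift_pow_pred_ne_zero (by omega : 0 < k) ?_, hnc,
    strictlySingular_offDiagSum _ fun Y c hc hY => ?_⟩
  · have := FiniteDimensional.proper_real
      (C(UnitAddCircle, ℂ) × Lp ℂ 2 (AddCircle.haarAddCircle (T := 1)) × (Fin k → ℝ))
    exact hnc (isCompactOperator_of_locallyCompactSpace_dom _)
  · obtain ⟨j, rfl⟩ := Nat.exists_eq_add_of_le' hk
    refine ContinuousLinearMap.ext fun x => ?_
    rw [offDiagSum_pow_add_two_apply, finShift_pow_self]
    rfl
  · refine ContinuousLinearMap.ext fun v => ?_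
    have := offDiagSum_pow_apply_snd_snd J (finShift k) (k - 1) (0, 0, v)
    rw [h] at this
    exact this.symm
  · refine finiteDimensional_of_norm_le_toLp AddCircle.haarAddCircle Y (inv_nonneg.2 hc.le)
      fun y hy => ?_
    rw [inv_mul_eq_div, le_div_iff₀' hc]
    exact hY y hy
end

section
/- For every natural number k ≥ 2 there exist an infinite-dimensional separable real Banach space X and a bounded linear operator S : X → X with S^k = 0, S^(k-1) ≠ 0, S strictly singular and not compact, such that for every bounded linear operator T : X → X there exist scalars λ_0, …, λ_{k-1} ∈ ℝ and a compact operator K : X → X with T = ∑_{i=0}^{k-1} λ_i S^i + K. -/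
/-!
A Bourgain-Delbaen space over the dual numbers: a module of bounded sequences, determined by a
sequence of nodes, on which every bounded operator is multiplication by a dual number plus a
compact operator. Multiplication by `ε` is strictly singular, not compact, and squares to zero.
-/

namespace BourgainDelbaen

open Filter Topology Finset

set_option linter.unusedSectionVars false

/-- The reciprocals of the weights. -/
def mm (j : ℕ) : ℝ := 4 ^ (2 ^ j)

/-- The bounds obtained by iterating the growth estimate. -/
def kap (N : ℕ) : ℕ → ℕ
  | 0 => 13
  | s + 1 => 13 + N * (6 + kap N s)

/-- The maximal ages. -/
def nn : ℕ → ℕ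
  | 0 => 1
  | j + 1 => nn j + (4 ^ (2 ^ (j + 1))) ^ 2 * (kap (nn j) (2 ^ (j + 2) + 1) + 10)
      + (j + 1) ^ (2 ^ (j + 2) + 10)

/-- The least admissible weight index of the coordinates used by coded nodes. -/
def ll (j : ℕ) : ℕ := nn j + 10

theorem kap_succ (N s : ℕ) : kap N (s + 1) = 13 + N * (6 + kap N s) := rfl

theorem nn_zero : nn 0 = 1 := rfl

theorem nn_succ (j : ℕ) : nn (j + 1) = nn j +
    (4 ^ (2 ^ (j + 1))) ^ 2 * (kap (nn j) (2 ^ (j + 2) + 1) + 10) +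
      (j + 1) ^ (2 ^ (j + 2) + 10) := rfl

attribute [irreducible] mm kap nn ll

/-- The data attached to a coordinate. -/
structure Node (A : Type*) where
  wt : ℕ
  age : ℕ
  pre : Option ℕ
  cut : ℕ
  fn : ℕ → A

section Ext

variable {A : Type*} [NormedCommRing A] [NormedAlgebra ℝ A]

/-- The extension of the first `p` coordinates of `x` determined by the nodes. -/
noncomputable def extAux (ν : ℕ → Node A) (x : ℕ → A) (γ : ℕ) : ℕ → A := fun p =>
  if γ < p then x γ else
    (match (ν γ).pre with
      | some ξ => if _h : ξ < γ then extAux ν x ξ p else 0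
      | none => 0) +
    (mm (ν γ).wt)⁻¹ • ∑ η : Fin γ, (ν γ).fn η *
      (extAux ν x η p - extAux ν x η (min p (ν γ).cut))
termination_by γ
decreasing_by
  · exact _h
  · exact η.2
  · exact η.2

noncomputable def ext (ν : ℕ → Node A) (p : ℕ) (x : ℕ → A) : ℕ → A := fun γ => extAux ν x γ p

/-- The contribution of the predecessor. -/
def preVal (ν : ℕ → Node A) (x : ℕ → A) (γ : ℕ) : A :=
  match (ν γ).pre with
  | some ξ => x ξ
  | none => 0

/-- The pairing of `x` with the functional stored in a node. -/
noncomputable def pair (ν : ℕ → Node A) (x : ℕ → A) (γ : ℕ) : A :=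
  ∑ η ∈ range γ, (ν γ).fn η * x η

/-- Validity of a system of nodes. -/
structure Adm (ν : ℕ → Node A) : Prop where
  wt_le : ∀ γ, (ν γ).wt ≤ γ
  cut_le : ∀ γ, (ν γ).cut ≤ γ
  fn_le : ∀ γ, ∑ η ∈ range γ, ‖(ν γ).fn η‖ ≤ 1
  pre_lt : ∀ γ ξ, (ν γ).pre = some ξ → ξ < (ν γ).cut
  pre_wt : ∀ γ ξ, (ν γ).pre = some ξ → (ν ξ).wt = (ν γ).wt
  pre_age : ∀ γ ξ, (ν γ).pre = some ξ → (ν γ).age = (ν ξ).age + 1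
  none_age : ∀ γ, (ν γ).pre = none → (ν γ).age = 1
  age_le : ∀ γ, (ν γ).age ≤ nn (ν γ).wt
  coded : ∀ γ, (ν γ).wt % 2 = 1 → ∃ η < γ, (ν γ).fn = Pi.single η 1 ∧
    ll (ν γ).wt ≤ (ν η).wt ∧ ((ν γ).pre = none → (ν η).wt % 4 = 2) ∧
    ∀ ξ, (ν γ).pre = some ξ → (ν η).wt = 4 * ξ + 4

theorem one_le_mm (j : ℕ) : 1 ≤ mm j := by
  rw [mm]; exact one_le_pow₀ (by norm_num)

theorem four_le_mm (j : ℕ) : 4 ≤ mm j := by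
  unfold mm
  calc (4 : ℝ) = 4 ^ 1 := by norm_num
    _ ≤ 4 ^ (2 ^ j) := pow_le_pow_right₀ (by norm_num) Nat.one_le_two_pow

theorem mm_pos (j : ℕ) : 0 < mm j := by linarith [one_le_mm j]

theorem mm_mono : Monotone mm := fun _ _ h => by
  rw [mm, mm]
  exact pow_le_pow_right₀ (by norm_num) (Nat.pow_le_pow_right (by norm_num) h)

theorem mm_succ (j : ℕ) : mm (j + 1) = mm j ^ 2 := by
  unfold mm; rw [← pow_mul, pow_succ]

theorem mm_sq_le {j l : ℕ} (h : j < l) : mm j ^ 2 ≤ mm l := by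
  rw [← mm_succ]; exact mm_mono h

variable {ν : ℕ → Node A}

theorem ext_of_lt {p γ : ℕ} (x : ℕ → A) (h : γ < p) : ext ν p x γ = x γ := by
  unfold ext; rw [extAux]; simp [h]

theorem Adm.pre_lt_self (hν : Adm ν) {γ ξ : ℕ} (h : (ν γ).pre = some ξ) : ξ < γ :=
  (hν.pre_lt γ ξ h).trans_le (hν.cut_le γ)

theorem ext_of_le (hν : Adm ν) {p γ : ℕ} (x : ℕ → A) (h : p ≤ γ) :
    ext ν p x γ = preVal ν (ext ν p x) γ +
      (mm (ν γ).wt)⁻¹ • pair ν (ext ν p x - ext ν (min p (ν γ).cut) x) γ := by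
  unfold ext pair preVal; rw [extAux]
  rw [if_neg (not_lt.2 h), Finset.sum_range]
  congr 1
  cases hp : (ν γ).pre with
  | none => rfl
  | some ξ => simp [hν.pre_lt_self hp]

theorem preVal_congr (hν : Adm ν) {γ : ℕ} {x y : ℕ → A} (h : ∀ η < γ, x η = y η) :
    preVal ν x γ = preVal ν y γ := by
  unfold preVal
  cases hp : (ν γ).pre with
  | none => rfl
  | some ξ => exact h _ (hν.pre_lt_self hp)

theorem pair_congr {γ : ℕ} {x y : ℕ → A} (h : ∀ η < γ, x η = y η) :
    pair ν x γ = pair ν y γ :=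
  Finset.sum_congr rfl fun η hη => by rw [h η (mem_range.1 hη)]

theorem norm_pair_le (hν : Adm ν) {γ : ℕ} {x : ℕ → A} {C : ℝ} (hC : 0 ≤ C)
    (h : ∀ η < γ, ‖x η‖ ≤ C) : ‖pair ν x γ‖ ≤ C := by
  calc ‖pair ν x γ‖ ≤ ∑ η ∈ range γ, ‖(ν γ).fn η‖ * C :=
        norm_sum_le_of_le _ fun η hη => (norm_mul_le _ _).trans
          (mul_le_mul_of_nonneg_left (h η (mem_range.1 hη)) (norm_nonneg _))
    _ = (∑ η ∈ range γ, ‖(ν γ).fn η‖) * C := by rw [Finset.sum_mul]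
    _ ≤ 1 * C := mul_le_mul_of_nonneg_right (hν.fn_le γ) hC
    _ = C := one_mul C

theorem preVal_add (x y : ℕ → A) (γ : ℕ) : preVal ν (x + y) γ = preVal ν x γ + preVal ν y γ := by
  unfold preVal; cases (ν γ).pre <;> simp

theorem preVal_smul (a : A) (x : ℕ → A) (γ : ℕ) : preVal ν (a • x) γ = a * preVal ν x γ := by
  unfold preVal; cases (ν γ).pre <;> simp

theorem pair_add (x y : ℕ → A) (γ : ℕ) : pair ν (x + y) γ = pair ν x γ + pair ν y γ := by
  simp [pair, mul_add, Finset.sum_add_distrib]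

theorem pair_smul (a : A) (x : ℕ → A) (γ : ℕ) : pair ν (a • x) γ = a * pair ν x γ := by
  simp [pair, Finset.mul_sum, mul_left_comm]

theorem ext_congr (hν : Adm ν) {p : ℕ} {x y : ℕ → A} (h : ∀ η < p, x η = y η) :
    ext ν p x = ext ν p y := by
  have key : ∀ γ p, (∀ η < p, x η = y η) → ext ν p x γ = ext ν p y γ := by
    intro γ
    induction γ using Nat.strong_induction_on with
    | _ γ ih =>
      intro p h
      rcases lt_or_ge γ p with hp | hp
      · rw [ext_of_lt _ hp, ext_of_lt _ hp, h _ hp]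
      · rw [ext_of_le hν _ hp, ext_of_le hν _ hp]
        congr 1
        · exact preVal_congr hν fun η hη => ih η hη p h
        · congr 1
          refine pair_congr fun η hη => ?_
          simp only [Pi.sub_apply]
          rw [ih η hη p h, ih η hη _ fun ζ hζ => h ζ (hζ.trans_le (min_le_left _ _))]
  exact funext fun γ => key γ p h

theorem ext_ext (hν : Adm ν) (p q : ℕ) (x : ℕ → A) :
    ext ν p (ext ν q x) = ext ν (min p q) x := by
  have key : ∀ γ p, ext ν p (ext ν q x) γ = ext ν (min p q) x γ := by
    intro γ
    induction γ using Nat.strong_induction_on with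
    | _ γ ih =>
      intro p
      rcases le_or_gt p q with hpq | hpq
      · rw [min_eq_left hpq]
        exact congrFun (ext_congr hν fun η hη => ext_of_lt _ (hη.trans_le hpq)) γ
      · rw [min_eq_right hpq.le]
        rcases lt_or_ge γ p with hp | hp
        · exact ext_of_lt _ hp
        · rw [ext_of_le hν _ hp, ext_of_le hν _ (hpq.le.trans hp)]
          have e1 : ∀ η < γ, ext ν p (ext ν q x) η = ext ν q x η := fun η hη => by
            rw [ih η hη, min_eq_right hpq.le]
          congr 1
          · exact preVal_congr hν e1
          · congr 1
            refine pair_congr fun η hη => ?_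
            simp only [Pi.sub_apply]
            rw [e1 η hη, ih η hη]
            rw [show min (min p (ν γ).cut) q = min q (ν γ).cut by omega]
  exact funext fun γ => key γ p

theorem ext_add (hν : Adm ν) (p : ℕ) (x y : ℕ → A) :
    ext ν p (x + y) = ext ν p x + ext ν p y := by
  have key : ∀ γ p, ext ν p (x + y) γ = (ext ν p x + ext ν p y) γ := by
    intro γ
    induction γ using Nat.strong_induction_on with
    | _ γ ih =>
      intro p
      rcases lt_or_ge γ p with hp | hp
      · simp [ext_of_lt _ hp]
      · rw [Pi.add_apply, ext_of_le hν _ hp, ext_of_le hν x hp, ext_of_le hν y hp,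
          preVal_congr hν fun η hη => ih η hη p, preVal_add,
          pair_congr (y := (ext ν p x - ext ν (min p (ν γ).cut) x) +
            (ext ν p y - ext ν (min p (ν γ).cut) y)) fun η hη => by
              simp only [Pi.sub_apply, Pi.add_apply, ih η hη]; ring, pair_add, smul_add]
        abel
  exact funext fun γ => key γ p

theorem ext_smul (hν : Adm ν) (p : ℕ) (a : A) (x : ℕ → A) :
    ext ν p (a • x) = a • ext ν p x := by
  have key : ∀ γ p, ext ν p (a • x) γ = (a • ext ν p x) γ := by
    intro γ
    induction γ using Nat.strong_induction_on with
    | _ γ ih =>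
      intro p
      rcases lt_or_ge γ p with hp | hp
      · simp [ext_of_lt _ hp]
      · rw [Pi.smul_apply, ext_of_le hν _ hp, ext_of_le hν x hp,
          preVal_congr hν fun η hη => ih η hη p, preVal_smul,
          pair_congr (y := a • (ext ν p x - ext ν (min p (ν γ).cut) x)) fun η hη => by
              simp only [Pi.sub_apply, Pi.smul_apply, ih η hη, smul_sub], pair_smul, smul_add,
          smul_eq_mul, smul_eq_mul, mul_smul_comm]
  exact funext fun γ => key γ p

/-- The extension operator as a linear map. -/
noncomputable def extL (hν : Adm ν) (p : ℕ) : (ℕ → A) →ₗ[A] (ℕ → A) where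
  toFun := ext ν p
  map_add' := ext_add hν p
  map_smul' := ext_smul hν p

theorem ext_zero (hν : Adm ν) (p : ℕ) : ext ν p (0 : ℕ → A) = 0 := (extL hν p).map_zero

theorem ext_sub (hν : Adm ν) (p : ℕ) (x y : ℕ → A) :
    ext ν p (x - y) = ext ν p x - ext ν p y := (extL hν p).map_sub x y

theorem ext_sum (hν : Adm ν) (p : ℕ) {ι : Type*} (s : Finset ι) (x : ι → ℕ → A) :
    ext ν p (∑ i ∈ s, x i) = ∑ i ∈ s, ext ν p (x i) := map_sum (extL hν p) x s

theorem ext_rsmul (hν : Adm ν) (p : ℕ) (c : ℝ) (x : ℕ → A) :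
    ext ν p (c • x) = c • ext ν p x := by
  have h : ∀ y : ℕ → A, c • y = (algebraMap ℝ A c) • y := fun y => by
    funext γ; simp [Algebra.smul_def]
  rw [h, h, ext_smul hν]

theorem norm_preVal_le (hν : Adm ν) {γ : ℕ} {x : ℕ → A} {C : ℝ} (hC : 0 ≤ C)
    (h : ∀ η < (ν γ).cut, ‖x η‖ ≤ C) : ‖preVal ν x γ‖ ≤ C := by
  unfold preVal
  cases hp : (ν γ).pre with
  | none => simpa using hC
  | some ξ => exact h _ (hν.pre_lt γ ξ hp)

theorem norm_inv_mm_smul_le (j : ℕ) {a : A} {C : ℝ} (h : ‖a‖ ≤ C) :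
    ‖(mm j)⁻¹ • a‖ ≤ (mm j)⁻¹ * C := by
  rw [norm_smul, norm_inv, Real.norm_of_nonneg (mm_pos j).le]
  exact mul_le_mul_of_nonneg_left h (inv_nonneg.2 (mm_pos j).le)

theorem inv_mm_le (j : ℕ) : (mm j)⁻¹ ≤ 1 / 4 := by
  rw [one_div]; exact inv_anti₀ (by norm_num) (four_le_mm j)

theorem norm_ext_le (hν : Adm ν) {p : ℕ} {x : ℕ → A} {C : ℝ} (hC : 0 ≤ C)
    (h : ∀ η < p, ‖x η‖ ≤ C) (γ : ℕ) : ‖ext ν p x γ‖ ≤ 2 * C := by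
  have key : ∀ γ p, (∀ η < p, ‖x η‖ ≤ C) → ‖ext ν p x γ‖ ≤ 2 * C := by
    intro γ
    induction γ using Nat.strong_induction_on with
    | _ γ ih =>
      intro p h
      rcases lt_or_ge γ p with hp | hp
      · rw [ext_of_lt _ hp]; linarith [h γ hp]
      · rw [ext_of_le hν _ hp]
        rcases le_or_gt p (ν γ).cut with hc | hc
        · rw [min_eq_left hc, sub_self]
          have : pair ν (0 : ℕ → A) γ = 0 := by simp [pair]
          rw [this, smul_zero, add_zero]
          exact norm_preVal_le hν (by linarith) fun η hη =>
            ih η (hη.trans_le (hν.cut_le γ)) p h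
        · have h1 : ‖preVal ν (ext ν p x) γ‖ ≤ C := norm_preVal_le hν hC fun η hη => by
            rw [ext_of_lt _ (hη.trans hc)]; exact h η (hη.trans hc)
          have h2 : ‖pair ν (ext ν p x - ext ν (min p (ν γ).cut) x) γ‖ ≤ 4 * C :=
            norm_pair_le hν (by linarith) fun η hη => by
              refine (norm_sub_le _ _).trans ?_
              linarith [ih η hη p h, ih η hη (min p (ν γ).cut) fun ζ hζ =>
                h ζ (hζ.trans_le (min_le_left _ _))]
          have h3 := norm_inv_mm_smul_le (ν γ).wt h2
          have h4 := mul_le_mul_of_nonneg_right (inv_mm_le (ν γ).wt) (by linarith : 0 ≤ 4 * C)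
          refine (norm_add_le _ _).trans ?_
          linarith
  exact key γ p h

/-- The biorthogonal functionals. -/
noncomputable def dst (ν : ℕ → Node A) (γ : ℕ) (x : ℕ → A) : A := x γ - ext ν γ x γ

theorem eq_dst_add (hν : Adm ν) (x : ℕ → A) (γ : ℕ) :
    x γ = dst ν γ x + preVal ν x γ + (mm (ν γ).wt)⁻¹ • pair ν (x - ext ν (ν γ).cut x) γ := by
  have h1 : ext ν γ x γ = preVal ν x γ +
      (mm (ν γ).wt)⁻¹ • pair ν (x - ext ν (ν γ).cut x) γ := by
    rw [ext_of_le hν _ le_rfl, min_eq_right (hν.cut_le γ)]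
    congr 1
    · exact preVal_congr hν fun η hη => ext_of_lt _ hη
    · congr 1
      exact pair_congr fun η hη => by simp [ext_of_lt _ hη]
  rw [dst, h1]; abel

theorem dst_sum (hν : Adm ν) (γ : ℕ) {ι : Type*} (s : Finset ι) (x : ι → ℕ → A) :
    dst ν γ (∑ i ∈ s, x i) = ∑ i ∈ s, dst ν γ (x i) := by
  simp [dst, ext_sum hν]

theorem norm_dst_le (hν : Adm ν) (γ : ℕ) {x : ℕ → A} {C : ℝ} (hC : 0 ≤ C)
    (h : ∀ γ, ‖x γ‖ ≤ C) : ‖dst ν γ x‖ ≤ 3 * C := by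
  refine (norm_sub_le _ _).trans ?_
  linarith [h γ, norm_ext_le hν hC (fun η (_ : η < γ) => h η) γ]

theorem ext_eq_self_of_le (hν : Adm ν) {q r : ℕ} {x : ℕ → A} (h : ext ν q x = x) (hqr : q ≤ r) :
    ext ν r x = x := by
  conv_lhs => rw [← h]
  rw [ext_ext hν, min_eq_right hqr, h]

theorem eq_zero_of_ext_eq_zero {p : ℕ} {x : ℕ → A} (h : ext ν p x = 0) {γ : ℕ}
    (hγ : γ < p) : x γ = 0 := by
  rw [← ext_of_lt (ν := ν) x hγ, h]; rfl

theorem ext_eq_zero_of_le (hν : Adm ν) {p r : ℕ} {x : ℕ → A} (h : ext ν p x = 0) (hr : r ≤ p) :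
    ext ν r x = 0 := by
  rw [ext_congr hν (y := 0) fun η hη => eq_zero_of_ext_eq_zero h (hη.trans_le hr), ext_zero hν]

theorem ext_eq_zero_iff (hν : Adm ν) {p : ℕ} {x : ℕ → A} :
    ext ν p x = 0 ↔ ∀ γ < p, x γ = 0 :=
  ⟨fun h _ hγ => eq_zero_of_ext_eq_zero h hγ, fun h => by
    rw [ext_congr hν (y := 0) h, ext_zero hν]⟩

theorem dst_eq_zero_of_le (hν : Adm ν) {q γ : ℕ} {x : ℕ → A} (h : ext ν q x = x) (hq : q ≤ γ) :
    dst ν γ x = 0 := by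
  rw [dst, ext_eq_self_of_le hν h hq, sub_self]

theorem dst_eq_zero_of_lt (hν : Adm ν) {p γ : ℕ} {x : ℕ → A} (h : ext ν p x = 0) (hp : γ < p) :
    dst ν γ x = 0 := by
  rw [dst, ext_eq_zero_of_le hν h hp.le, eq_zero_of_ext_eq_zero h hp]; simp

end Ext

theorem nn_mono : Monotone nn := monotone_nat_of_le_succ fun j => by
  rw [nn_succ]; omega

theorem one_le_nn (j : ℕ) : 1 ≤ nn j := (by rw [nn_zero] : 1 ≤ nn 0).trans (nn_mono (Nat.zero_le j))

theorem mm_sq_mul_le_nn {j : ℕ} (hj : 1 ≤ j) :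
    mm j ^ 2 * (kap (nn (j - 1)) (2 ^ (j + 1) + 1) + 10) ≤ nn j := by
  obtain ⟨i, rfl⟩ : ∃ i, j = i + 1 := ⟨j - 1, by omega⟩
  have h : (4 ^ (2 ^ (i + 1))) ^ 2 * (kap (nn i) (2 ^ (i + 2) + 1) + 10) ≤ nn (i + 1) := by
    rw [nn_succ]; omega
  have h' := (Nat.cast_le (α := ℝ)).2 h
  push_cast at h'
  simpa [mm] using h'

theorem pow_le_nn {j n : ℕ} (hj : n + 1 ≤ j) : n ^ (2 ^ (j + 1) + 10) ≤ nn j := by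
  obtain ⟨i, rfl⟩ : ∃ i, j = i + 1 := ⟨j - 1, by omega⟩
  rw [nn_succ]
  calc n ^ (2 ^ (i + 2) + 10) ≤ (i + 1) ^ (2 ^ (i + 2) + 10) := Nat.pow_le_pow_left (by omega) _
    _ ≤ _ := by omega

theorem four_pow_eq_mm_sq (j : ℕ) : (4 : ℝ) ^ (2 ^ (j + 1)) = mm j ^ 2 := by
  unfold mm; rw [← pow_mul, pow_succ]

theorem two_pow_eq_mm (j : ℕ) : (2 : ℝ) ^ (2 ^ (j + 1)) = mm j := by
  unfold mm; rw [pow_succ, mul_comm, pow_mul]; norm_num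

theorem norm_sum_le_of_unique {ι A : Type*} [SeminormedAddCommGroup A] {s : Finset ι} {f : ι → A}
    {B : ℝ} (hB : 0 ≤ B) (h : ∀ i ∈ s, ‖f i‖ ≤ B)
    (hu : ∀ i ∈ s, ∀ k ∈ s, f i ≠ 0 → f k ≠ 0 → i = k) : ‖∑ i ∈ s, f i‖ ≤ B := by
  by_cases h0 : ∃ i ∈ s, f i ≠ 0
  · obtain ⟨i, hi, hne⟩ := h0
    rw [Finset.sum_eq_single_of_mem i hi fun k hk hki => by
      by_contra hk0; exact hki (hu k hk i hi hk0 hne)]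
    exact h i hi
  · push Not at h0
    rw [Finset.sum_eq_zero h0]; simpa using hB

section

variable {A : Type*} [NormedCommRing A] [NormedAlgebra ℝ A] {ν : ℕ → Node A}

/-- A vector whose local support avoids the weight `l` is small on the coordinates of weight `l`. -/
theorem norm_le_of_local_support (hν : Adm ν) {q l : ℕ} {x : ℕ → A} {C : ℝ} (hC : 0 ≤ C)
    (hq : ext ν q x = x) (hx : ∀ γ, ‖x γ‖ ≤ C) (h0 : ∀ η < q, (ν η).wt = l → x η = 0) :
    ∀ γ, (ν γ).wt = l → ‖x γ‖ ≤ 3 * C / mm l := by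
  have hpos : 0 ≤ 3 * C / mm l := div_nonneg (by linarith) (mm_pos l).le
  intro γ
  induction γ using Nat.strong_induction_on with
  | _ γ ih =>
    intro hl
    rcases lt_or_ge γ q with hγ | hγ
    · rw [h0 γ hγ hl]; simpa using hpos
    · rw [eq_dst_add hν x γ, dst_eq_zero_of_le hν hq hγ, zero_add]
      rcases le_or_gt q (ν γ).cut with hc | hc
      · have : pair ν (x - ext ν (ν γ).cut x) γ = 0 := by
          rw [ext_eq_self_of_le hν hq hc, sub_self]; simp [pair]
        rw [this, smul_zero, add_zero]
        unfold preVal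
        cases hp : (ν γ).pre with
        | none => simpa using hpos
        | some ξ => exact ih ξ (hν.pre_lt_self hp) ((hν.pre_wt γ ξ hp).trans hl)
      · have : preVal ν x γ = 0 := by
          unfold preVal
          cases hp : (ν γ).pre with
          | none => rfl
          | some ξ => exact h0 ξ ((hν.pre_lt γ ξ hp).trans hc) ((hν.pre_wt γ ξ hp).trans hl)
        rw [this, zero_add]
        have h2 : ‖pair ν (x - ext ν (ν γ).cut x) γ‖ ≤ 3 * C :=
          norm_pair_le hν (by linarith) fun η _ => by
            refine (norm_sub_le _ _).trans ?_
            linarith [hx η, norm_ext_le hν hC (p := (ν γ).cut) (fun ζ _ => hx ζ) η]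
        have h3 := norm_inv_mm_smul_le (ν γ).wt h2
        rw [hl] at h3 ⊢
        rw [div_eq_inv_mul]; exact h3

/-- Bounded block families. -/
structure Block (ν : ℕ → Node A) (C : ℝ) (I : Set ℕ) (x : ℕ → ℕ → A) (p q : ℕ → ℕ) : Prop where
  nonneg : 0 ≤ C
  sep : ∀ i ∈ I, ∀ k ∈ I, i < k → q i ≤ p k
  low : ∀ i ∈ I, ext ν (p i) (x i) = 0
  high : ∀ i ∈ I, ext ν (q i) (x i) = x i
  bound : ∀ i ∈ I, ∀ γ, ‖x i γ‖ ≤ C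

theorem Block.eq_of_mem_range {C : ℝ} {I : Set ℕ} {x : ℕ → ℕ → A} {p q : ℕ → ℕ}
    (hb : Block ν C I x p q) {i k : ℕ} (hi : i ∈ I) (hk : k ∈ I) {r : ℕ}
    (hi1 : p i ≤ r) (hi2 : r < q i) (hk1 : p k ≤ r) (hk2 : r < q k) : i = k := by
  rcases lt_trichotomy i k with h | h | h
  · have := hb.sep i hi k hk h; omega
  · exact h
  · have := hb.sep k hk i hi h; omega

theorem Block.norm_dst_sum_le (hν : Adm ν) {C : ℝ} {I : Set ℕ} {x : ℕ → ℕ → A} {p q : ℕ → ℕ}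
    (hb : Block ν C I x p q) {E : Finset ℕ} (hE : ∀ i ∈ E, i ∈ I) (γ : ℕ) :
    ‖dst ν γ (∑ i ∈ E, x i)‖ ≤ 3 * C := by
  have hC := hb.nonneg
  rw [dst_sum hν]
  refine norm_sum_le_of_unique (by linarith)
    (fun i hi => norm_dst_le hν γ hC (hb.bound i (hE i hi))) ?_
  have hr : ∀ i ∈ E, dst ν γ (x i) ≠ 0 → p i ≤ γ ∧ γ < q i := fun i hi h => by
    constructor
    · by_contra hlt
      exact h (dst_eq_zero_of_lt hν (hb.low i (hE i hi)) (not_le.1 hlt))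
    · by_contra hlt
      exact h (dst_eq_zero_of_le hν (hb.high i (hE i hi)) (not_lt.1 hlt))
  intro i hi k hk h1 h2
  exact hb.eq_of_mem_range (hE i hi) (hE k hk) (hr i hi h1).1 (hr i hi h1).2 (hr k hk h2).1
    (hr k hk h2).2

/-- Truncating a sum of blocks from the right affects only one of them. -/
theorem Block.norm_ext_sum_sub_le (hν : Adm ν) {C : ℝ} {I : Set ℕ} {x : ℕ → ℕ → A} {p q : ℕ → ℕ}
    (hb : Block ν C I x p q) {E : Finset ℕ} (hE : ∀ i ∈ E, i ∈ I) (r γ : ℕ) :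
    ‖ext ν r (∑ i ∈ E, x i) γ - (∑ i ∈ E with p i < r, x i) γ‖ ≤ 3 * C := by
  have hC := hb.nonneg
  rw [ext_sum hν, Finset.sum_filter, Finset.sum_apply, Finset.sum_apply, ← Finset.sum_sub_distrib]
  have hz : ∀ i ∈ E, ¬ (p i < r ∧ r < q i) →
      ext ν r (x i) γ - (if p i < r then x i else 0) γ = 0 := by
    intro i hi h
    by_cases h1 : p i < r
    · have h2 : q i ≤ r := by by_contra h3; exact h ⟨h1, not_le.1 h3⟩
      rw [if_pos h1, ext_eq_self_of_le hν (hb.high i (hE i hi)) h2, sub_self]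
    · rw [if_neg h1, ext_eq_zero_of_le hν (hb.low i (hE i hi)) (not_lt.1 h1), sub_self]
  refine norm_sum_le_of_unique (by linarith) (fun i hi => ?_) fun i hi k hk h1 h2 => ?_
  · refine (norm_sub_le _ _).trans ?_
    have h1 := norm_ext_le hν hC (p := r) (fun ζ _ => hb.bound i (hE i hi) ζ) γ
    have h2 : ‖(if p i < r then x i else 0) γ‖ ≤ C := by
      split_ifs
      · exact hb.bound i (hE i hi) γ
      · simpa using hC
    linarith
  · have h1' : p i < r ∧ r < q i := by by_contra h; exact h1 (hz i hi h)
    have h2' : p k < r ∧ r < q k := by by_contra h; exact h2 (hz k hk h)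
    exact hb.eq_of_mem_range (hE i hi) (hE k hk) h1'.1.le h1'.2 h2'.1.le h2'.2

theorem Block.norm_sum_le {C : ℝ} {I : Set ℕ} {x : ℕ → ℕ → A} {p q : ℕ → ℕ}
    (hb : Block ν C I x p q) {E : Finset ℕ} (hE : ∀ i ∈ E, i ∈ I) (γ : ℕ) :
    ‖(∑ i ∈ E, x i) γ‖ ≤ C * E.card := by
  rw [Finset.sum_apply]
  refine (norm_sum_le_of_le _ fun i hi => hb.bound i (hE i hi) γ).trans ?_
  rw [Finset.sum_const, nsmul_eq_mul, mul_comm]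

/-- The growth estimate: a linear bound for all coordinates improves on coordinates of a fixed
weight. -/
theorem Block.norm_sum_le_of_wt (hν : Adm ν) {C K lam : ℝ} {I : Set ℕ} {x : ℕ → ℕ → A}
    {p q : ℕ → ℕ} (hb : Block ν C I x p q) (hK : 0 ≤ K) (hlam : 0 ≤ lam)
    (h : ∀ γ, ∀ E : Finset ℕ, (∀ i ∈ E, i ∈ I) → ‖(∑ i ∈ E, x i) γ‖ ≤ K + lam * E.card)
    {E : Finset ℕ} (hE : ∀ i ∈ E, i ∈ I) (γ : ℕ) :
    ‖(∑ i ∈ E, x i) γ‖ ≤ nn (ν γ).wt * (6 * C + K) + lam / mm (ν γ).wt * E.card := by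
  have hC := hb.nonneg
  have key : ∀ γ, ‖(∑ i ∈ E, x i) γ‖ ≤ (ν γ).age * (6 * C + K) +
      lam / mm (ν γ).wt * (E.filter fun i => p i ≤ γ).card := by
    intro γ
    induction γ using Nat.strong_induction_on with
    | _ γ ih =>
      set y := ∑ i ∈ E, x i with hy
      set E' := E.filter fun i => (ν γ).cut ≤ p i ∧ p i < γ with hE'
      have hmu : 0 ≤ lam / mm (ν γ).wt := div_nonneg hlam (mm_pos _).le
      have h1 : ‖dst ν γ y‖ ≤ 3 * C := hb.norm_dst_sum_le hν hE γ
      have h3 : ‖(mm (ν γ).wt)⁻¹ • pair ν (y - ext ν (ν γ).cut y) γ‖ ≤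
          3 * C + K + lam / mm (ν γ).wt * E'.card := by
        have h4 : ‖pair ν (y - ext ν (ν γ).cut y) γ‖ ≤ 3 * C + K + lam * E'.card := by
          refine norm_pair_le hν (by positivity) fun η hη => ?_
          have e1 := hb.norm_ext_sum_sub_le hν hE (ν γ).cut η
          have e2 := h η E' fun i hi => hE i (Finset.mem_filter.1 hi).1
          have e3 : y η = (∑ i ∈ E with p i < (ν γ).cut, x i) η + (∑ i ∈ E', x i) η := by
            rw [hy, ← Finset.sum_filter_add_sum_filter_not E (fun i => p i < (ν γ).cut),
              Pi.add_apply]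
            congr 1
            rw [Finset.sum_apply, Finset.sum_apply]
            symm
            refine Finset.sum_subset (fun i hi => ?_) fun i hi hn => ?_
            · simp only [hE', Finset.mem_filter] at hi ⊢
              exact ⟨hi.1, not_lt.2 hi.2.1⟩
            · simp only [hE', Finset.mem_filter, not_and, not_lt] at hi hn
              exact eq_zero_of_ext_eq_zero (hb.low i (hE i hi.1)) (hη.trans_le (hn hi.1 hi.2))
          have e4 : (y - ext ν (ν γ).cut y) η = (∑ i ∈ E', x i) η -
              (ext ν (ν γ).cut y η - (∑ i ∈ E with p i < (ν γ).cut, x i) η) := by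
            rw [Pi.sub_apply, e3]; abel
          rw [e4]
          refine (norm_sub_le _ _).trans ?_
          linarith
        refine (norm_inv_mm_smul_le _ h4).trans ?_
        have h5 : (mm (ν γ).wt)⁻¹ ≤ 1 := (inv_mm_le _).trans (by norm_num)
        have h6 : (mm (ν γ).wt)⁻¹ * (3 * C + K) ≤ 3 * C + K :=
          mul_le_of_le_one_left (by linarith) h5
        calc _ = (mm (ν γ).wt)⁻¹ * (3 * C + K) + lam / mm (ν γ).wt * E'.card := by
              rw [div_eq_mul_inv]; ring
          _ ≤ _ := by linarith
      have h0 : ‖y γ‖ ≤ 3 * C + ‖preVal ν y γ‖ + (3 * C + K + lam / mm (ν γ).wt * E'.card) := by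
        conv_lhs => rw [eq_dst_add hν y γ]
        refine (norm_add_le _ _).trans (add_le_add ((norm_add_le _ _).trans ?_) h3)
        linarith
      cases hp : (ν γ).pre with
      | none =>
        have h2 : preVal ν y γ = 0 := by simp [preVal, hp]
        rw [h2, norm_zero] at h0
        rw [hν.none_age γ hp]
        have hc : (E'.card : ℝ) ≤ (E.filter fun i => p i ≤ γ).card := by
          exact_mod_cast Finset.card_le_card fun i hi => by
            simp only [hE', Finset.mem_filter] at hi ⊢
            exact ⟨hi.1, hi.2.2.le⟩
        have := mul_le_mul_of_nonneg_left hc hmu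
        push_cast; linarith
      | some ξ =>
        have h2 : preVal ν y γ = y ξ := by simp [preVal, hp]
        have h7 := ih ξ (hν.pre_lt_self hp)
        rw [hν.pre_wt γ ξ hp] at h7
        rw [h2] at h0
        rw [hν.pre_age γ ξ hp]
        have hlt := hν.pre_lt γ ξ hp
        have hltγ := hν.pre_lt_self hp
        have hc : ((E.filter fun i => p i ≤ ξ).card : ℝ) + E'.card ≤
            (E.filter fun i => p i ≤ γ).card := by
          rw [← Nat.cast_add, ← Finset.card_union_of_disjoint]
          · exact_mod_cast Finset.card_le_card fun i hi => by
              simp only [hE', Finset.mem_union, Finset.mem_filter] at hi ⊢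
              rcases hi with hi | hi
              · exact ⟨hi.1, hi.2.trans hltγ.le⟩
              · exact ⟨hi.1, hi.2.2.le⟩
          · rw [Finset.disjoint_left]
            intro i hi hi'
            simp only [hE', Finset.mem_filter] at hi hi'
            omega
        have := mul_le_mul_of_nonneg_left hc hmu
        push_cast; linarith
  have hmu : 0 ≤ lam / mm (ν γ).wt := div_nonneg hlam (mm_pos _).le
  refine (key γ).trans (add_le_add (mul_le_mul_of_nonneg_right ?_ (by linarith))
    (mul_le_mul_of_nonneg_left ?_ hmu))
  · exact_mod_cast hν.age_le γ
  · exact_mod_cast Finset.card_filter_le _ _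

/-- Iterating the growth estimate. -/
theorem Block.norm_sum_le_of_high (hν : Adm ν) {C M : ℝ} {I : Set ℕ} {x : ℕ → ℕ → A}
    {p q : ℕ → ℕ} (hb : Block ν C I x p q) {j : ℕ} (hM : 0 < M) (hMj : M ≤ mm j ^ 2)
    (h : ∀ γ, j ≤ (ν γ).wt → ∀ E : Finset ℕ, (∀ i ∈ E, i ∈ I) →
      ‖(∑ i ∈ E, x i) γ‖ ≤ 4 * C + 3 * C / M * E.card)
    {E : Finset ℕ} (hE : ∀ i ∈ E, i ∈ I) (γ : ℕ) :
    ‖(∑ i ∈ E, x i) γ‖ ≤ C * kap (nn (j - 1)) (2 ^ (j + 1)) + 4 * C / M * E.card ∧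
    ((ν γ).wt < j → ‖(∑ i ∈ E, x i) γ‖ ≤ C * kap (nn (j - 1)) (2 ^ (j + 1) + 1) +
      4 * C / (M * mm (ν γ).wt) * E.card) := by
  have hC := hb.nonneg
  set N := nn (j - 1)
  have hN : ∀ γ, (ν γ).wt < j → (nn (ν γ).wt : ℝ) ≤ N := fun γ hγ => by
    exact_mod_cast nn_mono (by omega)
  have step : ∀ t γ, ∀ E : Finset ℕ, (∀ i ∈ E, i ∈ I) →
      ‖(∑ i ∈ E, x i) γ‖ ≤ C * kap N t + (3 * C / M + C / 4 ^ t) * E.card := by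
    intro t
    induction t with
    | zero =>
      intro γ E hE
      refine (hb.norm_sum_le hE γ).trans ?_
      have h1 : 0 ≤ C * kap N 0 := by positivity
      have h2 : C ≤ 3 * C / M + C / 4 ^ 0 := by
        have : 0 ≤ 3 * C / M := by positivity
        simpa using this
      have := mul_le_mul_of_nonneg_right h2 (Nat.cast_nonneg (α := ℝ) E.card)
      linarith
    | succ t ih =>
      intro γ E hE
      have hk : (kap N (t + 1) : ℝ) = 13 + N * (6 + kap N t) := by rw [kap_succ]; push_cast; ring
      have h4 : 0 ≤ C / 4 ^ (t + 1) := by positivity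
      have h5 : 0 ≤ 3 * C / M := by positivity
      rcases lt_or_ge (ν γ).wt j with hγ | hγ
      · refine (hb.norm_sum_le_of_wt hν (K := C * kap N t) (lam := 3 * C / M + C / 4 ^ t)
          (by positivity) (by positivity) ih hE γ).trans (add_le_add ?_ ?_)
        · rw [hk]
          have := mul_le_mul_of_nonneg_right (hN γ hγ)
            (by positivity : 0 ≤ 6 * C + C * (kap N t : ℝ))
          linarith
        · refine mul_le_mul_of_nonneg_right ?_ (Nat.cast_nonneg _)
          have e : (3 * C / M + C / 4 ^ t) / mm (ν γ).wt ≤ (3 * C / M + C / 4 ^ t) * (1 / 4) := by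
            rw [div_eq_mul_inv]
            exact mul_le_mul_of_nonneg_left (inv_mm_le _) (by positivity)
          have e2 : C / 4 ^ (t + 1) = C / 4 ^ t * (1 / 4) := by
            rw [pow_succ]; field_simp
          rw [e2]; linarith
      · refine (h γ hγ E hE).trans (add_le_add ?_ ?_)
        · rw [hk]
          have : 0 ≤ C * (N * (6 + kap N t) : ℝ) := by positivity
          linarith
        · exact mul_le_mul_of_nonneg_right (by linarith) (Nat.cast_nonneg _)
  have fin : ∀ γ, ∀ E : Finset ℕ, (∀ i ∈ E, i ∈ I) →
      ‖(∑ i ∈ E, x i) γ‖ ≤ C * kap N (2 ^ (j + 1)) + 4 * C / M * E.card := by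
    intro γ E hE
    refine (step _ γ E hE).trans (add_le_add le_rfl
      (mul_le_mul_of_nonneg_right ?_ (Nat.cast_nonneg _)))
    rw [four_pow_eq_mm_sq]
    have : C / mm j ^ 2 ≤ C / M := div_le_div_of_nonneg_left hC hM hMj
    calc _ ≤ 3 * C / M + C / M := by linarith
      _ = _ := by ring
  refine ⟨fin γ E hE, fun hγ => ?_⟩
  refine (hb.norm_sum_le_of_wt hν (by positivity) (by positivity) fin hE γ).trans
    (add_le_add ?_ ?_)
  · have hk : (kap N (2 ^ (j + 1) + 1) : ℝ) = 13 + N * (6 + kap N (2 ^ (j + 1))) := by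
      rw [kap_succ]; push_cast; ring
    rw [hk]
    have := mul_le_mul_of_nonneg_right (hN γ hγ)
      (by positivity : 0 ≤ 6 * C + C * (kap N (2 ^ (j + 1)) : ℝ))
    linarith
  · rw [div_div]

end

theorem kap_le_succ {N : ℕ} (hN : 1 ≤ N) (s : ℕ) : kap N s ≤ kap N (s + 1) := by
  rw [kap_succ]; nlinarith

section

variable {A : Type*} [NormedCommRing A] [NormedAlgebra ℝ A] {ν : ℕ → Node A}

/-- Rapidly increasing sequences. -/
structure RIS (ν : ℕ → Node A) (C : ℝ) (I : Set ℕ) (x : ℕ → ℕ → A) (p q J : ℕ → ℕ) : Prop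
    extends Block ν C I x p q where
  fast : ∀ i ∈ I, ∀ k ∈ I, i < k → q i ≤ J k
  small : ∀ i ∈ I, ∀ γ, (ν γ).wt < J i → ‖x i γ‖ ≤ C / mm (ν γ).wt

theorem RIS.norm_sum_le_wt (hν : Adm ν) {C : ℝ} {I : Set ℕ} {x : ℕ → ℕ → A} {p q J : ℕ → ℕ}
    (hx : RIS ν C I x p q J) {E : Finset ℕ} (hE : ∀ i ∈ E, i ∈ I) (γ : ℕ) :
    ‖(∑ i ∈ E, x i) γ‖ ≤ C + 3 * C / mm (ν γ).wt * E.card := by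
  have hC := hx.nonneg
  set l := (ν γ).wt with hl
  have hm := mm_pos l
  rw [Finset.sum_apply, ← Finset.sum_filter_add_sum_filter_not E (fun i => J i ≤ l ∧ l < q i)]
  refine (norm_add_le _ _).trans (add_le_add ?_ ?_)
  · refine norm_sum_le_of_unique hC
      (fun i hi => hx.bound i (hE i (Finset.mem_filter.1 hi).1) γ) fun i hi k hk _ _ => ?_
    rw [Finset.mem_filter] at hi hk
    rcases lt_trichotomy i k with h | h | h
    · have := hx.fast i (hE i hi.1) k (hE k hk.1) h; omega
    · exact h
    · have := hx.fast k (hE k hk.1) i (hE i hi.1) h; omega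
  · have h1 : ∀ i ∈ E.filter (fun i => ¬ (J i ≤ l ∧ l < q i)), ‖x i γ‖ ≤ 3 * C / mm l := by
      intro i hi
      rw [Finset.mem_filter] at hi
      rcases lt_or_ge l (J i) with h | h
      · refine (hx.small i (hE i hi.1) γ h).trans ?_
        gcongr
        linarith
      · have hq : q i ≤ l := by by_contra h3; exact hi.2 ⟨h, not_le.1 h3⟩
        refine norm_le_of_local_support hν hC (hx.high i (hE i hi.1)) (hx.bound i (hE i hi.1))
          (fun η hη he => ?_) γ hl.symm
        have := hν.wt_le η
        omega
    refine (norm_sum_le_of_le _ h1).trans ?_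
    rw [Finset.sum_const, nsmul_eq_mul, mul_comm]
    refine mul_le_mul_of_nonneg_left ?_ (by positivity)
    exact_mod_cast Finset.card_filter_le _ _

/-- Exact vectors. -/
structure ExactVec (ν : ℕ → Node A) (j : ℕ) (D : ℝ) (p q : ℕ) (z : ℕ → A) : Prop where
  low : ext ν p z = 0
  high : ext ν q z = z
  bound : ∀ r γ, ‖ext ν r z γ‖ ≤ D
  small : ∀ r γ, (ν γ).wt ≠ j → ‖ext ν r z γ‖ ≤ D / mm (min (ν γ).wt j)
  dst_le : ∀ γ, ‖dst ν γ z‖ ≤ D / mm j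

theorem ExactVec.norm_le {j : ℕ} {D : ℝ} {p q : ℕ} {z : ℕ → A} (hz : ExactVec ν j D p q z)
    (γ : ℕ) : ‖z γ‖ ≤ D := by
  have := hz.bound q γ
  rwa [hz.high] at this

theorem RIS.exactVec (hν : Adm ν) {C : ℝ} {I : Set ℕ} {x : ℕ → ℕ → A} {p q J : ℕ → ℕ}
    (hx : RIS ν C I x p q J) {F : Finset ℕ} (hF : ∀ i ∈ F, i ∈ I) {j : ℕ} (hj : 1 ≤ j)
    (hcard : F.card = nn j) {P Q : ℕ} (hP : ∀ i ∈ F, P ≤ p i) (hQ : ∀ i ∈ F, q i ≤ Q) :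
    ExactVec ν j (5 * C) P Q ((mm j / nn j) • ∑ i ∈ F, x i) := by
  have hC := hx.nonneg
  have hm := mm_pos j
  have hm1 := one_le_mm j
  have hN : (0 : ℝ) < nn j := by exact_mod_cast one_le_nn j
  have hNk := mm_sq_mul_le_nn hj
  set κ := kap (nn (j - 1)) (2 ^ (j + 1) + 1) with hκ
  have hκ' : (kap (nn (j - 1)) (2 ^ (j + 1)) : ℝ) ≤ κ := by
    exact_mod_cast kap_le_succ (one_le_nn _) _
  have hκ0 : (0 : ℝ) ≤ κ := Nat.cast_nonneg _
  have hratio : mm j / nn j * (κ + 10) ≤ 1 / mm j := by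
    rw [div_mul_eq_mul_div, div_le_div_iff₀ hN hm]
    nlinarith
  have hr0 : 0 < mm j / nn j := by positivity
  have hsm : ∀ a ≤ (κ : ℝ) + 10, mm j / nn j * (C * a) ≤ C / mm j := fun a ha => by
    calc mm j / nn j * (C * a) ≤ mm j / nn j * (C * (κ + 10)) := by gcongr
      _ = C * (mm j / nn j * (κ + 10)) := by ring
      _ ≤ C * (1 / mm j) := by gcongr
      _ = C / mm j := by ring
  have hhigh : ∀ γ, j ≤ (ν γ).wt → ∀ E : Finset ℕ, (∀ i ∈ E, i ∈ I) →
      ‖(∑ i ∈ E, x i) γ‖ ≤ 4 * C + 3 * C / mm j * E.card := fun γ hγ E hE => by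
    refine (hx.norm_sum_le_wt hν hE γ).trans (add_le_add (by linarith) ?_)
    have := mm_mono hγ
    gcongr
  have hit := fun E (hE : ∀ i ∈ E, i ∈ I) γ =>
    hx.toBlock.norm_sum_le_of_high hν hm (by nlinarith) hhigh hE γ
  have hnorm : ∀ a : A, ‖(mm j / nn j) • a‖ = mm j / nn j * ‖a‖ := fun a => by
    rw [norm_smul, Real.norm_of_nonneg hr0.le]
  have hcard' : (F.card : ℝ) = nn j := by exact_mod_cast hcard
  have herr : ∀ r γ, ‖ext ν r ((mm j / nn j) • ∑ i ∈ F, x i) γ‖ ≤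
      mm j / nn j * (C * 3 + ‖(∑ i ∈ F with p i < r, x i) γ‖) := fun r γ => by
    rw [ext_rsmul hν, Pi.smul_apply, hnorm]
    refine mul_le_mul_of_nonneg_left ?_ hr0.le
    rw [← sub_add_cancel (ext ν r (∑ i ∈ F, x i) γ) ((∑ i ∈ F with p i < r, x i) γ), mul_comm C]
    exact (norm_add_le _ _).trans (add_le_add (hx.toBlock.norm_ext_sum_sub_le hν hF r γ) le_rfl)
  have hsub : ∀ r, ∀ i ∈ F.filter (fun i => p i < r), i ∈ I :=
    fun r i hi => hF i (Finset.mem_filter.1 hi).1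
  have hcardr : ∀ r, ((F.filter fun i => p i < r).card : ℝ) ≤ nn j := fun r => by
    rw [← hcard']; exact_mod_cast Finset.card_filter_le _ _
  refine ⟨?_, ?_, fun r γ => (herr r γ).trans ?_, fun r γ hγ => (herr r γ).trans ?_, fun γ => ?_⟩
  · rw [ext_rsmul hν, ext_sum hν, Finset.sum_eq_zero, smul_zero]
    exact fun i hi => ext_eq_zero_of_le hν (hx.low i (hF i hi)) (hP i hi)
  · rw [ext_rsmul hν, ext_sum hν]
    congr 1
    exact Finset.sum_congr rfl fun i hi => ext_eq_self_of_le hν (hx.high i (hF i hi)) (hQ i hi)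
  · have e := (hit _ (hsub r) γ).1
    have e3 := hcardr r
    calc _ ≤ mm j / nn j * (C * 3 + (C * κ + 4 * C / mm j * nn j)) := by
            gcongr
            refine e.trans ?_
            gcongr
      _ = mm j / nn j * (C * (κ + 3)) + 4 * C := by field_simp; ring
      _ ≤ C / mm j + 4 * C := by gcongr; exact hsm _ (by linarith)
      _ ≤ C + 4 * C := by gcongr; exact div_le_self hC hm1
      _ = 5 * C := by ring
  · have e3 := hcardr r
    rcases lt_or_gt_of_ne hγ with h | h
    · rw [min_eq_left h.le]
      have hml := mm_pos (ν γ).wt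
      have e := (hit _ (hsub r) γ).2 h
      calc _ ≤ mm j / nn j * (C * 3 + (C * κ + 4 * C / (mm j * mm (ν γ).wt) * nn j)) := by
            gcongr
            refine e.trans ?_
            gcongr
        _ = mm j / nn j * (C * (κ + 3)) + 4 * C / mm (ν γ).wt := by field_simp; ring
        _ ≤ C / mm j + 4 * C / mm (ν γ).wt := by gcongr; exact hsm _ (by linarith)
        _ ≤ C / mm (ν γ).wt + 4 * C / mm (ν γ).wt := by
            have := mm_mono h.le
            gcongr
        _ = _ := by ring
    · rw [min_eq_right h.le]
      have e := hx.norm_sum_le_wt hν (hsub r) γ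
      have hsq := mm_sq_le h
      calc _ ≤ mm j / nn j * (C * 3 + (C + 3 * C / mm (ν γ).wt * nn j)) := by
            gcongr
            refine e.trans ?_
            have := mm_pos (ν γ).wt
            gcongr
        _ ≤ mm j / nn j * (C * 3 + (C + 3 * C / mm j ^ 2 * nn j)) := by gcongr
        _ = mm j / nn j * (C * 4) + 3 * C / mm j := by field_simp; ring
        _ ≤ C / mm j + 3 * C / mm j := by gcongr; exact hsm _ (by linarith)
        _ ≤ 5 * C / mm j := by rw [← add_div]; gcongr; linarith
  · have e := hx.toBlock.norm_dst_sum_le hν hF γ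
    rw [dst, ext_rsmul hν, Pi.smul_apply, Pi.smul_apply, ← smul_sub, hnorm]
    calc _ ≤ mm j / nn j * (C * 3) := by
            rw [mul_comm C]; gcongr; exact e
      _ ≤ C / mm j := hsm _ (by linarith)
      _ ≤ 5 * C / mm j := by gcongr; linarith

end

theorem three_mul_sq_le_mm_ll (j : ℕ) : 3 * (nn j : ℝ) ^ 2 ≤ mm (ll j) := by
  unfold ll mm
  set n := nn j
  have h1 : (n : ℝ) ≤ 2 ^ n := by exact_mod_cast (Nat.lt_two_pow_self (n := n)).le
  calc 3 * (n : ℝ) ^ 2 ≤ 3 * (2 ^ n) ^ 2 := by gcongr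
    _ ≤ 4 ^ 10 * (2 ^ n) ^ 2 := by gcongr; norm_num
    _ = 4 ^ (n + 10) := by rw [pow_add, ← pow_mul, mul_comm n, pow_mul]; norm_num; ring
    _ ≤ 4 ^ 2 ^ (n + 10) := pow_le_pow_right₀ (by norm_num) Nat.lt_two_pow_self.le

section

variable {A : Type*} [NormedCommRing A] [NormedAlgebra ℝ A] [Nontrivial A] {ν : ℕ → Node A}

/-- Special sequences of exact vectors. -/
structure Special (ν : ℕ → Node A) (j : ℕ) (D : ℝ) (z : ℕ → ℕ → A) (p q J η ζ : ℕ → ℕ) :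
    Prop where
  exact : ∀ k < nn j, ExactVec ν (J k) D (p k) (q k) (z k)
  sep : ∀ k < nn j, ∀ i < k, q i ≤ p k
  fast : ∀ k < nn j, ∀ i < k, q i ≤ J k
  wt : ∀ k < nn j, (ν (ζ k)).wt = j
  cut : ∀ k < nn j, (ν (ζ k)).cut = p k
  fn : ∀ k < nn j, (ν (ζ k)).fn = Pi.single (η k) 1
  pre_zero : (ν (ζ 0)).pre = none
  pre_succ : ∀ k, k + 1 < nn j → (ν (ζ (k + 1))).pre = some (ζ k)
  J_zero : J 0 % 4 = 2
  J_succ : ∀ k, k + 1 < nn j → J (k + 1) = 4 * ζ k + 4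
  J_ge : ∀ k < nn j, ll j ≤ J k
  small : ∀ k < nn j, ‖z k (η k)‖ ≤ D / nn j

variable {j : ℕ} {D : ℝ} {z : ℕ → ℕ → A} {p q J η ζ : ℕ → ℕ}

theorem Special.ζ_lt (hν : Adm ν) (h : Special ν j D z p q J η ζ) {k : ℕ} (hk : k < nn j) :
    ∀ i < k, ζ i < ζ k := by
  induction k with
  | zero => intro i hi; omega
  | succ k ih =>
    intro i hi
    have h1 := hν.pre_lt_self (h.pre_succ k hk)
    rcases Nat.lt_succ_iff_lt_or_eq.1 hi with h2 | rfl
    · exact (ih (by omega) i h2).trans h1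
    · exact h1

theorem Special.ζ_inj (hν : Adm ν) (h : Special ν j D z p q J η ζ) {i k : ℕ} (hi : i < nn j)
    (hk : k < nn j) (he : ζ i = ζ k) : i = k := by
  rcases lt_trichotomy i k with hl | hl | hl
  · have := h.ζ_lt hν hk i hl; omega
  · exact hl
  · have := h.ζ_lt hν hi k hl; omega

theorem Special.J_inj (hν : Adm ν) (h : Special ν j D z p q J η ζ) {i k : ℕ} (hi : i < nn j)
    (hk : k < nn j) (he : J i = J k) : i = k := by
  have h0 := h.J_zero
  cases i with
  | zero =>
    cases k with
    | zero => rfl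
    | succ k => have := h.J_succ k hk; omega
  | succ i =>
    have hi' := h.J_succ i hi
    cases k with
    | zero => omega
    | succ k =>
      have := h.J_succ k hk
      rw [h.ζ_inj hν (show i < nn j by omega) (show k < nn j by omega) (by omega)]

theorem Special.nonneg (h : Special ν j D z p q J η ζ) : 0 ≤ D :=
  (norm_nonneg _).trans ((h.exact 0 (one_le_nn j)).norm_le 0)

theorem Special.ris (h : Special ν j D z p q J η ζ) :
    RIS ν D {k | k < nn j} z p q J where
  nonneg := h.nonneg
  sep i _ k hk hik := h.sep k hk i hik
  low i hi := (h.exact i hi).low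
  high i hi := (h.exact i hi).high
  bound i hi := (h.exact i hi).norm_le
  fast i _ k hk hik := h.fast k hk i hik
  small i hi γ hγ := by
    have := (h.exact i hi).small (q i) γ hγ.ne
    rwa [(h.exact i hi).high, min_eq_left hγ.le] at this

theorem Special.card_le {E : Finset ℕ} (hE : ∀ i ∈ E, i < nn j) : E.card ≤ nn j := by
  have := Finset.card_le_card (show E ⊆ range (nn j) from fun i hi => mem_range.2 (hE i hi))
  rwa [card_range] at this

/-- One step along a coded path. -/
theorem Special.norm_step_le (hν : Adm ν) (h : Special ν j D z p q J η ζ) {E : Finset ℕ}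
    (hE : ∀ i ∈ E, i < nn j) {γ θ : ℕ} (hθ : θ < γ) (hfn : (ν γ).fn = Pi.single θ 1)
    (hL : ll j ≤ (ν θ).wt) {B : ℝ} (hB0 : 0 ≤ B)
    (hB : ∀ k ∈ E, J k = (ν θ).wt → ‖z k θ - ext ν (ν γ).cut (z k) θ‖ ≤ B) :
    ‖(∑ i ∈ E, z i) γ‖ ≤ ‖preVal ν (∑ i ∈ E, z i) γ‖ + (3 * nn j * D / mm (ll j) + B / 4) := by
  have hD := h.nonneg
  set y := ∑ i ∈ E, z i with hy
  have hm := mm_pos (ll j)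
  have hn : (1 : ℝ) ≤ nn j := by exact_mod_cast one_le_nn j
  have h1 : ‖dst ν γ y‖ ≤ D / mm (ll j) := by
    rw [hy, dst_sum hν]
    refine norm_sum_le_of_unique (by positivity) (fun i hi => ?_) fun i hi k hk h1 h2 => ?_
    · refine ((h.exact i (hE i hi)).dst_le γ).trans ?_
      have := mm_mono (h.J_ge i (hE i hi))
      gcongr
    · have hr : ∀ i ∈ E, dst ν γ (z i) ≠ 0 → p i ≤ γ ∧ γ < q i := fun i hi hne => by
        constructor
        · by_contra hlt
          exact hne (dst_eq_zero_of_lt hν (h.exact i (hE i hi)).low (not_le.1 hlt))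
        · by_contra hlt
          exact hne (dst_eq_zero_of_le hν (h.exact i (hE i hi)).high (not_lt.1 hlt))
      exact h.ris.eq_of_mem_range (hE i hi) (hE k hk) (hr i hi h1).1 (hr i hi h1).2
        (hr k hk h2).1 (hr k hk h2).2
  have h2 : ‖pair ν (y - ext ν (ν γ).cut y) γ‖ ≤ B + 2 * D / mm (ll j) * nn j := by
    have e : pair ν (y - ext ν (ν γ).cut y) γ =
        ∑ k ∈ E, (z k θ - ext ν (ν γ).cut (z k) θ) := by
      unfold pair
      rw [Finset.sum_eq_single_of_mem θ (mem_range.2 hθ) fun b _ hb => by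
        rw [hfn, Pi.single_eq_of_ne hb, zero_mul], hfn, Pi.single_eq_same, one_mul, Pi.sub_apply,
        hy, ext_sum hν, Finset.sum_apply, Finset.sum_apply, Finset.sum_sub_distrib]
    rw [e, ← Finset.sum_filter_add_sum_filter_not E (fun k => J k = (ν θ).wt)]
    refine (norm_add_le _ _).trans (add_le_add ?_ ?_)
    · refine norm_sum_le_of_unique hB0 (fun k hk => ?_) fun i hi k hk _ _ => ?_
      · rw [Finset.mem_filter] at hk
        exact hB k hk.1 hk.2
      · rw [Finset.mem_filter] at hi hk
        exact h.J_inj hν (hE i hi.1) (hE k hk.1) (hi.2.trans hk.2.symm)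
    · refine (norm_sum_le_of_le (n := fun _ => 2 * D / mm (ll j)) _ fun k hk => ?_).trans ?_
      · rw [Finset.mem_filter] at hk
        have hkk := hE k hk.1
        have e1 : ∀ r, ‖ext ν r (z k) θ‖ ≤ D / mm (ll j) := fun r => by
          refine ((h.exact k hkk).small r θ (fun h' => hk.2 h'.symm)).trans ?_
          have := mm_mono (le_min hL (h.J_ge k hkk))
          gcongr
        have e2 := e1 (q k)
        rw [(h.exact k hkk).high] at e2
        refine (norm_sub_le _ _).trans ((add_le_add e2 (e1 _)).trans_eq ?_)
        ring
      · rw [Finset.sum_const, nsmul_eq_mul, mul_comm]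
        refine mul_le_mul_of_nonneg_left ?_ (by positivity)
        exact_mod_cast (Finset.card_filter_le _ _).trans (Special.card_le hE)
  conv_lhs => rw [eq_dst_add hν y γ]
  have h3 := norm_inv_mm_smul_le (ν γ).wt h2
  have h4 := mul_le_mul_of_nonneg_right (inv_mm_le (ν γ).wt)
    (by positivity : 0 ≤ B + 2 * D / mm (ll j) * nn j)
  have h5 : D / mm (ll j) + 1 / 4 * (2 * D / mm (ll j) * nn j) ≤ 3 * nn j * D / mm (ll j) := by
    rw [show D / mm (ll j) + 1 / 4 * (2 * D / mm (ll j) * nn j) =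
      (D + D * nn j / 2) / mm (ll j) by ring]
    gcongr
    nlinarith
  refine (norm_add₃_le).trans ?_
  linarith

theorem Special.norm_sum_le_wt (hν : Adm ν) (hj : j % 2 = 1) (h : Special ν j D z p q J η ζ)
    {E : Finset ℕ} (hE : ∀ i ∈ E, i < nn j) : ∀ γ, (ν γ).wt = j → ‖(∑ i ∈ E, z i) γ‖ ≤
      (ν γ).age * (3 * nn j * D / mm (ll j) + D / nn j) +
        (if ∃ k < nn j, ζ k = γ then 0 else D) := by
  have hD := h.nonneg
  have hn : (1 : ℝ) ≤ nn j := by exact_mod_cast one_le_nn j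
  have hm := mm_pos (ll j)
  have hs : 0 ≤ 3 * nn j * D / mm (ll j) + D / nn j := by positivity
  have hτ : 0 ≤ D / nn j := by positivity
  intro γ
  induction γ using Nat.strong_induction_on with
  | _ γ ih =>
    intro hγ
    obtain ⟨θ, hθ, hfn, hL, hnone, hsome⟩ := hν.coded γ (by rw [hγ]; exact hj)
    rw [hγ] at hL
    have step := fun (B : ℝ) hB0 hB => h.norm_step_le hν hE hθ hfn hL (B := B) hB0 hB
    have hgen : ∀ k ∈ E, ‖z k θ - ext ν (ν γ).cut (z k) θ‖ ≤ 2 * D := fun k hk => by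
      refine (norm_sub_le _ _).trans ?_
      have e1 := (h.exact k (hE k hk)).norm_le θ
      have e2 := (h.exact k (hE k hk)).bound (ν γ).cut θ
      linarith
    by_cases hbr : ∃ k < nn j, ζ k = γ
    · rw [if_pos hbr, add_zero]
      obtain ⟨k, hk, rfl⟩ := hbr
      have hθk : θ = η k := by
        have e := hfn.symm.trans (h.fn k hk)
        by_contra hne
        have := congrFun e θ
        rw [Pi.single_eq_same, Pi.single_eq_of_ne hne] at this
        exact one_ne_zero this
      have hstep := step (D / nn j) hτ fun i hi hJi => by
        have hik : i = k := by
          cases k with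
          | zero =>
            have h1 := hnone h.pre_zero
            cases i with
            | zero => rfl
            | succ i => have := h.J_succ i (hE _ hi); omega
          | succ k =>
            have h1 := hsome _ (h.pre_succ k hk)
            exact h.J_inj hν (hE i hi) hk (by rw [hJi, h1, h.J_succ k hk])
        subst hik
        rw [h.cut i hk, (h.exact i hk).low, Pi.zero_apply, sub_zero, hθk]
        exact h.small i hk
      cases k with
      | zero =>
        have e : preVal ν (∑ i ∈ E, z i) (ζ 0) = 0 := by simp [preVal, h.pre_zero]
        rw [e, norm_zero] at hstep
        rw [hν.none_age _ h.pre_zero]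
        push_cast; linarith
      | succ k =>
        have hp := h.pre_succ k hk
        have e : preVal ν (∑ i ∈ E, z i) (ζ (k + 1)) = (∑ i ∈ E, z i) (ζ k) := by
          simp [preVal, hp]
        have := ih (ζ k) (hν.pre_lt_self hp) (h.wt k (by omega))
        rw [if_pos ⟨k, by omega, rfl⟩] at this
        rw [e] at hstep
        rw [hν.pre_age _ _ hp]
        push_cast; linarith
    · rw [if_neg hbr]
      cases hp : (ν γ).pre with
      | none =>
        have e : preVal ν (∑ i ∈ E, z i) γ = 0 := by simp [preVal, hp]
        have hstep := step (2 * D) (by positivity) fun i hi _ => hgen i hi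
        rw [e, norm_zero] at hstep
        rw [hν.none_age _ hp]
        push_cast; linarith
      | some ξ =>
        have e : preVal ν (∑ i ∈ E, z i) γ = (∑ i ∈ E, z i) ξ := by simp [preVal, hp]
        have hξ := ih ξ (hν.pre_lt_self hp) ((hν.pre_wt _ _ hp).trans hγ)
        rw [hν.pre_age _ _ hp]
        push_cast
        by_cases hbr' : ∃ k < nn j, ζ k = ξ
        · rw [if_pos hbr'] at hξ
          have hstep := step (2 * D) (by positivity) fun i hi _ => hgen i hi
          rw [e] at hstep
          linarith
        · rw [if_neg hbr'] at hξ
          have hstep := step 0 le_rfl fun i hi hJi => by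
            exfalso
            have h1 := hsome ξ hp
            cases i with
            | zero => have := h.J_zero; omega
            | succ i =>
              have h2 := h.J_succ i (hE _ hi)
              exact hbr' ⟨i, by have := hE _ hi; omega, by omega⟩
          rw [e] at hstep
          linarith

/-- The norm of the sum of a special sequence is small. -/
theorem Special.norm_sum_le (hν : Adm ν) (hj : j % 2 = 1) (h : Special ν j D z p q J η ζ)
    (γ : ℕ) : ‖(∑ k ∈ range (nn j), z k) γ‖ ≤ 5 * D / mm j ^ 2 * nn j := by
  have hD := h.nonneg
  have hn : (1 : ℝ) ≤ nn j := by exact_mod_cast one_le_nn j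
  have hL := mm_pos (ll j)
  have hm := mm_pos j
  have hwt : ∀ E : Finset ℕ, (∀ i ∈ E, i < nn j) → ∀ γ, (ν γ).wt = j →
      ‖(∑ i ∈ E, z i) γ‖ ≤ 4 * D := fun E hE γ hγ => by
    refine (h.norm_sum_le_wt hν hj hE γ hγ).trans ?_
    have h1 : ((ν γ).age : ℝ) ≤ nn j := by
      have := hν.age_le γ
      rw [hγ] at this; exact_mod_cast this
    have h2 : (if ∃ k < nn j, ζ k = γ then 0 else D) ≤ D := by split_ifs <;> simp [hD]
    have h3 : ((ν γ).age : ℝ) * (3 * nn j * D / mm (ll j) + D / nn j) ≤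
        nn j * (3 * nn j * D / mm (ll j) + D / nn j) := by gcongr
    have h4 : nn j * (3 * nn j * D / mm (ll j) + D / nn j) =
        D * (3 * (nn j : ℝ) ^ 2 / mm (ll j)) + D := by field_simp
    have h5 : 3 * (nn j : ℝ) ^ 2 / mm (ll j) ≤ 1 := by
      rw [div_le_one hL]; exact three_mul_sq_le_mm_ll j
    have h6 := mul_le_mul_of_nonneg_left h5 hD
    linarith
  have hr : ∀ i ∈ range (nn j), i ∈ {k | k < nn j} := fun i hi => by simpa using hi
  have key : ‖(∑ k ∈ range (nn j), z k) γ‖ ≤ D * kap (nn (j - 1)) (2 ^ (j + 1)) +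
      4 * D / mm j ^ 2 * (range (nn j)).card := (h.ris.toBlock.norm_sum_le_of_high hν (M := mm j ^ 2) (j := j) (by positivity) le_rfl
    (fun γ hγ E hE => by
      rcases hγ.eq_or_lt with he | hlt
      · have := hwt E hE γ he.symm
        have : 0 ≤ 3 * D / mm j ^ 2 * E.card := by positivity
        linarith [hwt E hE γ he.symm]
      · refine (h.ris.norm_sum_le_wt hν hE γ).trans (add_le_add (by linarith) ?_)
        exact mul_le_mul_of_nonneg_right (div_le_div_of_nonneg_left (by positivity)
          (by positivity) (mm_sq_le hlt)) (Nat.cast_nonneg _)) (E := range (nn j)) hr γ).1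
  rw [card_range] at key
  have hk := mm_sq_mul_le_nn (j := j) (by omega)
  have hk' : (kap (nn (j - 1)) (2 ^ (j + 1)) : ℝ) ≤ kap (nn (j - 1)) (2 ^ (j + 1) + 1) := by
    exact_mod_cast kap_le_succ (one_le_nn _) _
  have h1 : (kap (nn (j - 1)) (2 ^ (j + 1)) : ℝ) ≤ nn j / mm j ^ 2 := by
    rw [le_div_iff₀ (by positivity)]
    nlinarith [sq_nonneg (mm j)]
  have h2 := mul_le_mul_of_nonneg_left h1 hD
  have h3 : D * (nn j / mm j ^ 2) + 4 * D / mm j ^ 2 * nn j = 5 * D / mm j ^ 2 * nn j := by ring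
  linarith

/-- Evaluating blocks along a chain of nodes. -/
theorem chain_apply (hν : Adm ν) {n : ℕ} {ζ p q : ℕ → ℕ} {y : ℕ → A}
    (hcut : ∀ k < n, (ν (ζ k)).cut = p k) (hq : ∀ k < n, q k ≤ ζ k)
    (h0 : (ν (ζ 0)).pre = none) (hs : ∀ k, k + 1 < n → (ν (ζ (k + 1))).pre = some (ζ k))
    (hqp : ∀ k, k + 1 < n → ζ k < p (k + 1))
    {s : ℕ} (hsn : s < n) (hlow : ext ν (p s) y = 0) (hhigh : ext ν (q s) y = y) :
    ∀ r < n, y (ζ r) = if s ≤ r then (mm (ν (ζ s)).wt)⁻¹ • pair ν y (ζ s) else 0 := by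
  have hpζ : ∀ k < n, p k ≤ ζ k := fun k hk => hcut k hk ▸ hν.cut_le _
  have hlt : ∀ r < n, ∀ i < r, ζ i < p r := by
    intro r
    induction r with
    | zero => intro _ i hi; omega
    | succ r ih =>
      intro hr i hi
      have h1 := hqp r hr
      rcases Nat.lt_succ_iff_lt_or_eq.1 hi with h | rfl
      · have := ih (by omega) i h; have := hpζ r (by omega); omega
      · exact h1
  intro r
  induction r with
  | zero =>
    intro hr
    by_cases hsr : s ≤ 0
    · obtain rfl : s = 0 := by omega
      rw [if_pos le_rfl]
      conv_lhs => rw [eq_dst_add hν y]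
      rw [dst_eq_zero_of_le hν hhigh (hq 0 hr), hcut 0 hr, hlow, sub_zero]
      simp [preVal, h0]
    · rw [if_neg hsr]
      exact eq_zero_of_ext_eq_zero hlow (hlt s hsn 0 (by omega))
  | succ r ih =>
    intro hr
    have hpre : preVal ν y (ζ (r + 1)) = y (ζ r) := by simp [preVal, hs r hr]
    rcases lt_trichotomy s (r + 1) with h | h | h
    · rw [if_pos h.le, eq_dst_add hν y, hpre, ih (by omega), if_pos (by omega)]
      have hqs : q s ≤ p (r + 1) := by
        have := hlt (r + 1) hr s h; have := hq s hsn; omega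
      rw [dst_eq_zero_of_le hν hhigh (hqs.trans (hpζ _ hr)), hcut _ hr,
        ext_eq_self_of_le hν hhigh hqs, sub_self]
      simp [pair]
    · subst h
      rw [if_pos le_rfl]
      conv_lhs => rw [eq_dst_add hν y]
      rw [hpre, ih (by omega), if_neg (by omega), dst_eq_zero_of_le hν hhigh (hq _ hr),
        hcut _ hr, hlow, sub_zero]
      simp
    · rw [if_neg (by omega)]
      exact eq_zero_of_ext_eq_zero hlow (hlt s hsn (r + 1) h)

end

section

variable {A : Type*} [NormedCommRing A] [NormedAlgebra ℝ A] [TopologicalSpace.SeparableSpace A]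

/-- The finitely supported functionals used by nodes of even weight. -/
noncomputable def listFn (A : Type*) [NormedCommRing A] [TopologicalSpace.SeparableSpace A]
    (v : List ℕ) (η : ℕ) : A :=
  (v[η]?).elim 0 (TopologicalSpace.denseSeq A)

/-- Systems of nodes containing all admissible nodes, arbitrarily far out. -/
structure Rich (ν : ℕ → Node A) : Prop extends Adm ν where
  even : ∀ (M w : ℕ) (pre : Option ℕ) (cut : ℕ) (v : List ℕ), w % 2 = 0 →
    (∀ ξ, pre = some ξ → ξ < cut ∧ (ν ξ).wt = w ∧ (ν ξ).age < nn w) →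
    (∀ Q, ∑ η ∈ range Q, ‖listFn A v η‖ ≤ 1) →
    ∃ γ ≥ M, (ν γ).wt = w ∧ (ν γ).pre = pre ∧ (ν γ).cut = cut ∧ (ν γ).fn = listFn A v
  odd : ∀ (M w : ℕ) (pre : Option ℕ) (cut θ : ℕ), w % 2 = 1 →
    (∀ ξ, pre = some ξ → ξ < cut ∧ (ν ξ).wt = w ∧ (ν ξ).age < nn w) →
    ll w ≤ (ν θ).wt → (pre = none → (ν θ).wt % 4 = 2) →
    (∀ ξ, pre = some ξ → (ν θ).wt = 4 * ξ + 4) →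
    ∃ γ ≥ M, (ν γ).wt = w ∧ (ν γ).pre = pre ∧ (ν γ).cut = cut ∧ (ν γ).fn = Pi.single θ 1

/-- Admissibility of a single node. -/
structure GoodNode (ν : ℕ → Node A) (γ : ℕ) (N : Node A) : Prop where
  wt_le : N.wt ≤ γ
  cut_le : N.cut ≤ γ
  fn_le : ∑ η ∈ range γ, ‖N.fn η‖ ≤ 1
  pre_some : ∀ ξ, N.pre = some ξ → ξ < N.cut ∧ (ν ξ).wt = N.wt ∧ N.age = (ν ξ).age + 1
  none_age : N.pre = none → N.age = 1
  age_le : N.age ≤ nn N.wt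
  coded : N.wt % 2 = 1 → ∃ η < γ, N.fn = Pi.single η 1 ∧
    ll N.wt ≤ (ν η).wt ∧ (N.pre = none → (ν η).wt % 4 = 2) ∧
    ∀ ξ, N.pre = some ξ → (ν η).wt = 4 * ξ + 4

theorem GoodNode.congr {ν ν' : ℕ → Node A} {γ : ℕ} {N : Node A} (h : ∀ m < γ, ν m = ν' m)
    (hg : GoodNode ν γ N) : GoodNode ν' γ N where
  wt_le := hg.wt_le
  cut_le := hg.cut_le
  fn_le := hg.fn_le
  pre_some ξ hξ := by
    have := hg.pre_some ξ hξ
    rwa [h ξ (this.1.trans_le hg.cut_le)] at this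
  none_age := hg.none_age
  age_le := hg.age_le
  coded hw := by
    obtain ⟨η, hη, h2⟩ := hg.coded hw
    exact ⟨η, hη, by rwa [h η hη] at h2⟩

/-- The node of age one and weight zero with vanishing functional. -/
def trivNode (A : Type*) [NormedCommRing A] : Node A := ⟨0, 1, none, 0, 0⟩

theorem goodNode_trivNode (ν : ℕ → Node A) (γ : ℕ) : GoodNode ν γ (trivNode A) where
  wt_le := Nat.zero_le _
  cut_le := Nat.zero_le _
  fn_le := by simp [trivNode]
  pre_some ξ hξ := by simp [trivNode] at hξ
  none_age _ := rfl
  age_le := one_le_nn _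
  coded hw := by simp [trivNode] at hw

/-- The node described by an instruction. -/
noncomputable def mkNode (ν : ℕ → Node A) (i : Bool × ℕ × Option ℕ × ℕ × List ℕ) : Node A where
  wt := i.2.1
  age := i.2.2.1.elim 1 fun ξ => (ν ξ).age + 1
  pre := i.2.2.1
  cut := i.2.2.2.1
  fn := if i.1 then listFn A i.2.2.2.2 else Pi.single (i.2.2.2.2.headD 0) 1

open Classical in
/-- The node at `γ`, in terms of the previous ones. -/
noncomputable def nextNode (γ : ℕ) (ν : ℕ → Node A) : Node A :=
  match (Encodable.decode (Nat.unpair γ).1 : Option (Bool × ℕ × Option ℕ × ℕ × List ℕ)) with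
  | some i => if GoodNode ν γ (mkNode ν i) then mkNode ν i else trivNode A
  | none => trivNode A

open Classical in
theorem exists_nextNode : ∃ ν : ℕ → Node A,
    ∀ γ, ν γ = nextNode γ fun m => if m < γ then ν m else trivNode A := by
  refine ⟨WellFounded.fix Nat.lt_wfRel.wf fun γ prev =>
    nextNode γ fun m => if h : m < γ then prev m h else trivNode A, fun γ => ?_⟩
  rw [WellFounded.fix_eq]
  congr 1

variable (A) in
theorem exists_rich [NormOneClass A] : ∃ ν : ℕ → Node A, Rich ν := by
  classical
  obtain ⟨ν, hν⟩ := exists_nextNode (A := A)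
  have hagree : ∀ γ, ∀ m < γ, (fun m => if m < γ then ν m else trivNode A) m = ν m :=
    fun γ m hm => if_pos hm
  have good : ∀ γ, GoodNode ν γ (ν γ) := fun γ => by
    rw [hν γ]
    refine GoodNode.congr (hagree γ) ?_
    unfold nextNode
    split
    · split_ifs with h
      · exact h
      · exact goodNode_trivNode _ _
    · exact goodNode_trivNode _ _
  have ex : ∀ (i : Bool × ℕ × Option ℕ × ℕ × List ℕ) (M : ℕ), ∃ γ ≥ M,
      GoodNode ν γ (mkNode (fun m => if m < γ then ν m else trivNode A) i) →
      ν γ = mkNode (fun m => if m < γ then ν m else trivNode A) i := fun i M => by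
    refine ⟨Nat.pair (Encodable.encode i) M, Nat.right_le_pair _ _, fun hg => ?_⟩
    conv_lhs => rw [hν]
    unfold nextNode
    rw [Nat.unpair_pair, Encodable.encodek]
    exact if_pos (hg.congr fun m hm => (hagree _ m hm).symm)
  have presome : ∀ (γ w : ℕ) (pre : Option ℕ) (cut : ℕ), cut ≤ γ →
      (∀ ξ, pre = some ξ → ξ < cut ∧ (ν ξ).wt = w ∧ (ν ξ).age < nn w) →
      (∀ ξ, pre = some ξ → ξ < cut ∧ (ν ξ).wt = w ∧
        (pre.elim 1 fun ξ => (if ξ < γ then ν ξ else trivNode A).age + 1) = (ν ξ).age + 1) ∧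
      (pre = none → (pre.elim 1 fun ξ => (if ξ < γ then ν ξ else trivNode A).age + 1) = 1) ∧
      (pre.elim 1 fun ξ => (if ξ < γ then ν ξ else trivNode A).age + 1) ≤ nn w := by
    intro γ w pre cut hcut hpre
    cases pre with
    | none => simpa using one_le_nn w
    | some ξ =>
      obtain ⟨h1, h2, h3⟩ := hpre ξ rfl
      simp only [Option.some.injEq, Option.elim_some, forall_eq', reduceCtorEq, false_implies,
        if_pos (h1.trans_le hcut)]
      exact ⟨⟨h1, h2, trivial⟩, trivial, h3⟩
  refine ⟨ν, ⟨⟨fun γ => (good γ).wt_le, fun γ => (good γ).cut_le, fun γ => (good γ).fn_le,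
    fun γ ξ h => ((good γ).pre_some ξ h).1, fun γ ξ h => ((good γ).pre_some ξ h).2.1,
    fun γ ξ h => ((good γ).pre_some ξ h).2.2, fun γ => (good γ).none_age,
    fun γ => (good γ).age_le, fun γ => (good γ).coded⟩, ?_, ?_⟩⟩
  · intro M w pre cut v hw hpre hv
    obtain ⟨γ, hγ, h⟩ := ex (true, w, pre, cut, v) (M + w + cut)
    obtain ⟨h1, h2, h3⟩ := presome γ w pre cut (by omega) hpre
    have := h ⟨show w ≤ γ by omega, show cut ≤ γ by omega, hv γ, h1, h2, h3,
      fun h' => absurd h' (by simp only [mkNode]; omega)⟩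
    exact ⟨γ, by omega, by rw [this]; exact ⟨rfl, rfl, rfl, rfl⟩⟩
  · intro M w pre cut θ hw hpre hl h0 hs
    obtain ⟨γ, hγ, h⟩ := ex (false, w, pre, cut, [θ]) (M + w + cut + θ + 1)
    obtain ⟨h1, h2, h3⟩ := presome γ w pre cut (by omega) hpre
    have := h ⟨show w ≤ γ by omega, show cut ≤ γ by omega, ?_, h1, h2, h3,
      fun _ => ⟨θ, by omega, rfl, hl, h0, hs⟩⟩
    · exact ⟨γ, by omega, by rw [this]; exact ⟨rfl, rfl, rfl, rfl⟩⟩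
    · change ∑ η ∈ range γ, ‖Pi.single (M := fun _ => A) θ 1 η‖ ≤ 1
      refine (Finset.sum_le_sum (g := fun η => if η = θ then (1 : ℝ) else 0) fun η _ => ?_).trans ?_
      · by_cases h : η = θ
        · subst h; simp
        · simp [h]
      · rw [Finset.sum_ite_eq']; split_ifs <;> norm_num

theorem exists_listFn_near (B : ℕ → A) (Q : ℕ) (hB : ∑ η ∈ range Q, ‖B η‖ ≤ 1 / 2) {e : ℝ}
    (he : 0 < e) : ∃ v : List ℕ, (∀ η, Q ≤ η → listFn A v η = 0) ∧
      (∀ η, η < Q → ‖listFn A v η - B η‖ ≤ e) ∧ ∀ R, ∑ η ∈ range R, ‖listFn A v η‖ ≤ 1 := by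
  set e' := min e (1 / (2 * (Q + 1))) with he'
  have hpos : 0 < e' := lt_min he (by positivity)
  have h1 : ∀ η, ∃ k, ‖TopologicalSpace.denseSeq A k - B η‖ < e' := fun η => by
    obtain ⟨k, hk⟩ := (TopologicalSpace.denseRange_denseSeq A).exists_dist_lt (B η) hpos
    exact ⟨k, by rwa [← dist_eq_norm, dist_comm]⟩
  choose k hk using h1
  have h2 : ∀ η < Q, listFn A ((List.range Q).map k) η = TopologicalSpace.denseSeq A (k η) :=
    fun η hη => by simp [listFn, hη]
  have h3 : ∀ η, Q ≤ η → listFn A ((List.range Q).map k) η = 0 := fun η hη => by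
    simp [listFn, hη]
  have h4 : ∀ η < Q, ‖listFn A ((List.range Q).map k) η - B η‖ ≤ e' := fun η hη => by
    rw [h2 η hη]; exact (hk η).le
  refine ⟨(List.range Q).map k, h3, fun η hη => (h4 η hη).trans (min_le_left _ _), fun R => ?_⟩
  have h5 : ∑ η ∈ range R, ‖listFn A ((List.range Q).map k) η‖ ≤
      ∑ η ∈ range Q, ‖listFn A ((List.range Q).map k) η‖ := by
    rcases le_total R Q with h | h
    · exact Finset.sum_le_sum_of_subset_of_nonneg (range_subset_range.2 h)
        fun _ _ _ => norm_nonneg _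
    · refine (Finset.sum_subset (range_subset_range.2 h) fun η _ hη => ?_).ge
      rw [h3 η (by simpa using hη), norm_zero]
  refine h5.trans ((Finset.sum_le_sum (g := fun η => e' + ‖B η‖) fun η hη => ?_).trans ?_)
  · have := h4 η (mem_range.1 hη)
    calc _ = ‖(listFn A ((List.range Q).map k) η - B η) + B η‖ := by rw [sub_add_cancel]
      _ ≤ _ := (norm_add_le _ _).trans (add_le_add this le_rfl)
  · rw [Finset.sum_add_distrib, Finset.sum_const, card_range, nsmul_eq_mul]
    have : (Q : ℝ) * e' ≤ 1 / 2 := by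
      calc (Q : ℝ) * e' ≤ Q * (1 / (2 * (Q + 1))) := by gcongr; exact min_le_right _ _
        _ ≤ 1 / 2 := by
          rw [mul_one_div, div_le_div_iff₀ (by positivity) (by norm_num)]; linarith
    linarith

end

theorem exists_seq {α : Type*} (n : ℕ) (P : ℕ → α → Prop) (R : α → α → Prop)
    (h0 : ∃ a, P 0 a) (hs : ∀ k a, k + 1 < n → P k a → ∃ b, P (k + 1) b ∧ R a b) :
    ∃ s : ℕ → α, (∀ k < n, P k (s k)) ∧ ∀ k, k + 1 < n → R (s k) (s (k + 1)) := by
  classical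
  obtain ⟨a0, ha0⟩ := h0
  let s : ℕ → α := fun k => Nat.rec a0
    (fun k a => if h : ∃ b, P (k + 1) b ∧ R a b then h.choose else a) k
  have hsucc : ∀ k, k + 1 < n → P k (s k) → P (k + 1) (s (k + 1)) ∧ R (s k) (s (k + 1)) := by
    intro k hk hP
    have hex := hs k _ hk hP
    have e : s (k + 1) = hex.choose := dif_pos hex
    rw [e]; exact hex.choose_spec
  have hP : ∀ k, k < n → P k (s k) := by
    intro k
    induction k with
    | zero => intro _; exact ha0
    | succ k ih => intro hk; exact (hsucc k hk (ih (by omega))).1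
  exact ⟨s, hP, fun k hk => (hsucc k hk (hP k (by omega))).2⟩

section

variable {A : Type*} [NormedCommRing A] [NormedAlgebra ℝ A] [NormOneClass A] [Nontrivial A]
  [TopologicalSpace.SeparableSpace A] {ν : ℕ → Node A}

theorem lt_of_forall_succ {ι : ℕ → ℕ} {n : ℕ} (h : ∀ k, k + 1 < n → ι k < ι (k + 1)) {b : ℕ}
    (hb : b < n) : ∀ a < b, ι a < ι b := by
  induction b with
  | zero => intro a ha; omega
  | succ b ih =>
    intro a ha
    rcases Nat.lt_succ_iff_lt_or_eq.1 ha with h1 | rfl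
    · exact (ih (by omega) a h1).trans (h b hb)
    · exact h a hb

/-- Summing a family of functionals along nodes of even weight. -/
theorem Rich.exists_even_chain (hν : Rich ν) {p q : ℕ → ℕ} (hp : Tendsto p atTop atTop)
    (v : ℕ → List ℕ) (hv : ∀ i R, ∑ η ∈ range R, ‖listFn A (v i) η‖ ≤ 1)
    (hvq : ∀ i η, q i ≤ η → listFn A (v i) η = 0) {j n : ℕ} (hj : j % 2 = 0) (hn : 1 ≤ n)
    (hnj : n ≤ nn j) (P : ℕ) :
    ∃ (F : Finset ℕ) (θ : ℕ), F.card = n ∧ (∀ i ∈ F, P ≤ p i) ∧ (∀ i ∈ F, q i ≤ θ) ∧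
      (ν θ).wt = j ∧ ∀ u : ℕ → ℕ → A, (∀ i, ext ν (p i) (u i) = 0) →
      (∀ i, ext ν (q i) (u i) = u i) → (∑ i ∈ F, u i) θ =
        (mm j)⁻¹ • ∑ i ∈ F, ∑ η ∈ range (q i), listFn A (v i) η * u i η := by
  have hA := hν.toAdm
  obtain ⟨s, h1, h2⟩ := exists_seq n (α := ℕ × ℕ)
    (fun k a => (ν a.2).wt = j ∧ (ν a.2).cut = p a.1 ∧ (ν a.2).fn = listFn A (v a.1) ∧
      (ν a.2).age = k + 1 ∧ q a.1 ≤ a.2 ∧ P ≤ p a.1 ∧ (k = 0 → (ν a.2).pre = none))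
    (fun a b => a.1 < b.1 ∧ a.2 < p b.1 ∧ (ν b.2).pre = some a.2)
    (by
      obtain ⟨i, hi⟩ := (hp.eventually_ge_atTop P).exists
      obtain ⟨γ, hγ, e1, e2, e3, e4⟩ := hν.even (q i) j none (p i) (v i) hj (by simp) (hv i)
      exact ⟨(i, γ), e1, e3, e4, hA.none_age _ e2, hγ, hi, fun _ => e2⟩)
    (by
      rintro k ⟨i, γ⟩ hk ⟨e1, e2, e3, e4, e5, e6, -⟩
      obtain ⟨i', hi1, hi2⟩ := ((hp.eventually_ge_atTop (P + γ + 1)).and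
        (eventually_gt_atTop i)).exists
      obtain ⟨γ', hγ, f1, f2, f3, f4⟩ := hν.even (q i') j (some γ) (p i') (v i') hj
        (fun ξ hξ => by
          obtain rfl : γ = ξ := by simpa using hξ
          exact ⟨by omega, e1, by simp only at e4; omega⟩) (hv i')
      refine ⟨(i', γ'), ⟨f1, f3, f4, ?_, hγ, by simp only; omega, fun h => by omega⟩, hi2,
        by simp only; omega, f2⟩
      rw [hA.pre_age _ _ f2]
      simp only at e4; omega)
  have hinj : Set.InjOn (fun k => (s k).1) (range n) := by
    intro a ha b hb hab
    rw [Finset.coe_range, Set.mem_Iio] at ha hb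
    have hlt := fun b (hb : b < n) => lt_of_forall_succ (ι := fun k => (s k).1) (n := n)
      (fun k hk => (h2 k hk).1) hb
    simp only at hab hlt
    rcases lt_trichotomy a b with h | h | h
    · have := hlt b hb a h; omega
    · exact h
    · have := hlt a ha b h; omega
  have hζ : ∀ k < n, (s k).2 ≤ (s (n - 1)).2 := fun k hk => by
    rcases Nat.lt_or_ge k (n - 1) with h | h
    · exact (lt_of_forall_succ (ι := fun k => (s k).2) (n := n)
        (fun k hk => hA.pre_lt_self (h2 k hk).2.2) (b := n - 1) (by omega) k h).le
    · rw [show k = n - 1 by omega]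
  refine ⟨(range n).image fun k => (s k).1, (s (n - 1)).2, ?_, ?_, ?_,
    (h1 (n - 1) (by omega)).1, fun u hu1 hu2 => ?_⟩
  · rw [Finset.card_image_of_injOn hinj, card_range]
  · intro i hi
    obtain ⟨k, hk, rfl⟩ := Finset.mem_image.1 hi
    exact (h1 k (mem_range.1 hk)).2.2.2.2.2.1
  · intro i hi
    obtain ⟨k, hk, rfl⟩ := Finset.mem_image.1 hi
    exact (h1 k (mem_range.1 hk)).2.2.2.2.1.trans (hζ k (mem_range.1 hk))
  · rw [Finset.sum_image hinj, Finset.sum_image hinj, Finset.sum_apply, Finset.smul_sum]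
    refine Finset.sum_congr rfl fun k hk => ?_
    rw [mem_range] at hk
    rw [chain_apply hA (n := n) (ζ := fun k => (s k).2) (p := fun k => p (s k).1)
      (q := fun k => q (s k).1) (y := u (s k).1) (fun k hk => (h1 k hk).2.1)
      (fun k hk => (h1 k hk).2.2.2.2.1) ((h1 0 (by omega)).2.2.2.2.2.2 rfl)
      (fun k hk => (h2 k hk).2.2) (fun k hk => (h2 k hk).2.1) hk (hu1 _) (hu2 _) (n - 1)
      (by omega), if_pos (by omega), (h1 k hk).1]
    congr 1
    unfold pair
    rw [(h1 k hk).2.2.1]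
    symm
    refine Finset.sum_subset (range_subset_range.2 (h1 k hk).2.2.2.2.1) fun η _ hη => ?_
    rw [hvq _ _ (by simpa using hη), zero_mul]

/-- Exact vectors of even weight on which a given transversal family is large. -/
theorem RIS.exists_exactVec (hν : Rich ν) {φ : A →L[ℝ] ℝ} (hφ : ∀ a, |φ a| ≤ ‖a‖) {C C' : ℝ}
    {x y : ℕ → ℕ → A} {p q J : ℕ → ℕ} (hx : RIS ν C Set.univ x p q J)
    (hy : Block ν C' Set.univ y p q) (hp : Tendsto p atTop atTop) {B : ℕ → ℕ → A}
    (hB : ∀ i, ∑ η ∈ range (q i), ‖B i η‖ ≤ 1 / 2)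
    (hBx : ∀ i, ∑ η ∈ range (q i), B i η * x i η = 0) {δ : ℝ} (hδ : 0 < δ)
    (hBy : ∀ i, δ ≤ φ (∑ η ∈ range (q i), B i η * y i η)) {j : ℕ} (hj : j % 2 = 0) (hj1 : 1 ≤ j)
    (P : ℕ) {τ : ℝ} (hτ : 0 < τ) :
    ∃ (F : Finset ℕ) (θ : ℕ), (ν θ).wt = j ∧ (∀ i ∈ F, P ≤ p i) ∧ (∀ i ∈ F, q i ≤ θ) ∧
      ExactVec ν j (5 * C) P θ ((mm j / nn j) • ∑ i ∈ F, x i) ∧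
      ‖((mm j / nn j) • ∑ i ∈ F, x i) θ‖ ≤ τ ∧
      δ / 2 ≤ φ (((mm j / nn j) • ∑ i ∈ F, y i) θ) := by
  have hA := hν.toAdm
  have hC := hx.nonneg
  have hC' := hy.nonneg
  set τ' := min τ (δ / 2)
  have hτ' : 0 < τ' := lt_min hτ (by linarith)
  have hex := fun i => exists_listFn_near (B i) (q i) (hB i)
    (e := τ' / ((q i + 1) * (C + C' + 1))) (by positivity)
  choose v hv1 hv2 hv3 using hex
  obtain ⟨F, θ, hF, hFp, hFq, hθ, hev⟩ := hν.exists_even_chain hp v hv3 hv1 hj (one_le_nn j) le_rfl P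
  have near : ∀ (u : ℕ → ℕ → A) (c : ℝ), 0 ≤ c → c ≤ C + C' + 1 → (∀ i γ, ‖u i γ‖ ≤ c) → ∀ i,
      ‖∑ η ∈ range (q i), listFn A (v i) η * u i η - ∑ η ∈ range (q i), B i η * u i η‖ ≤ τ' := by
    intro u c hc0 hc hu i
    rw [← Finset.sum_sub_distrib]
    refine (norm_sum_le_of_le (n := fun _ => τ' / ((q i + 1) * (C + C' + 1)) * c) _
      fun η hη => ?_).trans ?_
    · rw [← sub_mul]
      refine (norm_mul_le _ _).trans ?_
      have := hv2 i η (mem_range.1 hη)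
      have := hu i η
      gcongr
    · rw [Finset.sum_const, card_range, nsmul_eq_mul]
      calc (q i : ℝ) * (τ' / ((q i + 1) * (C + C' + 1)) * c)
          ≤ (q i + 1) * (τ' / ((q i + 1) * (C + C' + 1)) * (C + C' + 1)) := by
            gcongr; linarith
        _ = τ' := by field_simp
  have hn0 : (0 : ℝ) < nn j := by exact_mod_cast one_le_nn j
  have hm := mm_pos j
  have eval : ∀ u : ℕ → ℕ → A, (∀ i, ext ν (p i) (u i) = 0) →
      (∀ i, ext ν (q i) (u i) = u i) → ((mm j / nn j) • ∑ i ∈ F, u i) θ =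
        (nn j : ℝ)⁻¹ • ∑ i ∈ F, ∑ η ∈ range (q i), listFn A (v i) η * u i η := fun u h1 h2 => by
    rw [Pi.smul_apply, hev u h1 h2, smul_smul]
    congr 1
    field_simp
  refine ⟨F, θ, hθ, hFp, hFq, hx.exactVec hA (fun i _ => Set.mem_univ i) hj1 hF hFp hFq, ?_, ?_⟩
  · rw [eval x (fun i => hx.low i trivial) (fun i => hx.high i trivial), norm_smul, norm_inv,
      Real.norm_of_nonneg hn0.le, inv_mul_le_iff₀ hn0]
    refine (norm_sum_le_of_le (n := fun _ => τ) _ fun i _ => ?_).trans ?_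
    · have := near x C hC (by linarith) (fun i => hx.bound i trivial) i
      rw [hBx, sub_zero] at this
      exact this.trans (min_le_left _ _)
    · rw [Finset.sum_const, hF, nsmul_eq_mul]
  · rw [eval y (fun i => hy.low i trivial) (fun i => hy.high i trivial), map_smul, smul_eq_mul,
      le_inv_mul_iff₀ hn0, map_sum]
    calc (nn j : ℝ) * (δ / 2) = ∑ i ∈ F, δ / 2 := by rw [Finset.sum_const, hF, nsmul_eq_mul]
      _ ≤ _ := Finset.sum_le_sum fun i _ => ?_
    have h1 := (abs_le.1 ((hφ _).trans (near y C' hC' (by linarith) (fun i => hy.bound i trivial) i))).1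
    rw [map_sub] at h1
    have h2 := hBy i
    have h3 : τ' ≤ δ / 2 := min_le_right _ _
    linarith

end

theorem natCast_le_mm (j : ℕ) : (j : ℝ) ≤ mm j := by
  have h1 : j ≤ 4 ^ j := (Nat.lt_pow_self (by norm_num : 1 < 4)).le
  have h2 : (4 : ℝ) ^ j ≤ mm j := by
    rw [mm]; exact pow_le_pow_right₀ (by norm_num) Nat.lt_two_pow_self.le
  exact le_trans (by exact_mod_cast h1) h2

theorem self_le_nn (j : ℕ) : j ≤ nn j := by
  induction j with
  | zero => exact Nat.zero_le _
  | succ j ih =>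
    rw [nn_succ]
    have : 0 < (4 ^ (2 ^ (j + 1))) ^ 2 * (kap (nn j) (2 ^ (j + 2) + 1) + 10) := by positivity
    omega

theorem le_ll (j : ℕ) : j ≤ ll j := by
  rw [ll]; have := self_le_nn j; omega

theorem mm_sq_le_nn {j : ℕ} (hj : 1 ≤ j) : mm j ^ 2 ≤ nn j := by
  have h := mm_sq_mul_le_nn hj
  have : (0 : ℝ) ≤ kap (nn (j - 1)) (2 ^ (j + 1) + 1) := Nat.cast_nonneg _
  nlinarith [sq_nonneg (mm j)]

section

variable {A : Type*} [NormedCommRing A] [NormedAlgebra ℝ A] [NormOneClass A] [Nontrivial A]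
  [TopologicalSpace.SeparableSpace A] {ν : ℕ → Node A}

theorem Block.mono {C C' : ℝ} {I : Set ℕ} {x : ℕ → ℕ → A} {p q : ℕ → ℕ}
    (hx : Block ν C I x p q) (h : C ≤ C') : Block ν C' I x p q where
  nonneg := hx.nonneg.trans h
  sep := hx.sep
  low := hx.low
  high := hx.high
  bound i hi γ := (hx.bound i hi γ).trans h

theorem RIS.mono {C C' : ℝ} {I : Set ℕ} {x : ℕ → ℕ → A} {p q J : ℕ → ℕ}
    (hx : RIS ν C I x p q J) (h : C ≤ C') : RIS ν C' I x p q J where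
  toBlock := hx.toBlock.mono h
  fast := hx.fast
  small i hi γ hγ := (hx.small i hi γ hγ).trans (by have := mm_pos (ν γ).wt; gcongr)

/-- A rapidly increasing sequence cannot dominate a transversal family. -/
theorem RIS.exists_comb_of_functional (hν : Rich ν) {φ : A →L[ℝ] ℝ} (hφ : ∀ a, |φ a| ≤ ‖a‖)
    {C C' : ℝ} {x y : ℕ → ℕ → A} {p q J : ℕ → ℕ} (hx : RIS ν C Set.univ x p q J)
    (hy : Block ν C' Set.univ y p q) (hp : Tendsto p atTop atTop) {B : ℕ → ℕ → A}
    (hB : ∀ i, ∑ η ∈ range (q i), ‖B i η‖ ≤ 1 / 2)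
    (hBx : ∀ i, ∑ η ∈ range (q i), B i η * x i η = 0) {δ : ℝ} (hδ : 0 < δ)
    (hBy : ∀ i, δ ≤ φ (∑ η ∈ range (q i), B i η * y i η)) {e : ℝ} (he : 0 < e) :
    ∃ (s : Finset ℕ) (a : ℕ → ℝ), (∀ i, |a i| ≤ 1) ∧ (∀ γ, ‖(∑ i ∈ s, a i • x i) γ‖ ≤ e) ∧
      ∃ γ, δ / 2 ≤ φ ((∑ i ∈ s, a i • y i) γ) := by
  classical
  have hA := hν.toAdm
  wlog hC : 0 < C generalizing C
  · exact this (hx.mono (by linarith : C ≤ C + 1)) (by linarith [hx.nonneg])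
  obtain ⟨j, hj, hje⟩ : ∃ j, j % 2 = 1 ∧ 5 * (5 * C) / mm j ≤ e := by
    obtain ⟨m, hm⟩ := exists_nat_ge (5 * (5 * C) / e)
    refine ⟨2 * m + 1, by omega, ?_⟩
    have h1 := natCast_le_mm (2 * m + 1)
    push_cast at h1
    have h2 : (0 : ℝ) ≤ m := Nat.cast_nonneg m
    rw [div_le_iff₀ (mm_pos _)]
    rw [div_le_iff₀ he] at hm
    nlinarith
  have hn0 : (0 : ℝ) < nn j := by exact_mod_cast one_le_nn j
  have hm := mm_pos j
  let Z : (ℕ → ℕ → A) → ℕ × Finset ℕ × ℕ × ℕ → ℕ → A := fun u a =>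
    (mm (ν a.2.2.1).wt / nn (ν a.2.2.1).wt) • ∑ i ∈ a.2.1, u i
  have hZ : ∀ u a, Z u a = (mm (ν a.2.2.1).wt / nn (ν a.2.2.1).wt) • ∑ i ∈ a.2.1, u i :=
    fun _ _ => rfl
  clear_value Z
  obtain ⟨s, h1, h2⟩ := exists_seq (nn j) (α := ℕ × Finset ℕ × ℕ × ℕ)
    (fun k a => (ExactVec ν (ν a.2.2.1).wt (5 * C) a.1 a.2.2.1 (Z x a) ∧
        ‖Z x a a.2.2.1‖ ≤ 5 * C / nn j ∧ δ / 2 ≤ φ (Z y a a.2.2.1)) ∧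
      (∀ i ∈ a.2.1, a.1 ≤ p i ∧ q i ≤ a.2.2.1) ∧
      ((ν a.2.2.2).wt = j ∧ (ν a.2.2.2).cut = a.1 ∧ (ν a.2.2.2).fn = Pi.single a.2.2.1 1) ∧
      (ν a.2.2.2).age = k + 1 ∧ a.2.2.1 ≤ a.2.2.2 ∧ ll j ≤ (ν a.2.2.1).wt ∧
      (k = 0 → (ν a.2.2.2).pre = none ∧ (ν a.2.2.1).wt % 4 = 2))
    (fun a b => (ν b.2.2.2).pre = some a.2.2.2 ∧ (ν b.2.2.1).wt = 4 * a.2.2.2 + 4 ∧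
      a.2.2.2 < b.1)
    (by
      obtain ⟨F, θ, e1, e2, e3, e4, e5, e6⟩ := hx.exists_exactVec hν hφ hy hp hB hBx hδ hBy
        (j := 4 * ll j + 2) (by omega) (by omega) 0 (τ := 5 * C / nn j) (by positivity)
      obtain ⟨ζ, f0, f1, f2, f3, f4⟩ := hν.odd θ j none 0 θ hj (by simp) (by omega)
        (fun _ => by omega) (by simp)
      refine ⟨(0, F, θ, ζ), ⟨?_, ?_, ?_⟩, fun i hi => ⟨e2 i hi, e3 i hi⟩, ⟨f1, f3, f4⟩,
        hA.none_age _ f2, f0, by simp only; omega, fun _ => ⟨f2, by simp only; omega⟩⟩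
      · rw [hZ]; simp only [e1]; exact e4
      · rw [hZ]; simp only [e1]; exact e5
      · rw [hZ]; simp only [e1]; exact e6)
    (by
      rintro k ⟨P, F, θ, ζ⟩ hk ⟨-, -, ⟨g1, g2, g3⟩, g4, g5, g6, -⟩
      simp only at g1 g2 g3 g4 g5 g6
      have hθ := hA.wt_le θ
      obtain ⟨F', θ', e1, e2, e3, e4, e5, e6⟩ := hx.exists_exactVec hν hφ hy hp hB hBx hδ hBy
        (j := 4 * ζ + 4) (by omega) (by omega) (ζ + 1) (τ := 5 * C / nn j) (by positivity)
      obtain ⟨ζ', f0, f1, f2, f3, f4⟩ := hν.odd θ' j (some ζ) (ζ + 1) θ' hj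
        (fun ξ hξ => by
          obtain rfl : ζ = ξ := by simpa using hξ
          exact ⟨by omega, g1, by omega⟩) (by omega) (by simp) (fun ξ hξ => by
          obtain rfl : ζ = ξ := by simpa using hξ
          exact e1)
      refine ⟨(ζ + 1, F', θ', ζ'), ⟨⟨?_, ?_, ?_⟩, fun i hi => ⟨e2 i hi, e3 i hi⟩, ⟨f1, f3, f4⟩,
        ?_, f0, by simp only; omega, fun h => by omega⟩, f2, e1, by simp only; omega⟩
      · rw [hZ]; simp only [e1]; exact e4
      · rw [hZ]; simp only [e1]; exact e5
      · rw [hZ]; simp only [e1]; exact e6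
      · rw [hA.pre_age _ _ f2]; omega)
  have hζ : ∀ k < nn j, ∀ i < k, (s i).2.2.2 < (s k).1 ∧
      (s i).2.2.1 < (ν (s k).2.2.1).wt := fun k hk i hi => by
    obtain ⟨l, rfl⟩ : ∃ l, k = l + 1 := ⟨k - 1, by omega⟩
    have h3 := (h1 i (by omega)).2.2.2.2.1
    have h4 := h2 l hk
    have h5 : (s i).2.2.2 ≤ (s l).2.2.2 := by
      rcases Nat.lt_succ_iff_lt_or_eq.1 hi with h | rfl
      · exact (lt_of_forall_succ (ι := fun k => (s k).2.2.2) (n := nn j)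
          (fun k hk => hA.pre_lt_self (h2 k hk).1) (b := l) (by omega) i h).le
      · exact le_rfl
    omega
  have hsp : Special ν j (5 * C) (fun k => Z x (s k)) (fun k => (s k).1) (fun k => (s k).2.2.1)
      (fun k => (ν (s k).2.2.1).wt) (fun k => (s k).2.2.1) (fun k => (s k).2.2.2) :=
    { exact := fun k hk => (h1 k hk).1.1
      sep := fun k hk i hi => by
        have := (hζ k hk i hi).1; have := (h1 i (by omega)).2.2.2.2.1; omega
      fast := fun k hk i hi => (hζ k hk i hi).2.le
      wt := fun k hk => (h1 k hk).2.2.1.1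
      cut := fun k hk => (h1 k hk).2.2.1.2.1
      fn := fun k hk => (h1 k hk).2.2.1.2.2
      pre_zero := ((h1 0 (one_le_nn j)).2.2.2.2.2.2 rfl).1
      pre_succ := fun k hk => (h2 k hk).1
      J_zero := ((h1 0 (one_le_nn j)).2.2.2.2.2.2 rfl).2
      J_succ := fun k hk => (h2 k hk).2.1
      J_ge := fun k hk => (h1 k hk).2.2.2.2.2.1
      small := fun k hk => (h1 k hk).1.2.1 }
  set c : ℕ → ℝ := fun k =>
    mm j / nn j * (mm (ν (s k).2.2.1).wt / nn (ν (s k).2.2.1).wt) with hc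
  have hcomb : ∀ u : ℕ → ℕ → A, ∑ i ∈ (range (nn j)).biUnion (fun k => (s k).2.1),
      (∑ k ∈ range (nn j), if i ∈ (s k).2.1 then c k else 0) • u i =
      (mm j / nn j) • ∑ k ∈ range (nn j), Z u (s k) := fun u => by
    simp_rw [Finset.sum_smul, Finset.smul_sum]
    rw [Finset.sum_comm]
    refine Finset.sum_congr rfl fun k hk => ?_
    rw [hZ, smul_smul, Finset.smul_sum]
    symm
    rw [← Finset.sum_subset (Finset.subset_biUnion_of_mem (fun k => (s k).2.1) hk)]
    · exact Finset.sum_congr rfl fun i hi => by rw [if_pos hi]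
    · exact fun i _ hi => by rw [if_neg hi, zero_smul]
  refine ⟨(range (nn j)).biUnion fun k => (s k).2.1,
    fun i => ∑ k ∈ range (nn j), if i ∈ (s k).2.1 then c k else 0, fun i => ?_, fun γ => ?_,
    (s (nn j - 1)).2.2.2, ?_⟩
  · refine (Finset.abs_sum_le_sum_abs _ _).trans
      ((Finset.sum_le_sum (g := fun _ => (nn j : ℝ)⁻¹) fun k hk => ?_).trans ?_)
    · have hJ : j ≤ (ν (s k).2.2.1).wt :=
        (le_ll j).trans (h1 k (mem_range.1 hk)).2.2.2.2.2.1
      have hmJ := mm_pos (ν (s k).2.2.1).wt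
      have hnJ : (0 : ℝ) < nn (ν (s k).2.2.1).wt := by exact_mod_cast one_le_nn _
      have h3 := mm_sq_le_nn (j := (ν (s k).2.2.1).wt) (by omega)
      have h4 := mm_mono hJ
      have hck : c k ≤ (nn j : ℝ)⁻¹ := by
        rw [hc]
        simp only
        rw [div_mul_div_comm, inv_eq_one_div, div_le_div_iff₀ (by positivity) hn0]
        have h5 : mm j * mm (ν (s k).2.2.1).wt ≤ nn (ν (s k).2.2.1).wt := by nlinarith
        nlinarith
      have hck0 : 0 ≤ c k := by rw [hc]; positivity
      split_ifs
      · rwa [abs_of_nonneg hck0]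
      · simp
    · rw [Finset.sum_const, card_range, nsmul_eq_mul, mul_inv_cancel₀ hn0.ne']
  · rw [hcomb, Pi.smul_apply, norm_smul, Real.norm_of_nonneg (by positivity)]
    have := hsp.norm_sum_le hA hj γ
    refine le_trans ?_ hje
    calc _ ≤ mm j / nn j * (5 * (5 * C) / mm j ^ 2 * nn j) := by gcongr
      _ = _ := by field_simp
  · rw [hcomb, Pi.smul_apply, Finset.sum_apply]
    have hlast : ∀ k ∈ range (nn j), Z y (s k) (s (nn j - 1)).2.2.2 =
        (mm j)⁻¹ • Z y (s k) (s k).2.2.1 := fun k hk => by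
      rw [mem_range] at hk
      have hlow : ext ν (s k).1 (Z y (s k)) = 0 := by
        rw [hZ, ext_rsmul hA, ext_sum hA, Finset.sum_eq_zero, smul_zero]
        exact fun i hi => ext_eq_zero_of_le hA (hy.low i trivial) ((h1 k hk).2.1 i hi).1
      have hhigh : ext ν (s k).2.2.1 (Z y (s k)) = Z y (s k) := by
        rw [hZ, ext_rsmul hA, ext_sum hA]
        congr 1
        exact Finset.sum_congr rfl fun i hi =>
          ext_eq_self_of_le hA (hy.high i trivial) ((h1 k hk).2.1 i hi).2
      rw [chain_apply hA (n := nn j) (ζ := fun k => (s k).2.2.2) (p := fun k => (s k).1)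
        (q := fun k => (s k).2.2.1) (y := Z y (s k)) hsp.cut
        (fun k hk => (h1 k hk).2.2.2.2.1) hsp.pre_zero hsp.pre_succ
        (fun k hk => (h2 k hk).2.2) hk hlow hhigh (nn j - 1) (by omega), if_pos (by omega),
        hsp.wt k hk]
      congr 1
      unfold pair
      have hlt : (s k).2.2.1 < (s k).2.2.2 := by
        obtain ⟨θ, hθ, hfn, -⟩ := hA.coded (s k).2.2.2 (by rw [hsp.wt k hk]; exact hj)
        have e := hfn.symm.trans (hsp.fn k hk)
        by_contra hne
        have hne' : θ ≠ (s k).2.2.1 := by rintro rfl; exact hne hθ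
        have := congrFun e θ
        rw [Pi.single_eq_same, Pi.single_eq_of_ne hne'] at this
        exact one_ne_zero this
      rw [Finset.sum_eq_single_of_mem _ (mem_range.2 hlt) fun b _ hb => by
        rw [(hsp.fn k hk), Pi.single_eq_of_ne hb, zero_mul], hsp.fn k hk, Pi.single_eq_same,
        one_mul]
    rw [Finset.sum_congr rfl hlast, ← Finset.smul_sum, smul_smul, map_smul, map_sum, smul_eq_mul,
      show mm j / nn j * (mm j)⁻¹ = (nn j : ℝ)⁻¹ by field_simp, le_inv_mul_iff₀ hn0]
    calc (nn j : ℝ) * (δ / 2) = ∑ k ∈ range (nn j), δ / 2 := by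
          rw [Finset.sum_const, card_range, nsmul_eq_mul]
      _ ≤ _ := Finset.sum_le_sum fun k hk => (h1 k (mem_range.1 hk)).1.2.2

end

section

open TrivSqZeroExt

instance : FiniteDimensional ℝ (DualNumber ℝ) :=
  inferInstanceAs (FiniteDimensional ℝ (ℝ × ℝ))

instance : ProperSpace (DualNumber ℝ) := FiniteDimensional.proper ℝ _

instance : TopologicalSpace.SeparableSpace (DualNumber ℝ) := inferInstance

/-- The infinitesimal part, as a functional. -/
noncomputable def sndL : DualNumber ℝ →L[ℝ] ℝ := sndCLM ℝ ℝ

theorem sndL_apply (a : DualNumber ℝ) : sndL a = a.snd := rfl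

theorem norm_eq (a : DualNumber ℝ) : ‖a‖ = |a.fst| + |a.snd| := norm_def a

theorem abs_sndL_le (a : DualNumber ℝ) : |sndL a| ≤ ‖a‖ := by
  rw [norm_eq, sndL_apply]; linarith [abs_nonneg a.fst]

theorem exists_functional {ι : Type*} [Fintype ι] [DecidableEq ι] (x y : ι → DualNumber ℝ) {δ : ℝ}
    (h : ∀ a : DualNumber ℝ, δ ≤ ‖y - a • x‖) :
    ∃ B : ι → DualNumber ℝ, ∑ i, ‖B i‖ ≤ 1 / 2 ∧ ∑ i, B i * x i = 0 ∧
      δ / 4 ≤ sndL (∑ i, B i * y i) := by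
  let W : Submodule ℝ (ι → DualNumber ℝ) := (Submodule.span (DualNumber ℝ) {x}).restrictScalars ℝ
  obtain ⟨g, hg, hgy⟩ := exists_dual_vector'' ℝ (Submodule.Quotient.mk (p := W) y)
  let f : (ι → DualNumber ℝ) →ₗ[ℝ] ℝ := (g : _ →ₗ[ℝ] ℝ) ∘ₗ W.mkQ
  have hf : ∀ z, f z ≤ ‖z‖ := fun z => by
    calc f z ≤ ‖g (W.mkQ z)‖ := Real.le_norm_self _
      _ ≤ ‖g‖ * ‖W.mkQ z‖ := g.le_opNorm _
      _ ≤ 1 * ‖z‖ := mul_le_mul hg (Submodule.Quotient.norm_mk_le W z) (norm_nonneg _) zero_le_one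
      _ = ‖z‖ := one_mul _
  have hfx : ∀ a : DualNumber ℝ, f (a • x) = 0 := fun a => by
    have : W.mkQ (a • x) = 0 := by
      rw [Submodule.mkQ_apply, Submodule.Quotient.mk_eq_zero]
      exact Submodule.smul_mem _ _ (Submodule.mem_span_singleton_self x)
    show g (W.mkQ (a • x)) = 0
    rw [this, map_zero]
  have hfy : δ ≤ f y := by
    show δ ≤ g (Submodule.Quotient.mk y)
    rw [hgy]
    refine le_trans ?_ (le_of_eq (QuotientAddGroup.norm_mk (S := W.toAddSubgroup) y).symm)
    refine (Metric.le_infDist ⟨0, W.zero_mem⟩).2 fun z hz => ?_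
    obtain ⟨a, rfl⟩ := Submodule.mem_span_singleton.1 (show z ∈ Submodule.span _ {x} from hz)
    rw [dist_eq_norm]
    exact h a
  let α : ι → ℝ := fun i => f (Pi.single i 1)
  let β : ι → ℝ := fun i => f (Pi.single i DualNumber.eps)
  let B : ι → DualNumber ℝ := fun i => (1 / 4 : ℝ) • (inl (β i) + inr (α i))
  have hB : ∀ z : ι → DualNumber ℝ, sndL (∑ i, B i * z i) = f z / 4 := fun z => by
    have hz : z = ∑ i, ((z i).fst • (Pi.single i 1 : ι → DualNumber ℝ) +
        (z i).snd • (Pi.single i DualNumber.eps : ι → DualNumber ℝ)) := by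
      funext k
      rw [Finset.sum_apply, Finset.sum_eq_single k]
      · ext <;> simp
      · intro b _ hb; simp [hb.symm, Pi.single_eq_of_ne]
      · simp
    conv_rhs => rw [hz]
    rw [map_sum, map_sum, Finset.sum_div]
    refine Finset.sum_congr rfl fun i _ => ?_
    rw [map_add, map_smul, map_smul, sndL_apply]
    simp [B, α, β]
    ring
  refine ⟨B, ?_, ?_, ?_⟩
  · let w : ι → DualNumber ℝ := fun i => inl (SignType.sign (α i) : ℝ) +
      inr (SignType.sign (β i) : ℝ)
    have hw : f w / 4 = ∑ i, ‖B i‖ := by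
      rw [← hB, map_sum]
      refine Finset.sum_congr rfl fun i _ => ?_
      rw [norm_eq, sndL_apply]
      simp [B, w, abs_mul]
      have h1 := sign_mul_self (α i)
      have h2 := sign_mul_self (β i)
      rw [← h1, ← h2]
      ring
    have hs : ∀ r : ℝ, |((SignType.sign r : SignType) : ℝ)| ≤ 1 := fun r => by
      rcases lt_trichotomy r 0 with h | h | h <;> simp [h]
    have hw2 : ‖w‖ ≤ 2 := (pi_norm_le_iff_of_nonneg zero_le_two).2 fun i => by
      rw [norm_eq]
      simp only [w, fst_add, fst_inl, fst_inr, snd_add, snd_inl, snd_inr, add_zero, zero_add]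
      linarith [hs (α i), hs (β i)]
    rw [← hw]
    linarith [hf w]
  · have key : ∀ a : DualNumber ℝ, sndL (a * ∑ i, B i * x i) = 0 := fun a => by
      rw [Finset.mul_sum]
      have := hB (a • x)
      rw [hfx, zero_div] at this
      rw [← this]
      congr 1
      exact Finset.sum_congr rfl fun i _ => by simp only [Pi.smul_apply, smul_eq_mul]; ring
    have h1 := key 1
    have h2 := key DualNumber.eps
    generalize ∑ i, B i * x i = c at h1 h2
    rw [sndL_apply] at h1 h2
    ext
    · simpa using h2
    · simpa using h1
  · rw [hB]; linarith

variable {ν : ℕ → Node (DualNumber ℝ)}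

/-- A block sequence dominated by a rapidly increasing sequence is asymptotically a multiple
of it. -/
theorem RIS.exists_comb (hν : Rich ν) {C C' : ℝ} {x y : ℕ → ℕ → DualNumber ℝ} {p q J : ℕ → ℕ}
    (hx : RIS ν C Set.univ x p q J) (hy : Block ν C' Set.univ y p q)
    (hp : Tendsto p atTop atTop) {δ : ℝ} (hδ : 0 < δ)
    (hxy : ∀ i, ∀ a : DualNumber ℝ, ∃ γ, δ ≤ ‖(y i - a • x i) γ‖) {e : ℝ} (he : 0 < e) :
    ∃ (s : Finset ℕ) (a : ℕ → ℝ), (∀ i, |a i| ≤ 1) ∧ (∀ γ, ‖(∑ i ∈ s, a i • x i) γ‖ ≤ e) ∧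
      ∃ γ, δ / 16 ≤ ‖(∑ i ∈ s, a i • y i) γ‖ := by
  have hA := hν.toAdm
  have key : ∀ i, ∃ B : ℕ → DualNumber ℝ, ∑ η ∈ range (q i), ‖B η‖ ≤ 1 / 2 ∧
      ∑ η ∈ range (q i), B η * x i η = 0 ∧
      δ / 8 ≤ sndL (∑ η ∈ range (q i), B η * y i η) := fun i => by
    obtain ⟨B, h1, h2, h3⟩ := exists_functional (fun η : Fin (q i) => x i η)
      (fun η : Fin (q i) => y i η) (δ := δ / 2) fun a => by
        obtain ⟨γ, hγ⟩ := hxy i a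
        have h4 := norm_ext_le hA (p := q i) (x := y i - a • x i) (norm_nonneg _) (fun η hη =>
          norm_le_pi_norm ((fun η : Fin (q i) => y i η) - a • (fun η : Fin (q i) => x i η))
            ⟨η, hη⟩) γ
        rw [ext_sub hA, ext_smul hA, hx.high i trivial, hy.high i trivial] at h4
        linarith
    refine ⟨fun η => if h : η < q i then B ⟨η, h⟩ else 0, ?_, ?_, ?_⟩
    · rw [Finset.sum_range]; simpa using h1
    · rw [Finset.sum_range]; simpa using h2
    · rw [Finset.sum_range]
      simp only [Fin.is_lt, dite_true]
      refine le_trans (by linarith) h3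
  choose B h1 h2 h3 using key
  obtain ⟨s, a, ha, hs, γ, hγ⟩ := hx.exists_comb_of_functional hν abs_sndL_le hy hp h1 h2
    (by positivity) h3 he
  refine ⟨s, a, ha, hs, γ, ?_⟩
  have := (le_abs_self _).trans (abs_sndL_le ((∑ i ∈ s, a i • y i) γ))
  linarith

end

section Space

open scoped BoundedContinuousFunction

variable {A : Type*} [NormedCommRing A] [NormedAlgebra ℝ A] {ν : ℕ → Node A}

/-- The bounded functions that are uniform limits of their extensions. -/
def space (hν : Adm ν) : Submodule A (ℕ →ᵇ A) where
  carrier := {x | ∀ e : ℝ, 0 < e → ∃ p₀, ∀ p, p₀ ≤ p → ∀ γ, ‖ext ν p x γ - x γ‖ ≤ e}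
  zero_mem' := fun e he => ⟨0, fun p _ γ => by
    rw [BoundedContinuousFunction.coe_zero, ext_zero hν]; simpa using he.le⟩
  add_mem' := fun {x y} hx hy e he => by
    obtain ⟨p₁, h1⟩ := hx (e / 2) (by positivity)
    obtain ⟨p₂, h2⟩ := hy (e / 2) (by positivity)
    refine ⟨max p₁ p₂, fun p hp γ => ?_⟩
    rw [BoundedContinuousFunction.coe_add, ext_add hν, Pi.add_apply, Pi.add_apply, add_sub_add_comm]
    have := norm_add_le (ext ν p x γ - x γ) (ext ν p y γ - y γ)
    linarith [h1 p (le_trans (le_max_left _ _) hp) γ, h2 p (le_trans (le_max_right _ _) hp) γ]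
  smul_mem' := fun a x hx e he => by
    obtain ⟨p₁, h1⟩ := hx (e / (‖a‖ + 1)) (by positivity)
    refine ⟨p₁, fun p hp γ => ?_⟩
    rw [BoundedContinuousFunction.coe_smul]
    change ‖ext ν p (a • ⇑x) γ - a * x γ‖ ≤ e
    rw [ext_smul hν, Pi.smul_apply, smul_eq_mul, ← mul_sub]
    have h2 := h1 p hp γ
    rw [le_div_iff₀ (by positivity)] at h2
    have := norm_mul_le a (ext ν p x γ - x γ)
    nlinarith [norm_nonneg (ext ν p x γ - x γ)]

theorem isClosed_space (hν : Adm ν) : IsClosed (space hν : Set (ℕ →ᵇ A)) := by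
  refine isClosed_of_closure_subset fun x hx e he => ?_
  obtain ⟨y, hy, hxy⟩ := Metric.mem_closure_iff.1 hx (e / 8) (by positivity)
  obtain ⟨p₀, h⟩ := hy (e / 2) (by positivity)
  refine ⟨p₀, fun p hp γ => ?_⟩
  have h1 : ∀ γ, ‖x γ - y γ‖ ≤ e / 8 := fun γ => by
    rw [← dist_eq_norm]; exact (BoundedContinuousFunction.dist_coe_le_dist γ).trans hxy.le
  have h2 := norm_ext_le hν (p := p) (x := ⇑x - ⇑y) (by positivity : 0 ≤ e / 8)
    (fun η _ => h1 η) γ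
  rw [ext_sub hν, Pi.sub_apply] at h2
  have h3 := h p hp γ
  have h4 : ext ν p x γ - x γ = (ext ν p x γ - ext ν p y γ) + (ext ν p y γ - y γ) - (x γ - y γ) := by
    abel
  rw [h4]
  have h5 := norm_sub_le (ext ν p x γ - ext ν p y γ + (ext ν p y γ - y γ)) (x γ - y γ)
  have h6 := norm_add_le (ext ν p x γ - ext ν p y γ) (ext ν p y γ - y γ)
  linarith [h1 γ]

/-- The Bourgain–Delbaen space of a system of nodes. -/
abbrev Sp (hν : Adm ν) : Type _ := space hν

noncomputable instance (hν : Adm ν) : NormedAddCommGroup (Sp hν) := inferInstance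

noncomputable instance (hν : Adm ν) : NormedSpace ℝ (Sp hν) := inferInstance

noncomputable instance (hν : Adm ν) : Module A (Sp hν) := inferInstance

instance (hν : Adm ν) [CompleteSpace A] : CompleteSpace (Sp hν) :=
  (isClosed_space hν).completeSpace_coe

variable {hν : Adm ν}

theorem Sp.norm_le_iff {x : Sp hν} {C : ℝ} (hC : 0 ≤ C) : ‖x‖ ≤ C ↔ ∀ γ, ‖x.1 γ‖ ≤ C :=
  BoundedContinuousFunction.norm_le hC

theorem Sp.norm_apply_le (x : Sp hν) (γ : ℕ) : ‖x.1 γ‖ ≤ ‖x‖ :=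
  BoundedContinuousFunction.norm_coe_le_norm x.1 γ

theorem Sp.coe_smul (a : A) (x : Sp hν) : ⇑(a • x).1 = a • ⇑x.1 := rfl

theorem Sp.coe_rsmul (a : ℝ) (x : Sp hν) : ⇑(a • x).1 = a • ⇑x.1 := rfl

theorem Sp.coe_add (x y : Sp hν) : ⇑(x + y).1 = ⇑x.1 + ⇑y.1 := rfl

theorem Sp.coe_sub (x y : Sp hν) : ⇑(x - y).1 = ⇑x.1 - ⇑y.1 := rfl

theorem Sp.coe_sum {ι : Type*} (s : Finset ι) (x : ι → Sp hν) :
    ⇑(∑ i ∈ s, x i).1 = ∑ i ∈ s, ⇑(x i).1 := by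
  classical
  induction s using Finset.induction_on with
  | empty => rfl
  | insert a s ha ih => rw [Finset.sum_insert ha, Finset.sum_insert ha, Sp.coe_add, ih]

theorem Sp.ext_iff' {x y : Sp hν} : x = y ↔ ⇑x.1 = ⇑y.1 := by
  rw [Subtype.ext_iff, DFunLike.coe_fn_eq]

theorem Sp.norm_smul_le' (a : A) (x : Sp hν) : ‖a • x‖ ≤ ‖a‖ * ‖x‖ :=
  (Sp.norm_le_iff (by positivity)).2 fun γ => by
    rw [Sp.coe_smul]
    exact (norm_mul_le _ _).trans (mul_le_mul_of_nonneg_left (x.norm_apply_le γ) (norm_nonneg _))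

/-- Extension of a finite list of coordinates to an element of the space. -/
noncomputable def extend (hν : Adm ν) (p : ℕ) : (Fin p → A) →L[ℝ] Sp hν :=
  LinearMap.mkContinuous
    { toFun := fun v => ⟨BoundedContinuousFunction.ofNormedAddCommGroupDiscrete
        (ext ν p fun η => if h : η < p then v ⟨η, h⟩ else 0) (2 * ‖v‖)
        (norm_ext_le hν (norm_nonneg _) fun η hη => by
          rw [dif_pos hη]; exact norm_le_pi_norm v _), fun e he => ⟨p, fun r hr γ => by
            change ‖ext ν r (ext ν p _) γ - ext ν p _ γ‖ ≤ e
            rw [ext_ext hν, min_eq_right hr, sub_self, norm_zero]; exact he.le⟩⟩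
      map_add' := fun v w => by
        rw [Sp.ext_iff', Sp.coe_add]
        change ext ν p _ = ext ν p _ + ext ν p _
        rw [← ext_add hν]
        refine ext_congr hν fun η hη => ?_
        simp [hη]
      map_smul' := fun a v => by
        rw [Sp.ext_iff', RingHom.id_apply, Sp.coe_rsmul]
        change ext ν p _ = a • ext ν p _
        rw [← ext_rsmul hν]
        refine ext_congr hν fun η hη => ?_
        simp [hη] } 2 fun v => (Sp.norm_le_iff (by positivity)).2 fun γ =>
          norm_ext_le hν (norm_nonneg _) (fun η hη => by
            rw [dif_pos hη]; exact norm_le_pi_norm v _) γ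

theorem extend_apply (p : ℕ) (v : Fin p → A) :
    ⇑(extend hν p v).1 = ext ν p fun η => if h : η < p then v ⟨η, h⟩ else 0 := rfl

theorem norm_extend_le (p : ℕ) (v : Fin p → A) : ‖extend hν p v‖ ≤ 2 * ‖v‖ :=
  (Sp.norm_le_iff (by positivity)).2 fun γ => norm_ext_le hν (norm_nonneg _) (fun η hη => by
    rw [dif_pos hη]; exact norm_le_pi_norm v _) γ

/-- The first `p` coordinates. -/
noncomputable def restr (hν : Adm ν) (p : ℕ) : Sp hν →L[ℝ] (Fin p → A) :=
  LinearMap.mkContinuous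
    { toFun := fun x i => x.1 i
      map_add' := fun _ _ => rfl
      map_smul' := fun _ _ => rfl } 1 fun x => by
    rw [one_mul]
    exact (pi_norm_le_iff_of_nonneg (norm_nonneg _)).2 fun i => x.norm_apply_le i

theorem restr_apply (p : ℕ) (x : Sp hν) (i : Fin p) : restr hν p x i = x.1 i := rfl

/-- The canonical projections. -/
noncomputable def proj (hν : Adm ν) (p : ℕ) : Sp hν →L[ℝ] Sp hν := extend hν p ∘L restr hν p

theorem proj_apply (p : ℕ) (x : Sp hν) : ⇑(proj hν p x).1 = ext ν p x.1 := by
  change ⇑(extend hν p (restr hν p x)).1 = _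
  rw [extend_apply]
  refine ext_congr hν fun η hη => ?_
  rw [dif_pos hη, restr_apply]

theorem norm_proj_le (p : ℕ) (x : Sp hν) : ‖proj hν p x‖ ≤ 2 * ‖x‖ :=
  (Sp.norm_le_iff (by positivity)).2 fun γ => by
    rw [proj_apply]; exact norm_ext_le hν (norm_nonneg _) (fun η _ => x.norm_apply_le η) γ

theorem norm_proj_le_restr (p : ℕ) (x : Sp hν) : ‖proj hν p x‖ ≤ 2 * ‖restr hν p x‖ :=
  norm_extend_le p (restr hν p x)

theorem proj_smul (p : ℕ) (a : A) (x : Sp hν) : proj hν p (a • x) = a • proj hν p x := by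
  rw [Sp.ext_iff', proj_apply, Sp.coe_smul, Sp.coe_smul, proj_apply, ext_smul hν]

theorem tendsto_proj (x : Sp hν) : Tendsto (fun p => proj hν p x) atTop (𝓝 x) := by
  rw [Metric.tendsto_atTop]
  intro e he
  obtain ⟨p₀, h⟩ := x.2 (e / 2) (by positivity)
  refine ⟨p₀, fun p hp => ?_⟩
  rw [dist_eq_norm]
  refine lt_of_le_of_lt ((Sp.norm_le_iff (by positivity)).2 fun γ => ?_) (half_lt_self he)
  rw [Sp.coe_sub, proj_apply]
  exact h p hp γ

theorem exists_sp {q : ℕ} {u : ℕ → A} (hu : ext ν q u = u) : ∃ x : Sp hν, ⇑x.1 = u := by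
  refine ⟨extend hν q fun i => u i, ?_⟩
  rw [extend_apply]
  conv_rhs => rw [← hu]
  exact ext_congr hν fun η hη => by rw [dif_pos hη]

theorem isCompactOperator_proj [ProperSpace A] (p : ℕ) : IsCompactOperator (proj hν p) := by
  have : IsCompactOperator (extend hν p) := by
    refine ⟨extend hν p '' Metric.closedBall 0 1,
      (isCompact_closedBall 0 1).image (extend hν p).continuous, ?_⟩
    exact mem_of_superset (Metric.closedBall_mem_nhds _ one_pos) (Set.subset_preimage_image _ _)
  exact this.comp_clm (restr hν p)

instance [TopologicalSpace.SeparableSpace A] : TopologicalSpace.SeparableSpace (Sp hν) := by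
  rw [← TopologicalSpace.isSeparable_univ_iff]
  have h : TopologicalSpace.IsSeparable (⋃ p : ℕ, Set.range (extend hν p)) :=
    TopologicalSpace.IsSeparable.iUnion fun p =>
      TopologicalSpace.isSeparable_range (extend hν p).continuous
  refine h.closure.mono fun x _ => ?_
  exact mem_closure_of_tendsto (tendsto_proj x) (Eventually.of_forall fun p =>
    Set.mem_iUnion.2 ⟨p, restr hν p x, rfl⟩)

end Space

/-- A vector supported in `[P, q)` that looks like a late member of a rapidly increasing
sequence. -/
structure Loc {A : Type*} [NormedCommRing A] [NormedAlgebra ℝ A] (ν : ℕ → Node A) (C : ℝ)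
    (P q : ℕ) (x : ℕ → A) : Prop where
  low : ext ν P x = 0
  high : ext ν q x = x
  bound : ∀ γ, ‖x γ‖ ≤ C
  small : ∀ γ, (ν γ).wt < P → ‖x γ‖ ≤ C / mm (ν γ).wt

section

variable {A : Type*} [NormedCommRing A] [NormedAlgebra ℝ A] {ν : ℕ → Node A} {hν : Adm ν}

theorem Loc.nonneg {C : ℝ} {P q : ℕ} {x : ℕ → A} (hx : Loc ν C P q x) : 0 ≤ C :=
  (norm_nonneg _).trans (hx.bound 0)

theorem Loc.mono {C C' : ℝ} {P P' q q' : ℕ} {x : ℕ → A} (hν : Adm ν) (hx : Loc ν C P q x)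
    (hC : C ≤ C') (hP : P' ≤ P) (hq : q ≤ q') : Loc ν C' P' q' x where
  low := ext_eq_zero_of_le hν hx.low hP
  high := ext_eq_self_of_le hν hx.high hq
  bound γ := (hx.bound γ).trans hC
  small γ h := (hx.small γ (h.trans_le hP)).trans (by have := mm_pos (ν γ).wt; gcongr)

theorem Loc.neg {C : ℝ} {P q : ℕ} {x : ℕ → A} (hν : Adm ν) (hx : Loc ν C P q x) :
    Loc ν C P q (-x) where
  low := by rw [← zero_sub, ext_sub hν, hx.low, ext_zero hν, sub_zero]
  high := by rw [← zero_sub, ext_sub hν, hx.high, ext_zero hν]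
  bound γ := by rw [Pi.neg_apply, norm_neg]; exact hx.bound γ
  small γ h := by rw [Pi.neg_apply, norm_neg]; exact hx.small γ h

theorem Loc.add {C C' : ℝ} {P q P' q' : ℕ} {x y : ℕ → A} (hν : Adm ν) (hx : Loc ν C P q x)
    (hy : Loc ν C' P' q' y) (hP : P ≤ P') (hq : q ≤ q') : Loc ν (C + C') P q' (x + y) := by
  have hx' := hx.mono hν le_rfl le_rfl hq
  have hy' := hy.mono hν le_rfl hP le_rfl
  refine ⟨?_, ?_, fun γ => ?_, fun γ h => ?_⟩
  · rw [ext_add hν, hx'.low, hy'.low, add_zero]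
  · rw [ext_add hν, hx'.high, hy'.high]
  · exact (norm_add_le _ _).trans (add_le_add (hx'.bound γ) (hy'.bound γ))
  · rw [add_div]
    exact (norm_add_le _ _).trans (add_le_add (hx'.small γ h) (hy'.small γ h))

theorem Loc.norm_le {C : ℝ} {P q : ℕ} {x : Sp hν} (hx : Loc ν C P q x.1) : ‖x‖ ≤ C :=
  (Sp.norm_le_iff hx.nonneg).2 hx.bound

theorem exists_ris {C C' : ℝ} {R : ℕ → Sp hν → Sp hν → Prop} (hC : 0 ≤ C) (hC' : 0 ≤ C')
    (h : ∀ k P, ∃ (x y : Sp hν) (q : ℕ), P < q ∧ Loc ν C P q x.1 ∧ ext ν P y.1 = 0 ∧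
      ext ν q y.1 = y.1 ∧ ‖y‖ ≤ C' ∧ R k x y) :
    ∃ (x y : ℕ → Sp hν) (p q : ℕ → ℕ), RIS ν C Set.univ (fun i => ⇑(x i).1) p q p ∧
      Block ν C' Set.univ (fun i => ⇑(y i).1) p q ∧ Tendsto p atTop atTop ∧
      ∀ k, R k (x k) (y k) := by
  choose x y q hq hx hy1 hy2 hy3 hR using h
  let p : ℕ → ℕ := fun k => Nat.rec 0 (fun k P => q k P) k
  have hp : ∀ k, p (k + 1) = q k (p k) := fun _ => rfl
  have hmono : StrictMono p := strictMono_nat_of_lt_succ fun k => by rw [hp]; exact hq k _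
  have hsep : ∀ i ∈ Set.univ (α := ℕ), ∀ k ∈ Set.univ (α := ℕ), i < k → q i (p i) ≤ p k :=
    fun i _ k _ hik => by rw [← hp]; exact hmono.monotone hik
  refine ⟨fun k => x k (p k), fun k => y k (p k), p, fun k => q k (p k), ⟨⟨hC, hsep, ?_, ?_, ?_⟩,
    hsep, ?_⟩, ⟨hC', hsep, ?_, ?_, ?_⟩, hmono.tendsto_atTop, fun k => hR _ _⟩
  · exact fun i _ => (hx i _).low
  · exact fun i _ => (hx i _).high
  · exact fun i _ => (hx i _).bound
  · exact fun i _ => (hx i _).small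
  · exact fun i _ => hy1 i _
  · exact fun i _ => hy2 i _
  · exact fun i _ γ => ((y i (p i)).norm_apply_le γ).trans (hy3 i _)

theorem eventually_abs_le (f : Sp hν →L[ℝ] ℝ) {C : ℝ} {c : ℝ} (hc : 0 < c) :
    ∀ᶠ P in atTop, ∀ q, ∀ x : Sp hν, Loc ν C P q x.1 → |f x| ≤ c := by
  by_contra hcon
  rw [not_eventually, frequently_atTop] at hcon
  push Not at hcon
  have hC : 0 ≤ C := by
    obtain ⟨P, -, q, x, h, -⟩ := hcon 0
    exact h.nonneg
  obtain ⟨x, -, p, q, hx, -, -, hf⟩ := exists_ris (hν := hν) (C := C) (C' := 0)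
    (R := fun _ x _ => c < f x) hC le_rfl fun _ P => by
      obtain ⟨P', hP, q, x, h, hfx⟩ := hcon P
      have h' := h.mono hν le_rfl hP (le_max_left q (P + 1))
      have hq : P < max q (P + 1) := by omega
      rcases lt_abs.1 hfx with h1 | h1
      · exact ⟨x, 0, _, hq, h', ext_zero hν _, ext_zero hν _, by simp, h1⟩
      · exact ⟨-x, 0, _, hq, h'.neg hν, ext_zero hν _, ext_zero hν _, by simp,
          by rwa [map_neg]⟩
  obtain ⟨j, hj⟩ := exists_nat_gt (‖f‖ * (5 * C) / c + 1)
  have hj1 : 1 ≤ j := by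
    have : (0 : ℝ) ≤ ‖f‖ * (5 * C) / c := by positivity
    have : (0 : ℝ) < j := by linarith
    exact_mod_cast this
  have hn0 : (0 : ℝ) < nn j := by exact_mod_cast one_le_nn j
  have hm := mm_pos j
  have hex := hx.exactVec hν (F := range (nn j)) (fun _ _ => trivial) hj1 (card_range _)
    (P := 0) (Q := (range (nn j)).sup q) (fun _ _ => Nat.zero_le _) fun i hi => le_sup hi
  have h1 : ‖(mm j / nn j) • ∑ i ∈ range (nn j), x i‖ ≤ 5 * C :=
    (Sp.norm_le_iff (by positivity)).2 fun γ => by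
      rw [Sp.coe_rsmul, Sp.coe_sum]
      exact hex.norm_le γ
  have h2 := (f.le_opNorm_of_le h1)
  rw [map_smul, map_sum, smul_eq_mul] at h2
  have h3 : (nn j : ℝ) * c ≤ ∑ i ∈ range (nn j), f (x i) := by
    calc (nn j : ℝ) * c = ∑ i ∈ range (nn j), c := by rw [sum_const, card_range, nsmul_eq_mul]
      _ ≤ _ := Finset.sum_le_sum fun i _ => (hf i).le
  have h4 : mm j * c ≤ ‖f‖ * (5 * C) := by
    refine le_trans ?_ ((Real.le_norm_self _).trans h2)
    calc mm j * c = mm j / nn j * (nn j * c) := by field_simp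
      _ ≤ _ := by gcongr
  have h5 := natCast_le_mm j
  have h6 : ‖f‖ * (5 * C) / c < mm j := by linarith
  rw [div_lt_iff₀ hc] at h6
  linarith

end

section

variable {ν : ℕ → Node (DualNumber ℝ)} {hν : Adm ν}

theorem eventually_norm_proj_le (T : Sp hν →L[ℝ] Sp hν) (C : ℝ) (p : ℕ) {c : ℝ} (hc : 0 < c) :
    ∀ᶠ P in atTop, ∀ q, ∀ x : Sp hν, Loc ν C P q x.1 → ‖proj hν p (T x)‖ ≤ c := by
  let fstL : DualNumber ℝ →L[ℝ] ℝ := TrivSqZeroExt.fstCLM ℝ ℝ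
  have h : ∀ᶠ P in atTop, ∀ i : Fin p, ∀ q, ∀ x : Sp hν, Loc ν C P q x.1 →
      ‖restr hν p (T x) i‖ ≤ c / 2 := by
    rw [eventually_all]
    intro i
    let g : Sp hν →L[ℝ] DualNumber ℝ :=
      (ContinuousLinearMap.proj (R := ℝ) (φ := fun _ : Fin p => DualNumber ℝ) i) ∘L
        restr hν p ∘L T
    filter_upwards [eventually_abs_le (fstL ∘L g) (C := C) (c := c / 4) (by positivity),
      eventually_abs_le (sndL ∘L g) (C := C) (c := c / 4) (by positivity)] with P h1 h2 q x hx
    rw [norm_eq]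
    have h3 := h1 q x hx
    have h4 := h2 q x hx
    change |(restr hν p (T x) i).fst| ≤ c / 4 at h3
    change |(restr hν p (T x) i).snd| ≤ c / 4 at h4
    linarith
  filter_upwards [h] with P h q x hx
  have h1 := norm_proj_le_restr p (T x)
  have h2 := (pi_norm_le_iff_of_nonneg (by positivity : 0 ≤ c / 2)).2 fun i => h i q x hx
  linarith

theorem sum_div_two_pow_le {e : ℝ} (he : 0 ≤ e) (s : Finset ℕ) :
    ∑ k ∈ s, e / 2 ^ (k + 1) ≤ e := by
  have h : HasSum (fun k : ℕ => e / 2 ^ (k + 1)) e := by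
    have h := (hasSum_geometric_two).mul_left (e / 2)
    rw [show e / 2 * 2 = e by ring] at h
    refine h.congr_fun fun k => ?_
    rw [one_div, inv_pow, pow_succ]; field_simp
  exact sum_le_hasSum s (fun k _ => by positivity) h

theorem exists_transversal (hR : Rich ν) {hν : Adm ν} {C C' δ : ℝ} (hC : 0 ≤ C) (hC' : 0 ≤ C')
    (hδ : 0 < δ) {R : ℝ → Sp hν → Sp hν → Prop}
    (h : ∀ η > 0, ∀ P, ∃ (x y : Sp hν) (q : ℕ), P < q ∧ Loc ν C P q x.1 ∧ ext ν P y.1 = 0 ∧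
      ext ν q y.1 = y.1 ∧ ‖y‖ ≤ C' ∧ (∀ a : DualNumber ℝ, δ ≤ ‖y - a • x‖) ∧ R η x y)
    {e : ℝ} (he : 0 < e) :
    ∃ (x y : ℕ → Sp hν) (s : Finset ℕ) (a : ℕ → ℝ), (∀ i, |a i| ≤ 1) ∧ ‖∑ i ∈ s, a i • x i‖ ≤ e ∧
      δ / 32 ≤ ‖∑ i ∈ s, a i • y i‖ ∧ ∀ k, R (e / 2 ^ (k + 1)) (x k) (y k) := by
  obtain ⟨x, y, p, q, hx, hy, hp, hxy⟩ := exists_ris (hν := hν) (C := C) (C' := C')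
    (R := fun k x y => (∀ a : DualNumber ℝ, δ ≤ ‖y - a • x‖) ∧ R (e / 2 ^ (k + 1)) x y) hC hC'
    fun k P => h _ (by positivity) P
  obtain ⟨s, a, ha, hs, γ, hγ⟩ := hx.exists_comb hR hy hp (half_pos hδ) (fun i a => by
    by_contra hcon
    push Not at hcon
    have := (Sp.norm_le_iff (half_pos hδ).le).2 fun γ =>
      (show ‖(y i - a • x i).1 γ‖ ≤ δ / 2 from (hcon γ).le)
    linarith [(hxy i).1 a]) he
  refine ⟨x, y, s, a, ha, (Sp.norm_le_iff he.le).2 fun γ => ?_, ?_, fun k => (hxy k).2⟩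
  · rw [Sp.coe_sum]; exact hs γ
  · refine le_trans ?_ ((∑ i ∈ s, a i • y i).norm_apply_le γ)
    rw [Sp.coe_sum]
    exact le_trans (by linarith) hγ

theorem exists_block_near (z : Sp hν) {P : ℕ} (q : ℕ) {η : ℝ} (hη : 0 < η)
    (hz : ‖proj hν P z‖ ≤ η / 2) : ∃ (y : Sp hν) (r : ℕ), q ≤ r ∧ P < r ∧ ext ν P y.1 = 0 ∧
      ext ν r y.1 = y.1 ∧ ‖y‖ ≤ 4 * ‖z‖ ∧ ‖z - y‖ ≤ η := by
  obtain ⟨r, ⟨h1, h2⟩, h3⟩ := (((Metric.tendsto_nhds.1 (tendsto_proj z) _ (half_pos hη)).and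
    (eventually_ge_atTop q)).and (eventually_gt_atTop P)).exists
  refine ⟨proj hν r z - proj hν P z, r, h2, h3, ?_, ?_, ?_, ?_⟩
  · rw [Sp.coe_sub, ext_sub hν, proj_apply, proj_apply, ext_ext hν, ext_ext hν,
      min_eq_left h3.le, min_self, sub_self]
  · rw [Sp.coe_sub, ext_sub hν, proj_apply, proj_apply, ext_ext hν, ext_ext hν, min_self,
      min_eq_right h3.le]
  · have := norm_sub_le (proj hν r z) (proj hν P z)
    linarith [norm_proj_le r z, norm_proj_le P z]
  · rw [dist_eq_norm] at h1
    have h7 : z - (proj hν r z - proj hν P z) = proj hν P z - (proj hν r z - z) := by abel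
    rw [h7]
    have := norm_sub_le (proj hν P z) (proj hν r z - z)
    linarith

theorem eventually_exists_norm_sub_le (hR : Rich ν) {hν : Adm ν} (T : Sp hν →L[ℝ] Sp hν) {C δ : ℝ}
    (hδ : 0 < δ) : ∀ᶠ P in atTop, ∀ q, ∀ x : Sp hν, Loc ν C P q x.1 →
      ∃ a : DualNumber ℝ, ‖T x - a • x‖ ≤ δ := by
  by_contra hcon
  rw [not_eventually] at hcon
  have hC : 0 ≤ C := by
    obtain ⟨P, h⟩ := hcon.exists
    push Not at h
    obtain ⟨q, x, h, -⟩ := h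
    exact h.nonneg
  have hT := norm_nonneg T
  have step : ∀ η > 0, ∀ P, ∃ (x y : Sp hν) (q : ℕ), P < q ∧ Loc ν C P q x.1 ∧ ext ν P y.1 = 0 ∧
      ext ν q y.1 = y.1 ∧ ‖y‖ ≤ 4 * (‖T‖ * C) ∧ (∀ a : DualNumber ℝ, δ / 2 ≤ ‖y - a • x‖) ∧
      ‖T x - y‖ ≤ η := fun η hη P => by
    have hη' : 0 < min η (δ / 2) := lt_min hη (half_pos hδ)
    obtain ⟨P', ⟨h1, h2⟩, h3⟩ := ((hcon.and_eventually (eventually_norm_proj_le T C P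
      (half_pos hη'))).and_eventually (eventually_ge_atTop P)).exists
    push Not at h1
    obtain ⟨q, x, hx, hxa⟩ := h1
    obtain ⟨y, r, h4, h5, h6, h7, h8, h9⟩ := exists_block_near (T x) q hη' (h2 q x hx)
    have hTx := T.le_opNorm_of_le hx.norm_le
    refine ⟨x, y, r, h5, hx.mono hν le_rfl h3 h4, h6, h7, by linarith, fun a => ?_,
      h9.trans (min_le_left _ _)⟩
    have h10 := norm_add_le (T x - y) (y - a • x)
    rw [sub_add_sub_cancel] at h10
    linarith [min_le_right η (δ / 2), hxa a]
  obtain ⟨x, y, s, a, ha, hs, hy, hxy⟩ := exists_transversal hR hC (by positivity) (half_pos hδ)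
    (R := fun η x y => ‖T x - y‖ ≤ η) step (e := δ / 64 / (‖T‖ + 2)) (by positivity)
  have h1 : ‖∑ i ∈ s, a i • (T (x i) - y i)‖ ≤ δ / 64 / (‖T‖ + 2) := by
    refine (norm_sum_le _ _).trans (le_trans (Finset.sum_le_sum fun k _ => ?_)
      (sum_div_two_pow_le (by positivity) s))
    rw [norm_smul, Real.norm_eq_abs]
    have := mul_le_mul (ha k) (hxy k) (norm_nonneg _) zero_le_one
    linarith
  have h2 := T.le_opNorm_of_le hs
  have h3 : ∑ i ∈ s, a i • y i = T (∑ i ∈ s, a i • x i) - ∑ i ∈ s, a i • (T (x i) - y i) := by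
    simp only [map_sum, map_smul, smul_sub, Finset.sum_sub_distrib]
    abel
  have h4 := norm_sub_le (T (∑ i ∈ s, a i • x i)) (∑ i ∈ s, a i • (T (x i) - y i))
  rw [← h3] at h4
  have h5 : (‖T‖ + 2) * (δ / 64 / (‖T‖ + 2)) = δ / 64 := by field_simp
  have h6 : 0 < δ / 64 / (‖T‖ + 2) := by positivity
  nlinarith

end

section

variable {A : Type*} [NormedCommRing A] [NormedAlgebra ℝ A] {ν : ℕ → Node A} {hν : Adm ν}

/-- Multiplication by a scalar of the coordinate algebra. -/
noncomputable def smulL (hν : Adm ν) (a : A) : Sp hν →L[ℝ] Sp hν :=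
  LinearMap.mkContinuous
    { toFun := fun x => a • x
      map_add' := fun x y => smul_add a x y
      map_smul' := fun c x => by
        rw [Sp.ext_iff', RingHom.id_apply, Sp.coe_rsmul, Sp.coe_smul, Sp.coe_smul, Sp.coe_rsmul]
        funext γ
        exact mul_smul_comm c a (x.1 γ) } ‖a‖ fun x => x.norm_smul_le' a

theorem smulL_apply (a : A) (x : Sp hν) : smulL hν a x = a • x := rfl

theorem exists_split {C : ℝ} (hC : 0 ≤ C) {P q : ℕ} {x : Sp hν} (hP : ext ν P x.1 = 0)
    (hq : ext ν q x.1 = x.1) (hx : ‖x‖ ≤ C) (N : ℕ) : ∃ y z : Sp hν, x = y + z ∧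
      Loc ν (6 * C * mm N) P q y.1 ∧ Loc ν (6 * C) (min P (N + 1)) q z.1 := by
  classical
  let u : ℕ → A := fun η => if (ν η).wt ≤ N then x.1 η else 0
  have hu : ∀ η, ‖u η‖ ≤ C := fun η => by
    simp only [u]; split_ifs
    · exact (x.norm_apply_le η).trans hx
    · simpa using hC
  have hxu : ∀ η, ‖(⇑x.1 - u) η‖ ≤ C := fun η => by
    simp only [u, Pi.sub_apply]; split_ifs
    · simpa using hC
    · simpa using (x.norm_apply_le η).trans hx
  have h0 : ∀ η < P, u η = 0 := fun η hη => by
    simp only [u, eq_zero_of_ext_eq_zero hP hη, ite_self]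
  have hh : ∀ v : ℕ → A, ext ν q (ext ν q v) = ext ν q v := fun v => by
    rw [ext_ext hν, min_self]
  obtain ⟨y, hy⟩ := exists_sp (hν := hν) (hh u)
  obtain ⟨z, hz⟩ := exists_sp (hν := hν) (hh (⇑x.1 - u))
  have hm := one_le_mm N
  have hyC : ∀ γ, ‖ext ν q u γ‖ ≤ 2 * C := norm_ext_le hν hC fun η _ => hu η
  have hzC : ∀ γ, ‖ext ν q (⇑x.1 - u) γ‖ ≤ 2 * C := norm_ext_le hν hC fun η _ => hxu η
  have hlow : ∀ v : ℕ → A, (∀ η < P, v η = 0) → ext ν P (ext ν q v) = 0 := fun v hv => by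
    rw [ext_ext hν, ext_eq_zero_iff hν]
    exact fun η hη => hv η (hη.trans_le (min_le_left _ _))
  refine ⟨y, z, ?_, ?_, ?_⟩
  · rw [Sp.ext_iff', Sp.coe_add, hy, hz, ← ext_add hν, add_sub_cancel, hq]
  · rw [hy]
    refine ⟨hlow u h0, hh u, fun γ => (hyC γ).trans (by nlinarith), fun γ _ => ?_⟩
    have hml := mm_pos (ν γ).wt
    rcases le_or_gt (ν γ).wt N with h | h
    · rw [le_div_iff₀ hml]
      have h1 := mm_mono h
      nlinarith [hyC γ, norm_nonneg (ext ν q u γ)]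
    · refine (norm_le_of_local_support hν (by positivity) (hh u) hyC (fun η hη hw => ?_) γ
        rfl).trans ?_
      · rw [ext_of_lt _ hη]; simp only [u]; rw [if_neg (by omega)]
      · exact div_le_div_of_nonneg_right (by nlinarith) hml.le
  · rw [hz]
    refine ⟨ext_eq_zero_of_le hν (hlow _ fun η hη => ?_) (min_le_left _ _), hh _,
      fun γ => (hzC γ).trans (by nlinarith), fun γ h => ?_⟩
    · rw [Pi.sub_apply, h0 η hη, eq_zero_of_ext_eq_zero hP hη, sub_zero]
    · refine (norm_le_of_local_support hν (by positivity) (hh _) hzC (fun η hη hw => ?_) γ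
        rfl).trans (by rw [← mul_assoc]; norm_num)
      rw [ext_of_lt _ hη]; simp only [u, Pi.sub_apply]; rw [if_pos (by omega), sub_self]

theorem eventually_norm_le_of_block {T : Sp hν →L[ℝ] Sp hν}
    (hT : ∀ C δ : ℝ, 0 < δ → ∀ᶠ P in atTop, ∀ q, ∀ x : Sp hν, Loc ν C P q x.1 → ‖T x‖ ≤ δ)
    {C δ : ℝ} (hC : 0 ≤ C) (hδ : 0 < δ) : ∀ᶠ P in atTop, ∀ q, ∀ x : Sp hν, ext ν P x.1 = 0 →
      ext ν q x.1 = x.1 → ‖x‖ ≤ C → ‖T x‖ ≤ δ := by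
  obtain ⟨N, hN⟩ := eventually_atTop.1 (hT (6 * C) (δ / 2) (half_pos hδ))
  filter_upwards [hT (6 * C * mm N) (δ / 2) (half_pos hδ), eventually_ge_atTop N]
    with P h1 h2 q x hP hq hx
  obtain ⟨y, z, rfl, hy, hz⟩ := exists_split hC hP hq hx N
  rw [map_add]
  have := norm_add_le (T y) (T z)
  linarith [h1 q y hy, hN _ (by omega) q z hz]

theorem isCompactOperator_of_forall_loc [ProperSpace A] [CompleteSpace A] {T : Sp hν →L[ℝ] Sp hν}
    (hT : ∀ C δ : ℝ, 0 < δ → ∀ᶠ P in atTop, ∀ q, ∀ x : Sp hν, Loc ν C P q x.1 → ‖T x‖ ≤ δ) :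
    IsCompactOperator T := by
  have key : ∀ n : ℕ, ∃ P, ‖T - T ∘L proj hν P‖ ≤ 1 / ((n : ℝ) + 1) := fun n => by
    obtain ⟨P, hP⟩ := (eventually_norm_le_of_block hT (C := 4) (δ := 1 / ((n : ℝ) + 1))
      (by norm_num) (by positivity)).exists
    refine ⟨P, ContinuousLinearMap.opNorm_le_of_unit_norm (by positivity) fun x hx => ?_⟩
    have h1 : Tendsto (fun q => ‖T (proj hν q x - proj hν P x)‖) atTop
        (𝓝 ‖T (x - proj hν P x)‖) :=
      ((T.continuous.tendsto _).comp ((tendsto_proj x).sub_const _)).norm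
    have h2 : (T - T ∘L proj hν P) x = T (x - proj hν P x) := by
      rw [map_sub]; rfl
    rw [h2]
    refine le_of_tendsto h1 ((eventually_ge_atTop P).mono fun q hq => hP q _ ?_ ?_ ?_)
    · rw [Sp.coe_sub, ext_sub hν, proj_apply, proj_apply, ext_ext hν, ext_ext hν,
        min_eq_left hq, min_self, sub_self]
    · rw [Sp.coe_sub, ext_sub hν, proj_apply, proj_apply, ext_ext hν, ext_ext hν, min_self,
        min_eq_right hq]
    · have := norm_sub_le (proj hν q x) (proj hν P x)
      linarith [norm_proj_le q x, norm_proj_le P x]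
  choose P hP using key
  refine isCompactOperator_of_tendsto (l := atTop) (F := fun n => T ∘L proj hν (P n)) (f := T) ?_
    (Eventually.of_forall fun n => (isCompactOperator_proj (P n)).clm_comp T)
  rw [tendsto_iff_norm_sub_tendsto_zero]
  refine squeeze_zero (fun _ => norm_nonneg _) (fun n => ?_) tendsto_one_div_add_atTop_nhds_zero_nat
  rw [norm_sub_rev]
  exact hP n

theorem Rich.exists_reference [NormOneClass A] [TopologicalSpace.SeparableSpace A] (hR : Rich ν)
    {hν : Adm ν} (P : ℕ) : ∃ (q : ℕ) (r : Sp hν) (γ : ℕ), Loc ν 8 P q r.1 ∧ r.1 γ = 1 := by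
  obtain ⟨γ, hγ, hw, -⟩ := hR.even P 0 none 0 [] rfl (by simp) (by simp [listFn])
  have hh : ext ν (γ + 1) (ext ν (γ + 1) (Pi.single γ (1 : A))) = ext ν (γ + 1) (Pi.single γ 1) := by
    rw [ext_ext hν, min_self]
  have hb : ∀ η, ‖ext ν (γ + 1) (Pi.single γ (1 : A)) η‖ ≤ 2 * 1 :=
    norm_ext_le hν zero_le_one fun η _ => by
      by_cases h : η = γ
      · subst h; simp
      · simp [Pi.single_eq_of_ne h]
  obtain ⟨r, hr⟩ := exists_sp (hν := hν) hh
  refine ⟨γ + 1, r, γ, ?_, ?_⟩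
  · rw [hr]
    refine ⟨?_, hh, fun η => (hb η).trans (by norm_num), fun η hη => ?_⟩
    · rw [ext_ext hν, ext_eq_zero_iff hν]
      exact fun η hη => Pi.single_eq_of_ne (by omega) _
    · by_cases h : (ν η).wt = 0
      · rw [h]; refine (hb η).trans ?_
        rw [mm]; norm_num
      · refine (norm_le_of_local_support hν (by norm_num) hh hb (fun ξ hξ hwt => ?_) η rfl).trans ?_
        · rw [ext_of_lt _ hξ]
          exact Pi.single_eq_of_ne (by rintro rfl; omega) _
        · have := mm_pos (ν η).wt
          gcongr; norm_num
  · rw [hr, ext_of_lt _ (Nat.lt_succ_self γ), Pi.single_eq_same]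

theorem norm_smul_sub_le {T : Sp hν →L[ℝ] Sp hν} {C δ : ℝ} (hδ : 0 ≤ δ) {P q q' γ : ℕ}
    {x r : Sp hν} (hx : Loc ν C P q x.1) (hr : Loc ν 8 q q' r.1) (hrγ : r.1 γ = 1) {a b c : A}
    (ha : ‖T x - a • x‖ ≤ δ) (hb : ‖T r - b • r‖ ≤ δ) (hc : ‖T (x + r) - c • (x + r)‖ ≤ δ) :
    ‖T x - b • x‖ ≤ (7 + 9 * C) * δ := by
  have hC := hx.nonneg
  obtain ⟨z, hz⟩ : ∃ z : Sp hν, z = (c - a) • x + (c - b) • r := ⟨_, rfl⟩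
  have hz3 : ‖z‖ ≤ 3 * δ := by
    have e : z = (T x - a • x) + (T r - b • r) - (T (x + r) - c • (x + r)) := by
      rw [hz, map_add, sub_smul, sub_smul, smul_add]; abel
    rw [e]
    have h3 := norm_sub_le ((T x - a • x) + (T r - b • r)) (T (x + r) - c • (x + r))
    have h4 := norm_add_le (T x - a • x) (T r - b • r)
    linarith
  have hproj : proj hν q z = (c - a) • x := by
    have h3 : proj hν q x = x := by rw [Sp.ext_iff', proj_apply, hx.high]
    have h4 : proj hν q r = 0 := by rw [Sp.ext_iff', proj_apply, hr.low]; rfl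
    rw [hz, map_add, proj_smul, proj_smul, h3, h4, smul_zero, add_zero]
  have hca : ‖(c - a) • x‖ ≤ 6 * δ := by
    rw [← hproj]; linarith [norm_proj_le q z]
  have hcb : ‖c - b‖ ≤ 9 * δ := by
    have h3 : ‖(c - b) • r‖ ≤ 9 * δ := by
      have e : (c - b) • r = z - (c - a) • x := by rw [hz]; abel
      rw [e]
      linarith [norm_sub_le z ((c - a) • x)]
    have h4 := ((c - b) • r).norm_apply_le γ
    rw [Sp.coe_smul, Pi.smul_apply, hrγ, smul_eq_mul, mul_one] at h4
    exact h4.trans h3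
  have hcbx : ‖(c - b) • x‖ ≤ 9 * δ * C :=
    (x.norm_smul_le' _).trans (mul_le_mul hcb hx.norm_le (norm_nonneg _) (by positivity))
  have e : T x - b • x = (T x - a • x) - (c - a) • x + (c - b) • x := by
    rw [sub_smul, sub_smul]; abel
  rw [e]
  have h3 := norm_add_le ((T x - a • x) - (c - a) • x) ((c - b) • x)
  have h4 := norm_sub_le (T x - a • x) ((c - a) • x)
  linarith

end

section

variable {ν : ℕ → Node (DualNumber ℝ)}

theorem eventually_norm_smul_sub_le (hR : Rich ν) {hν : Adm ν} (T : Sp hν →L[ℝ] Sp hν) {C δ : ℝ}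
    (hδ : 0 < δ) : ∀ᶠ P in atTop, ∀ q, ∀ x : Sp hν, Loc ν C P q x.1 → ∀ q' γ, ∀ r : Sp hν,
      Loc ν 8 q q' r.1 → r.1 γ = 1 → ∀ b : DualNumber ℝ, ‖T r - b • r‖ ≤ δ →
        ‖T x - b • x‖ ≤ (7 + 9 * C) * δ := by
  filter_upwards [eventually_exists_norm_sub_le hR T (C := C) hδ,
    eventually_exists_norm_sub_le hR T (C := C + 8) hδ] with P h1 h2 q x hx q' γ r hr hrγ b hb
  rcases le_or_gt q P with hqP | hqP
  · have hx0 : x = 0 := by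
      rw [Sp.ext_iff', ← hx.high, ext_eq_zero_of_le hν hx.low hqP]; rfl
    have := hx.nonneg
    rw [hx0, map_zero, smul_zero, sub_zero, norm_zero]
    positivity
  obtain ⟨a, ha⟩ := h1 q x hx
  obtain ⟨c, hc⟩ := h2 (max q q') (x + r) (by
    rw [Sp.coe_add]
    exact hx.add hν (hr.mono hν le_rfl le_rfl (le_max_right q q')) hqP.le (le_max_left q q'))
  exact norm_smul_sub_le hδ.le hx hr hrγ ha hb hc

theorem exists_scalar (hR : Rich ν) {hν : Adm ν} (T : Sp hν →L[ℝ] Sp hν) :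
    ∃ a : DualNumber ℝ, ∀ C δ : ℝ, 0 < δ → ∀ᶠ P in atTop, ∀ q, ∀ x : Sp hν, Loc ν C P q x.1 →
      ‖T x - a • x‖ ≤ δ := by
  have key : ∀ n : ℕ, ∃ (q : ℕ) (r : Sp hν) (γ : ℕ) (b : DualNumber ℝ), Loc ν 8 n q r.1 ∧
      r.1 γ = 1 ∧ ‖T r - b • r‖ ≤ 1 / ((n : ℝ) + 1) := fun n => by
    obtain ⟨P, hP, hn⟩ := ((eventually_exists_norm_sub_le hR T (C := 8)
      (δ := 1 / ((n : ℝ) + 1)) (by positivity)).and (eventually_ge_atTop n)).exists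
    obtain ⟨q, r, γ, hr, hγ⟩ := hR.exists_reference (hν := hν) P
    obtain ⟨b, hb⟩ := hP q r hr
    exact ⟨q, r, γ, b, hr.mono hν le_rfl hn le_rfl, hγ, hb⟩
  choose Q r γ b hr hγ hb using key
  have hbound : ∀ n, b n ∈ Metric.closedBall (0 : DualNumber ℝ) (‖T‖ * 8 + 1) := fun n => by
    rw [mem_closedBall_zero_iff]
    have h1 := (b n • r n).norm_apply_le (γ n)
    rw [Sp.coe_smul, Pi.smul_apply, hγ, smul_eq_mul, mul_one] at h1
    have h2 := norm_sub_le (T (r n)) (T (r n) - b n • r n)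
    rw [sub_sub_cancel] at h2
    have h3 := T.le_opNorm_of_le (hr n).norm_le
    have h4 : 1 / ((n : ℝ) + 1) ≤ 1 := by
      rw [div_le_one (by positivity)]; linarith [Nat.cast_nonneg (α := ℝ) n]
    linarith [hb n]
  obtain ⟨a, -, φ, hφ, hlim⟩ := (isCompact_closedBall (0 : DualNumber ℝ) (‖T‖ * 8 + 1)).tendsto_subseq
    hbound
  refine ⟨a, fun C δ hδ => ?_⟩
  by_cases hC : 0 ≤ C
  swap
  · exact Eventually.of_forall fun P q x hx => absurd hx.nonneg hC
  have hδ' : 0 < δ / (8 + 10 * C) := by positivity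
  filter_upwards [eventually_norm_smul_sub_le hR T (C := C) hδ'] with P hP q x hx
  obtain ⟨n, ⟨h1, h2⟩, h3⟩ := (((Metric.tendsto_nhds.1 hlim _ hδ').and
    ((tendsto_one_div_add_atTop_nhds_zero_nat.comp hφ.tendsto_atTop).eventually
      (ge_mem_nhds hδ'))).and (eventually_ge_atTop q)).exists
  have h4 := hP q x hx (Q (φ n)) (γ (φ n)) (r (φ n))
    ((hr _).mono hν le_rfl (h3.trans hφ.le_apply) le_rfl) (hγ _) (b (φ n)) ((hb _).trans h2)
  have h5 : ‖(b (φ n) - a) • x‖ ≤ δ / (8 + 10 * C) * C := by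
    rw [dist_eq_norm] at h1
    exact (x.norm_smul_le' _).trans (mul_le_mul h1.le hx.norm_le (norm_nonneg _) hδ'.le)
  have e : T x - a • x = (T x - b (φ n) • x) + (b (φ n) - a) • x := by
    rw [sub_smul]; abel
  rw [e]
  have h6 := norm_add_le (T x - b (φ n) • x) ((b (φ n) - a) • x)
  have h7 : (8 + 10 * C) * (δ / (8 + 10 * C)) = δ := by field_simp
  nlinarith

/-- Every operator is a multiplication plus a compact operator. -/
theorem exists_isCompactOperator_sub (hR : Rich ν) {hν : Adm ν} (T : Sp hν →L[ℝ] Sp hν) :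
    ∃ a : DualNumber ℝ, IsCompactOperator (T - smulL hν a) := by
  obtain ⟨a, ha⟩ := exists_scalar hR T
  exact ⟨a, isCompactOperator_of_forall_loc (T := T - smulL hν a) ha⟩

end

section

variable {A : Type*} [NormedCommRing A] [NormedAlgebra ℝ A] {ν : ℕ → Node A} {hν : Adm ν}

theorem Loc.smul {C : ℝ} {P q : ℕ} {x : ℕ → A} (hν : Adm ν) (hx : Loc ν C P q x) (a : A) :
    Loc ν (‖a‖ * C) P q (a • x) where
  low := by rw [ext_smul hν, hx.low, smul_zero]
  high := by rw [ext_smul hν, hx.high]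
  bound γ := (norm_mul_le _ _).trans (mul_le_mul_of_nonneg_left (hx.bound γ) (norm_nonneg _))
  small γ h := by
    rw [mul_div_assoc]
    exact (norm_mul_le _ _).trans (mul_le_mul_of_nonneg_left (hx.small γ h) (norm_nonneg _))

/-- Consecutive blocks supported between the terms of a strictly increasing sequence. -/
structure BlockSeq (ν : ℕ → Node A) (y : ℕ → ℕ → A) (p : ℕ → ℕ) : Prop where
  mono : StrictMono p
  low : ∀ i, ext ν (p i) (y i) = 0
  high : ∀ i, ext ν (p (i + 1)) (y i) = y i

theorem BlockSeq.comp {y : ℕ → ℕ → A} {p : ℕ → ℕ} (h : BlockSeq ν y p) (hν : Adm ν) {g : ℕ → ℕ}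
    (hg : StrictMono g) : BlockSeq ν (fun i => y (g i)) fun i => p (g i) where
  mono := h.mono.comp hg
  low i := h.low (g i)
  high i := ext_eq_self_of_le hν (h.high (g i))
    (h.mono.monotone (Nat.succ_le_of_lt (hg (Nat.lt_succ_self i))))

theorem BlockSeq.group {y : ℕ → ℕ → A} {p : ℕ → ℕ} (h : BlockSeq ν y p) (hν : Adm ν) {m : ℕ}
    (hm : 0 < m) : BlockSeq ν (fun i => ∑ l ∈ range m, y (i * m + l)) fun i => p (i * m) where
  mono := h.mono.comp fun _ _ hab => Nat.mul_lt_mul_of_pos_right hab hm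
  low i := by
    rw [ext_sum hν]
    exact Finset.sum_eq_zero fun l _ =>
      ext_eq_zero_of_le hν (h.low _) (h.mono.monotone (Nat.le_add_right _ _))
  high i := by
    rw [ext_sum hν]
    refine Finset.sum_congr rfl fun l hl => ext_eq_self_of_le hν (h.high _) (h.mono.monotone ?_)
    rw [mem_range] at hl
    rw [add_mul]; omega

theorem BlockSeq.block {y : ℕ → ℕ → A} {p : ℕ → ℕ} (h : BlockSeq ν y p) {C : ℝ}
    (hy : ∀ i γ, ‖y i γ‖ ≤ C) : Block ν C Set.univ y p fun i => p (i + 1) where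
  nonneg := (norm_nonneg _).trans (hy 0 0)
  sep _ _ _ _ hik := h.mono.monotone (Nat.succ_le_of_lt hik)
  low i _ := h.low i
  high i _ := h.high i
  bound i _ := hy i

/-- A long average of successive vectors is small on coordinates of low weight. -/
theorem BlockSeq.loc_average {y : ℕ → ℕ → A} {p : ℕ → ℕ} (h : BlockSeq ν y p) (hν : Adm ν)
    {N P : ℕ} (hN : 0 < N) (hP : P ≤ p 0) (hNP : ∀ l < P, 6 * (nn l : ℝ) * mm l ≤ N)
    {t : ℝ} (ht : 0 < t) (hy : ∀ i γ, ‖y i γ‖ ≤ t) :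
    Loc ν 2 P (p N) ((N * t)⁻¹ • ∑ i ∈ range N, y i) := by
  have hN' : (0 : ℝ) < N := by exact_mod_cast hN
  have hb := h.block hy
  refine ⟨?_, ?_, fun γ => ?_, fun γ hγ => ?_⟩
  · rw [ext_rsmul hν, ext_sum hν, Finset.sum_eq_zero fun i _ => ?_, smul_zero]
    exact ext_eq_zero_of_le hν (h.low i) (hP.trans (h.mono.monotone (Nat.zero_le i)))
  · rw [ext_rsmul hν, ext_sum hν, Finset.sum_congr rfl fun i hi => ?_]
    exact ext_eq_self_of_le hν (h.high i) (h.mono.monotone (by rw [mem_range] at hi; omega))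
  · rw [Pi.smul_apply, norm_smul, Real.norm_of_nonneg (by positivity), inv_mul_le_iff₀ (by positivity)]
    have := hb.norm_sum_le (E := range N) (fun i _ => trivial) γ
    rw [card_range] at this
    nlinarith [mul_pos hN' ht]
  · rw [Pi.smul_apply, norm_smul, Real.norm_of_nonneg (by positivity), inv_mul_le_iff₀ (by positivity)]
    have h1 := hb.norm_sum_le_of_wt hν (K := 0) (lam := t) le_rfl ht.le (fun γ E hE => by
      rw [zero_add]; exact hb.norm_sum_le hE γ) (E := range N) (fun i _ => trivial) γ
    rw [card_range] at h1
    have hm := mm_pos (ν γ).wt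
    refine h1.trans ?_
    rw [mul_div_assoc', le_div_iff₀ hm]
    have e : (nn (ν γ).wt * (6 * t + 0) + t / mm (ν γ).wt * N) * mm (ν γ).wt =
        (6 * (nn (ν γ).wt : ℝ) * mm (ν γ).wt) * t + t * N := by field_simp; ring
    rw [e]
    nlinarith [mul_le_mul_of_nonneg_right (hNP _ hγ) ht.le]

end

theorem sum_range_mul {M : Type*} [AddCommMonoid M] (f : ℕ → M) (N m : ℕ) :
    ∑ i ∈ range (N * m), f i = ∑ i ∈ range N, ∑ l ∈ range m, f (i * m + l) := by
  induction N with
  | zero => simp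
  | succ N ih => rw [add_mul, one_mul, Finset.sum_range_add, ih, Finset.sum_range_succ]

theorem exists_group_of_large {E : Type*} [SeminormedAddCommGroup E] {y : ℕ → E}
    (hy : ∀ i, ‖y i‖ ≤ 1) {N s : ℕ} (hN : 2 ≤ N) {g : ℕ → ℕ} (hg : StrictMono g)
    (h : ((N : ℝ) / 2) ^ s < ‖∑ i ∈ range (N ^ s), y (g i)‖) :
    ∃ (g : ℕ → ℕ) (m : ℕ) (t : ℝ), StrictMono g ∧ 0 < m ∧ 1 ≤ t ∧
      (∀ i, ‖∑ l ∈ range m, y (g (i * m + l))‖ ≤ t) ∧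
      N * t / 2 ≤ ‖∑ i ∈ range N, ∑ l ∈ range m, y (g (i * m + l))‖ := by
  by_contra hcon
  push Not at hcon
  have hN' : (2 : ℝ) ≤ N := by exact_mod_cast hN
  have key : ∀ r : ℕ, ∀ g : ℕ → ℕ, StrictMono g →
      ‖∑ i ∈ range (N ^ r), y (g i)‖ ≤ ((N : ℝ) / 2) ^ r := by
    intro r
    induction r with
    | zero =>
      intro g _
      rw [pow_zero, pow_zero, Finset.sum_range_one]
      exact hy (g 0)
    | succ r ih =>
      intro g hg
      have h1 := hcon g (N ^ r) (((N : ℝ) / 2) ^ r) hg (by positivity)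
        (one_le_pow₀ (by linarith)) fun i => ih (fun l => g (i * N ^ r + l)) fun a b hab =>
          hg (by simpa using hab)
      rw [pow_succ', sum_range_mul, pow_succ']
      linarith
  exact absurd (key s g hg) (not_le.2 h)

theorem exists_strictMono_image_range (F : Finset ℕ) :
    ∃ g : ℕ → ℕ, StrictMono g ∧ F = (range F.card).image g := by
  classical
  let f := F.orderEmbOfFin rfl
  have hf : ∀ i, f i ≤ F.sup id := fun i => Finset.le_sup (f := id) (F.orderEmbOfFin_mem rfl i)
  let g : ℕ → ℕ := fun i => if h : i < F.card then f ⟨i, h⟩ else F.sup id + 1 + i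
  have hg : StrictMono g := fun a b hab => by
    simp only [g]
    split_ifs with h1 h2 h2
    · exact f.strictMono hab
    · have := hf ⟨a, h1⟩; omega
    · omega
    · omega
  refine ⟨g, hg, (Finset.eq_of_subset_of_card_le ?_ ?_).symm⟩
  · intro x hx
    obtain ⟨i, hi, rfl⟩ := Finset.mem_image.1 hx
    rw [mem_range] at hi
    simp only [g]
    rw [dif_pos hi]
    exact F.orderEmbOfFin_mem rfl _
  · rw [Finset.card_image_of_injective _ hg.injective, card_range]

section

variable {ν : ℕ → Node (DualNumber ℝ)} {hν : Adm ν}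

theorem exists_lower_functional {q : ℕ} {y : Sp hν} (hq : ext ν q y.1 = y.1) (hy : 0 < ‖y‖) :
    ∃ v : List ℕ, (∀ η, q ≤ η → listFn (DualNumber ℝ) v η = 0) ∧
      (∀ R, ∑ η ∈ range R, ‖listFn (DualNumber ℝ) v η‖ ≤ 1) ∧
      ‖y‖ / 16 ≤ sndL (∑ η ∈ range q, listFn (DualNumber ℝ) v η * y.1 η) := by
  have hproj : proj hν q y = y := by rw [Sp.ext_iff', proj_apply, hq]
  have hr := norm_proj_le_restr q y
  rw [hproj] at hr
  obtain ⟨B, hB, -, hBy⟩ := exists_functional (0 : Fin q → DualNumber ℝ) (restr hν q y)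
    (δ := ‖y‖ / 2) (fun a => by rw [smul_zero, sub_zero]; linarith)
  let B' : ℕ → DualNumber ℝ := fun η => if h : η < q then B ⟨η, h⟩ else 0
  have hB' : ∀ i : Fin q, B' i = B i := fun i => by simp [B']
  obtain ⟨v, h1, h2, h3⟩ := exists_listFn_near B' q (by
    rw [Finset.sum_range]; simp only [hB']; exact hB) (e := 1 / (16 * ((q : ℝ) + 1))) (by positivity)
  refine ⟨v, h1, h3, ?_⟩
  have e1 : sndL (∑ i, B i * restr hν q y i) = sndL (∑ η ∈ range q, B' η * y.1 η) := by
    rw [Finset.sum_range]; simp only [hB', restr_apply]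
  rw [e1] at hBy
  have e2 : ‖∑ η ∈ range q, (listFn (DualNumber ℝ) v η * y.1 η - B' η * y.1 η)‖ ≤ ‖y‖ / 16 := by
    refine (norm_sum_le_of_le (range q) (fun η hη => (?_ : _ ≤ 1 / (16 * ((q : ℝ) + 1)) * ‖y‖))).trans ?_
    · rw [← sub_mul]
      exact (norm_mul_le _ _).trans (mul_le_mul (h2 η (mem_range.1 hη)) (y.norm_apply_le η)
        (norm_nonneg _) (by positivity))
    · rw [Finset.sum_const, card_range, nsmul_eq_mul, ← mul_assoc, mul_one_div, div_mul_eq_mul_div,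
        div_le_div_iff₀ (by positivity) (by norm_num)]
      nlinarith
  rw [Finset.sum_sub_distrib] at e2
  have e3 := (abs_le.1 ((abs_sndL_le _).trans e2)).1
  rw [map_sub] at e3
  linarith

theorem exists_sum_large (hR : Rich ν) {y : ℕ → Sp hν} {p : ℕ → ℕ}
    (h : BlockSeq ν (fun i => ⇑(y i).1) p) (hy : ∀ i, 1 / 8 ≤ ‖y i‖) {j n : ℕ} (hj : j % 2 = 0)
    (hn : 1 ≤ n) (hnj : n ≤ nn j) :
    ∃ g : ℕ → ℕ, StrictMono g ∧ (n : ℝ) ≤ 128 * mm j * ‖∑ i ∈ range n, y (g i)‖ := by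
  classical
  choose v h1 h2 h3 using fun i => exists_lower_functional (h.high i)
    (show 0 < ‖y i‖ by linarith [hy i])
  obtain ⟨F, θ, hF, -, -, -, hu⟩ := hR.exists_even_chain h.mono.tendsto_atTop v h2
    (q := fun i => p (i + 1)) h1 hj hn hnj 0
  have e := hu (fun i => ⇑(y i).1) h.low h.high
  obtain ⟨g, hg, hFg⟩ := exists_strictMono_image_range F
  rw [hF] at hFg
  refine ⟨g, hg, ?_⟩
  rw [← Finset.sum_image (s := range n) (f := y) hg.injective.injOn, ← hFg]
  have hm := mm_pos j
  have h4 : (n : ℝ) / 128 ≤ sndL (∑ i ∈ F, ∑ η ∈ range (p (i + 1)),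
      listFn (DualNumber ℝ) (v i) η * (y i).1 η) := by
    rw [map_sum, ← hF, div_eq_mul_one_div, ← nsmul_eq_mul]
    exact Finset.card_nsmul_le_sum _ _ _ fun i _ => by linarith [hy i, h3 i]
  have h5 := (le_abs_self _).trans (abs_sndL_le (∑ i ∈ F, ∑ η ∈ range (p (i + 1)),
      listFn (DualNumber ℝ) (v i) η * (y i).1 η))
  have h6 := (∑ i ∈ F, y i).norm_apply_le θ
  rw [Sp.coe_sum, e, norm_smul, norm_inv, Real.norm_of_nonneg hm.le, inv_mul_le_iff₀ hm] at h6
  linarith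

/-- Among successive vectors there are long averages of groups that keep half of their norm. -/
theorem exists_group_large (hR : Rich ν) {y : ℕ → Sp hν} {p : ℕ → ℕ}
    (h : BlockSeq ν (fun i => ⇑(y i).1) p) (hy : ∀ i, 1 / 8 ≤ ‖y i‖) (hy1 : ∀ i, ‖y i‖ ≤ 1)
    {N : ℕ} (hN : 2 ≤ N) :
    ∃ (g : ℕ → ℕ) (m : ℕ) (t : ℝ), StrictMono g ∧ 0 < m ∧ 1 ≤ t ∧
      (∀ i, ‖∑ l ∈ range m, y (g (i * m + l))‖ ≤ t) ∧
      N * t / 2 ≤ ‖∑ i ∈ range N, ∑ l ∈ range m, y (g (i * m + l))‖ := by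
  obtain ⟨j, hj, hNj⟩ : ∃ j, j % 2 = 0 ∧ N + 1 ≤ j := ⟨2 * (N + 1), by omega, by omega⟩
  obtain ⟨s, hs⟩ : ∃ s, s = 2 ^ (j + 1) + 10 := ⟨_, rfl⟩
  obtain ⟨g, hg, h1⟩ := exists_sum_large hR h hy hj (n := N ^ s) (Nat.one_le_pow _ _ (by omega))
    (hs ▸ pow_le_nn hNj)
  refine exists_group_of_large hy1 hN hg (s := s) ?_
  have hm := mm_pos j
  have h4 : (0 : ℝ) < (N : ℝ) ^ s := by positivity
  have h2 : (2 : ℝ) ^ s = 1024 * mm j := by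
    rw [hs, pow_add, two_pow_eq_mm]; norm_num [mul_comm]
  rw [div_pow, h2, div_lt_iff₀ (by positivity)]
  rw [Nat.cast_pow] at h1
  linarith

end

section

variable {A : Type*} [NormedCommRing A] [NormedAlgebra ℝ A] {ν : ℕ → Node A} {hν : Adm ν}

theorem exists_mem_proj_eq_zero [FiniteDimensional ℝ A] {Y : Submodule ℝ (Sp hν)}
    (hY : ¬FiniteDimensional ℝ Y) (P : ℕ) {c : ℝ} (hc : 0 < c) :
    ∃ w ∈ Y, ‖w‖ = c ∧ proj hν P w = 0 := by
  let f : Y →ₗ[ℝ] (Fin P → A) := (restr hν P : Sp hν →ₗ[ℝ] (Fin P → A)) ∘ₗ Y.subtype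
  have hf : ¬Function.Injective f := fun hf => hY (FiniteDimensional.of_injective f hf)
  rw [← LinearMap.ker_eq_bot, Submodule.eq_bot_iff] at hf
  push Not at hf
  obtain ⟨w, hw, hw0⟩ := hf
  have h1 : restr hν P w.1 = 0 := hw
  have h2 : 0 < ‖w.1‖ := norm_pos_iff.2 fun h => hw0 (Subtype.ext h)
  have h3 : proj hν P w.1 = 0 := by
    have := norm_proj_le_restr P w.1
    rw [h1, norm_zero, mul_zero] at this
    exact norm_le_zero_iff.1 this
  refine ⟨(c / ‖w.1‖) • w.1, Y.smul_mem _ w.2, ?_, ?_⟩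
  · rw [norm_smul, Real.norm_of_nonneg (by positivity), div_mul_cancel₀ _ h2.ne']
  · rw [map_smul, h3, smul_zero]

end

theorem exists_forall_lt_le (f : ℕ → ℝ) (P : ℕ) : ∃ N : ℕ, 2 ≤ N ∧ ∀ l < P, f l ≤ N := by
  obtain ⟨N, hN, h⟩ := ((eventually_ge_atTop 2).and
    ((eventually_all_finset (range P)).2 fun l _ =>
      tendsto_natCast_atTop_atTop.eventually_ge_atTop (f l))).exists
  exact ⟨N, hN, fun l hl => h l (mem_range.2 hl)⟩

section

variable {ν : ℕ → Node (DualNumber ℝ)} {hν : Adm ν}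

/-- Successive vectors that are close to a given infinite-dimensional subspace. -/
theorem exists_blockSeq {Y : Submodule ℝ (Sp hν)}
    (hY : ¬FiniteDimensional ℝ Y) (P : ℕ) {e : ℝ} (he : 0 < e) (he' : e ≤ 1 / 8) :
    ∃ (y w : ℕ → Sp hν) (p : ℕ → ℕ), p 0 = P ∧ BlockSeq ν (fun i => ⇑(y i).1) p ∧
      (∀ i, 1 / 8 ≤ ‖y i‖) ∧ (∀ i, ‖y i‖ ≤ 1) ∧ (∀ i, w i ∈ Y) ∧
      ∀ i, ‖y i - w i‖ ≤ e / 2 ^ (i + 1) := by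
  have step : ∀ (i Q : ℕ), ∃ (y w : Sp hν) (r : ℕ), Q < r ∧ ext ν Q y.1 = 0 ∧
      ext ν r y.1 = y.1 ∧ 1 / 8 ≤ ‖y‖ ∧ ‖y‖ ≤ 1 ∧ w ∈ Y ∧ ‖y - w‖ ≤ e / 2 ^ (i + 1) := fun i Q => by
    obtain ⟨w, hw, hw1, hw2⟩ := exists_mem_proj_eq_zero hY Q (c := 1 / 4) (by norm_num)
    have hpos : 0 < e / 2 ^ (i + 1) := by positivity
    obtain ⟨y, r, -, h1, h2, h3, h4, h5⟩ := exists_block_near w 0 hpos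
      (by rw [hw2, norm_zero]; exact (half_pos hpos).le)
    refine ⟨y, w, r, h1, h2, h3, ?_, by linarith, hw, by rwa [norm_sub_rev]⟩
    have h6 : e / 2 ^ (i + 1) ≤ e := div_le_self he.le (one_le_pow₀ one_le_two)
    have h7 := norm_sub_norm_le w y
    linarith
  choose y w r h1 h2 h3 h4 h5 h6 h7 using step
  let p : ℕ → ℕ := fun k => Nat.rec P (fun k Q => r k Q) k
  have hp : ∀ k, p (k + 1) = r k (p k) := fun _ => rfl
  refine ⟨fun k => y k (p k), fun k => w k (p k), p, rfl,
    ⟨strictMono_nat_of_lt_succ fun k => by rw [hp]; exact h1 k _, fun i => h2 i _,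
      fun i => by rw [hp]; exact h3 i _⟩, fun i => h4 i _, fun i => h5 i _, fun i => h6 i _,
    fun i => h7 i _⟩

theorem exists_loc_near (hR : Rich ν) {Y : Submodule ℝ (Sp hν)} (hY : ¬FiniteDimensional ℝ Y)
    (P : ℕ) {e : ℝ} (he : 0 < e) (he' : e ≤ 1 / 8) :
    ∃ (x w : Sp hν) (q : ℕ), P < q ∧ Loc ν 2 P q x.1 ∧ 1 / 2 ≤ ‖x‖ ∧ w ∈ Y ∧ ‖x - w‖ ≤ e := by
  obtain ⟨y, w, p, hp, hy, h1, h2, h3, h4⟩ := exists_blockSeq hY P he he'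
  obtain ⟨N, hN, hNP⟩ := exists_forall_lt_le (fun l => 6 * (nn l : ℝ) * mm l) P
  obtain ⟨g, m, t, hg, hm, ht, h5, h6⟩ := exists_group_large hR hy h1 h2 hN
  have hb := (hy.comp hν hg).group hν hm
  have hN' : (2 : ℝ) ≤ N := by exact_mod_cast hN
  have ht' : 0 < t := by linarith
  have hNt : 0 < (N : ℝ) * t := by positivity
  have hP0 : P ≤ p (g (0 * m)) := hp ▸ hy.mono.monotone (Nat.zero_le _)
  have hloc := hb.loc_average hν (N := N) (P := P) (by omega) hP0 hNP ht' (fun i γ => by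
    have := ((∑ l ∈ range m, y (g (i * m + l))).norm_apply_le γ).trans (h5 i)
    rwa [Sp.coe_sum] at this)
  refine ⟨(N * t)⁻¹ • ∑ i ∈ range N, ∑ l ∈ range m, y (g (i * m + l)),
    (N * t)⁻¹ • ∑ i ∈ range N, ∑ l ∈ range m, w (g (i * m + l)), p (g (N * m)), ?_, ?_, ?_, ?_, ?_⟩
  · exact hP0.trans_lt (hy.mono (hg (Nat.mul_lt_mul_of_pos_right (by omega) hm)))
  · rw [Sp.coe_rsmul, Sp.coe_sum]
    simp only [Sp.coe_sum]
    exact hloc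
  · rw [norm_smul, Real.norm_of_nonneg (by positivity), le_inv_mul_iff₀ hNt]
    linarith
  · exact Y.smul_mem _ (Y.sum_mem fun i _ => Y.sum_mem fun l _ => h3 _)
  · rw [← smul_sub, norm_smul, Real.norm_of_nonneg (by positivity), inv_mul_le_iff₀ hNt,
      ← sum_range_mul (fun i => y (g i)), ← sum_range_mul (fun i => w (g i)),
      ← Finset.sum_sub_distrib]
    have h8 : ‖∑ i ∈ range (N * m), (y (g i) - w (g i))‖ ≤
        ∑ i ∈ range (N * m), e / 2 ^ (i + 1) := norm_sum_le_of_le _ fun i _ =>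
      (h4 (g i)).trans (div_le_div_of_nonneg_left he.le (by positivity)
        (pow_le_pow_right₀ one_le_two (Nat.succ_le_succ hg.le_apply)))
    have h9 := sum_div_two_pow_le he.le (range (N * m))
    have h10 : 1 ≤ (N : ℝ) * t := by nlinarith
    exact (h8.trans h9).trans (le_mul_of_one_le_left he.le h10)

theorem norm_eps : ‖(DualNumber.eps : DualNumber ℝ)‖ = 1 := by
  rw [norm_eq]; simp

theorem smulL_eps_smul (a : DualNumber ℝ) (x : Sp hν) :
    smulL hν DualNumber.eps (x - a • (DualNumber.eps : DualNumber ℝ) • x) =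
      smulL hν DualNumber.eps x := by
  rw [smulL_apply, smulL_apply, smul_sub, smul_smul, smul_smul, mul_right_comm,
    DualNumber.eps_mul_eps, zero_mul, zero_smul, sub_zero]

theorem norm_smulL_eps_le (x : Sp hν) : ‖smulL hν DualNumber.eps x‖ ≤ ‖x‖ := by
  have := x.norm_smul_le' (DualNumber.eps : DualNumber ℝ)
  rwa [norm_eps, one_mul] at this

theorem exists_norm_smulL_eps_lt (hR : Rich ν) {hν : Adm ν} (Y : Submodule ℝ (Sp hν))
    (hY : ¬FiniteDimensional ℝ Y) {c : ℝ} (hc : 0 < c) :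
    ∃ y ∈ Y, ‖smulL hν DualNumber.eps y‖ < c * ‖y‖ := by
  by_contra hcon
  push Not at hcon
  set S := smulL hν (DualNumber.eps : DualNumber ℝ) with hS
  have step : ∀ η > 0, ∀ P, ∃ (x y : Sp hν) (q : ℕ), P < q ∧ Loc ν 2 P q x.1 ∧ ext ν P y.1 = 0 ∧
      ext ν q y.1 = y.1 ∧ ‖y‖ ≤ 2 ∧ (∀ a : DualNumber ℝ, c / 8 ≤ ‖y - a • x‖) ∧
      (x = S y ∧ ∃ w ∈ Y, ‖y - w‖ ≤ η) := fun η hη P => by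
    obtain ⟨y, w, q, h1, h2, h3, h4, h5⟩ := exists_loc_near hR hY P
      (e := min η (min (1 / 8) (c / 8))) (by positivity)
      ((min_le_right _ _).trans (min_le_left _ _))
    refine ⟨S y, y, q, h1, ?_, h2.low, h2.high, h2.norm_le, fun a => ?_, rfl, w, h4,
      h5.trans (min_le_left _ _)⟩
    · have := h2.smul hν (DualNumber.eps : DualNumber ℝ)
      rwa [norm_eps, one_mul] at this
    · have h6 := norm_smulL_eps_le (y - a • S y)
      have e1 : S (y - a • S y) = S y := smulL_eps_smul a y
      rw [← hS, e1] at h6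
      have h7 := hcon w h4
      have h8 : ‖S (w - y)‖ ≤ ‖w - y‖ := norm_smulL_eps_le (w - y)
      rw [map_sub, norm_sub_rev w y] at h8
      have h9 := norm_sub_norm_le y w
      have h10 := norm_sub_norm_le (S w) (S y)
      have h11 : ‖y - w‖ ≤ 1 / 8 := h5.trans ((min_le_right _ _).trans (min_le_left _ _))
      have h12 : ‖y - w‖ ≤ c / 8 := h5.trans ((min_le_right _ _).trans (min_le_right _ _))
      have h13 : c * (3 / 8) ≤ c * ‖w‖ := mul_le_mul_of_nonneg_left (by linarith) hc.le
      linarith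
  obtain ⟨e, he, hce⟩ : ∃ e : ℝ, 0 < e ∧ (c + 2) * e < c * (c / 8 / 32) :=
    ⟨c * (c / 8 / 32) / (2 * (c + 2)), by positivity, by
      have : (c + 2) * (c * (c / 8 / 32) / (2 * (c + 2))) = c * (c / 8 / 32) / 2 := by field_simp
      rw [this]; exact half_lt_self (by positivity)⟩
  obtain ⟨x, y, s, a, ha, hx, hy, hR⟩ := exists_transversal hR (hν := hν) (C := 2) (C' := 2)
    (δ := c / 8) (R := fun η x y => x = S y ∧ ∃ w ∈ Y, ‖y - w‖ ≤ η) zero_le_two zero_le_two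
    (by positivity) step he
  choose hxy w hw hyw using hR
  have h1 : ‖∑ i ∈ s, a i • y i - ∑ i ∈ s, a i • w i‖ ≤ e := by
    rw [← Finset.sum_sub_distrib]
    refine (norm_sum_le_of_le s fun i _ => ?_).trans (sum_div_two_pow_le he.le s)
    rw [← smul_sub, norm_smul, Real.norm_eq_abs]
    exact (mul_le_of_le_one_left (norm_nonneg _) (ha i)).trans (hyw i)
  have h2 : ∑ i ∈ s, a i • x i = S (∑ i ∈ s, a i • y i) := by
    rw [map_sum]
    exact Finset.sum_congr rfl fun i _ => by rw [map_smul, ← hxy]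
  obtain ⟨u, hu⟩ : ∃ u, u = ∑ i ∈ s, a i • y i := ⟨_, rfl⟩
  obtain ⟨v, hv⟩ : ∃ v, v = ∑ i ∈ s, a i • w i := ⟨_, rfl⟩
  have hvY : v ∈ Y := hv ▸ Y.sum_mem fun i _ => Y.smul_mem _ (hw i)
  rw [h2, ← hu] at hx
  rw [← hu] at hy
  rw [← hu, ← hv] at h1
  have h3 := hcon v hvY
  have h4 : ‖S (v - u)‖ ≤ ‖v - u‖ := norm_smulL_eps_le (v - u)
  rw [map_sub, norm_sub_rev v u] at h4
  have h5 := norm_sub_norm_le (S v) (S u)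
  have h6 := norm_sub_norm_le u v
  have h7 : c * (c / 8 / 32 - e) ≤ c * ‖v‖ := mul_le_mul_of_nonneg_left (by linarith) hc.le
  linarith

theorem not_isCompactOperator_smulL_eps (hR : Rich ν) {hν : Adm ν} :
    ¬IsCompactOperator (smulL hν (DualNumber.eps : DualNumber ℝ)) := by
  intro hcomp
  choose q r γ hr hγ using fun P => hR.exists_reference (hν := hν) P
  obtain ⟨K, hK, hKS⟩ := IsCompactOperator.image_closedBall_subset_compact hcomp 8
  obtain ⟨x, -, φ, hφ, hlim⟩ := hK.tendsto_subseq (x := fun P => smulL hν DualNumber.eps (r P))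
    fun P => hKS ⟨r P, mem_closedBall_zero_iff.2 (hr P).norm_le, rfl⟩
  have hx : ∀ p, proj hν p x = 0 := fun p => by
    refine tendsto_nhds_unique (((proj hν p).continuous.tendsto x).comp hlim)
      (tendsto_const_nhds.congr' ?_)
    filter_upwards [eventually_ge_atTop p] with n hn
    have h1 : proj hν p (r (φ n)) = 0 := by
      rw [Sp.ext_iff', proj_apply, ext_eq_zero_of_le hν (hr (φ n)).low (hn.trans hφ.le_apply)]
      rfl
    rw [Function.comp_apply, Function.comp_apply, smulL_apply, proj_smul, h1, smul_zero]
  have hx0 : x = 0 := tendsto_nhds_unique (tendsto_proj x)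
    (tendsto_const_nhds.congr fun p => (hx p).symm)
  have h1 : ∀ P, 1 ≤ ‖smulL hν DualNumber.eps (r P)‖ := fun P => by
    have := (smulL hν DualNumber.eps (r P)).norm_apply_le (γ P)
    rw [smulL_apply, Sp.coe_smul, Pi.smul_apply, hγ, smul_eq_mul, mul_one, norm_eps] at this
    exact this
  have h2 := ge_of_tendsto hlim.norm (Eventually.of_forall fun n => h1 (φ n))
  rw [hx0, norm_zero] at h2
  linarith

end

section

/-- The nilpotent shift on a finite-dimensional space. -/
noncomputable def shift (k : ℕ) : (Fin k → ℝ) →L[ℝ] (Fin k → ℝ) :=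
  LinearMap.toContinuousLinearMap
    { toFun := fun v i => if h : (i : ℕ) + 1 < k then v ⟨i + 1, h⟩ else 0
      map_add' := fun v w => by funext i; by_cases h : (i : ℕ) + 1 < k <;> simp [h]
      map_smul' := fun c v => by funext i; by_cases h : (i : ℕ) + 1 < k <;> simp [h] }

theorem shift_apply {k : ℕ} (v : Fin k → ℝ) (i : Fin k) :
    shift k v i = if h : (i : ℕ) + 1 < k then v ⟨i + 1, h⟩ else 0 := rfl

theorem shift_pow_apply {k : ℕ} (n : ℕ) (v : Fin k → ℝ) (i : Fin k) :
    (shift k ^ n) v i = if h : (i : ℕ) + n < k then v ⟨i + n, h⟩ else 0 := by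
  induction n generalizing v with
  | zero => simp
  | succ n ih =>
    rw [pow_succ, mul_apply_eq_comp, ih]
    by_cases h : (i : ℕ) + n < k
    · rw [dif_pos h, shift_apply]
      rfl
    · rw [dif_neg h, dif_neg (by omega)]

theorem shift_pow_self (k : ℕ) : shift k ^ k = 0 := by
  ext v i
  rw [shift_pow_apply, dif_neg (by omega)]; rfl

theorem shift_pow_pred_ne_zero {k : ℕ} (hk : 0 < k) : shift k ^ (k - 1) ≠ 0 := fun h => by
  have h1 := shift_pow_apply (k - 1) (fun _ => (1 : ℝ)) (⟨0, hk⟩ : Fin k)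
  rw [h, dif_pos (by simp only; omega)] at h1
  exact zero_ne_one h1

variable {Z F : Type*} [NormedAddCommGroup Z] [NormedSpace ℝ Z] [NormedAddCommGroup F]
  [NormedSpace ℝ F]

theorem prodMap_pow (T : Z →L[ℝ] Z) (N : F →L[ℝ] F) (n : ℕ) :
    (T.prodMap N) ^ n = (T ^ n).prodMap (N ^ n) := by
  induction n with
  | zero => rfl
  | succ n ih => rw [pow_succ, pow_succ, pow_succ, ih]; rfl

theorem isCompactOperator_of_factor [FiniteDimensional ℝ F] {V W : Type*} [NormedAddCommGroup V]
    [NormedSpace ℝ V] [NormedAddCommGroup W] [NormedSpace ℝ W] (f : V →L[ℝ] F) (g : F →L[ℝ] W) :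
    IsCompactOperator (g ∘L f) := by
  have : ProperSpace F := FiniteDimensional.proper ℝ F
  have h : IsCompactOperator g := ⟨g '' Metric.closedBall 0 1,
    (isCompact_closedBall 0 1).image g.continuous,
    mem_of_superset (Metric.closedBall_mem_nhds _ one_pos) (Set.subset_preimage_image _ _)⟩
  exact h.comp_clm f

theorem isCompactOperator_of_corner [FiniteDimensional ℝ F] {K : Z × F →L[ℝ] Z × F}
    (h : IsCompactOperator (ContinuousLinearMap.fst ℝ Z F ∘L K ∘L ContinuousLinearMap.inl ℝ Z F)) :
    IsCompactOperator K := by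
  have h1 := (h.comp_clm (ContinuousLinearMap.fst ℝ Z F)).clm_comp (ContinuousLinearMap.inl ℝ Z F)
  have h2 := isCompactOperator_of_factor (ContinuousLinearMap.snd ℝ Z F)
    (K ∘L ContinuousLinearMap.inr ℝ Z F)
  have h3 := isCompactOperator_of_factor (ContinuousLinearMap.snd ℝ Z F ∘L K ∘L
    ContinuousLinearMap.inl ℝ Z F ∘L ContinuousLinearMap.fst ℝ Z F) (ContinuousLinearMap.inr ℝ Z F)
  have e : K = (ContinuousLinearMap.inl ℝ Z F ∘L (ContinuousLinearMap.fst ℝ Z F ∘L K ∘L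
      ContinuousLinearMap.inl ℝ Z F) ∘L ContinuousLinearMap.fst ℝ Z F) +
      (K ∘L ContinuousLinearMap.inr ℝ Z F) ∘L ContinuousLinearMap.snd ℝ Z F +
      ContinuousLinearMap.inr ℝ Z F ∘L (ContinuousLinearMap.snd ℝ Z F ∘L K ∘L
      ContinuousLinearMap.inl ℝ Z F ∘L ContinuousLinearMap.fst ℝ Z F) := by
    refine ContinuousLinearMap.ext fun x => ?_
    have e : K x = K (x.1, 0) + K (0, x.2) := by rw [← map_add]; simp
    rw [e]
    change _ = ((K (x.1, 0)).1, (0 : F)) + K (0, x.2) + ((0 : Z), (K (x.1, 0)).2)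
    rw [add_right_comm]
    congr 1
    ext <;> simp
  rw [e]
  exact (h1.add h2).add h3

theorem strictlySingular_prodMap [FiniteDimensional ℝ F] {T : Z →L[ℝ] Z} (hT : StrictlySingular T)
    (N : F →L[ℝ] F) : StrictlySingular (T.prodMap N) := by
  intro Y hY c hc
  have h : ¬FiniteDimensional ℝ (Y.comap (LinearMap.inl ℝ Z F)) := fun h => hY <| by
    refine Module.Finite.iff_fg.2 (Submodule.fg_of_fg_map_of_fg_inf_ker (LinearMap.snd ℝ Z F)
      (IsNoetherian.noetherian _) ?_)
    have e : Y ⊓ LinearMap.ker (LinearMap.snd ℝ Z F) =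
        (Y.comap (LinearMap.inl ℝ Z F)).map (LinearMap.inl ℝ Z F) := by
      rw [Submodule.map_comap_eq, inf_comm, LinearMap.range_inl]
    rw [e]
    exact (Module.Finite.iff_fg.1 h).map _
  obtain ⟨z, hz, hlt⟩ := hT _ h c hc
  refine ⟨(z, 0), hz, ?_⟩
  change ‖((T z, N 0) : Z × F)‖ < c * ‖((z, 0) : Z × F)‖
  rw [map_zero, Prod.norm_mk, Prod.norm_mk, norm_zero,
    max_eq_left (norm_nonneg _), max_eq_left (norm_nonneg _)]
  exact hlt

/-- From square-zero operators to nilpotent operators of higher order. -/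
theorem exists_nilpotent {Z : Type} [NormedAddCommGroup Z] [NormedSpace ℝ Z] [CompleteSpace Z]
    [TopologicalSpace.SeparableSpace Z] {N : Z →L[ℝ] Z} (hN : N ^ 2 = 0) (hs : StrictlySingular N)
    (hc : ¬IsCompactOperator N)
    (h : ∀ T : Z →L[ℝ] Z, ∃ a b : ℝ,
      IsCompactOperator (T - (a • (1 : Z →L[ℝ] Z) + b • N))) {k : ℕ} (hk : 2 ≤ k) :
    ∃ (X : Type) (_ : NormedAddCommGroup X) (_ : NormedSpace ℝ X),
      CompleteSpace X ∧ TopologicalSpace.SeparableSpace X ∧ ¬FiniteDimensional ℝ X ∧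
      ∃ S : X →L[ℝ] X, S ^ k = 0 ∧ S ^ (k - 1) ≠ 0 ∧
        StrictlySingular S ∧ ¬IsCompactOperator S ∧
        ∀ T : X →L[ℝ] X, ∃ (lam : Fin k → ℝ) (K : X →L[ℝ] X),
          IsCompactOperator K ∧ T = (∑ i : Fin k, lam i • S ^ (i : ℕ)) + K := by
  have hS : ¬IsCompactOperator (N.prodMap (shift k)) := fun h => hc
    ((h.comp_clm (ContinuousLinearMap.inl ℝ Z (Fin k → ℝ))).clm_comp
      (ContinuousLinearMap.fst ℝ Z (Fin k → ℝ)))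
  refine ⟨Z × (Fin k → ℝ), inferInstance, inferInstance, inferInstance, inferInstance,
    fun _ => hS ?_, N.prodMap (shift k), ?_, ?_, strictlySingular_prodMap hs _, hS, fun T => ?_⟩
  · exact isCompactOperator_of_factor (N.prodMap (shift k)) (ContinuousLinearMap.id ℝ _)
  · rw [prodMap_pow, shift_pow_self, pow_eq_zero_of_le hk hN]
    rfl
  · rw [prodMap_pow]
    refine fun h0 => shift_pow_pred_ne_zero (k := k) (by omega) ?_
    ext v i
    have := DFunLike.congr_fun h0 ((0, v) : Z × (Fin k → ℝ))
    exact congr_fun (congr_arg Prod.snd this) i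
  · obtain ⟨a, b, hab⟩ := h
      (ContinuousLinearMap.fst ℝ Z (Fin k → ℝ) ∘L T ∘L ContinuousLinearMap.inl ℝ Z (Fin k → ℝ))
    obtain ⟨n, rfl⟩ : ∃ n, k = n + 2 := ⟨k - 2, by omega⟩
    refine ⟨Fin.cons a (Fin.cons b 0), T - (a • (1 : (Z × (Fin (n + 2) → ℝ)) →L[ℝ] _) +
      b • N.prodMap (shift (n + 2))), ?_, ?_⟩
    · refine isCompactOperator_of_corner ?_
      convert hab using 1
      ext z
      simp
    · rw [Fin.sum_univ_succ, Fin.sum_univ_succ]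
      simp

end

theorem dualNumber_smul {M : Type*} [AddCommGroup M] [Module ℝ M] [Module (DualNumber ℝ) M]
    [IsScalarTower ℝ (DualNumber ℝ) M] (a : DualNumber ℝ) (x : M) :
    a • x = a.fst • x + a.snd • (DualNumber.eps : DualNumber ℝ) • x := by
  have e : a = a.fst • (1 : DualNumber ℝ) + a.snd • DualNumber.eps := by
    refine TrivSqZeroExt.ext ?_ ?_ <;> simp
  conv_lhs => rw [e]
  rw [add_smul, smul_assoc, smul_assoc, one_smul]

theorem exists_sq_eq_zero : ∃ (Z : Type) (_ : NormedAddCommGroup Z) (_ : NormedSpace ℝ Z),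
    CompleteSpace Z ∧ TopologicalSpace.SeparableSpace Z ∧ ∃ N : Z →L[ℝ] Z, N ^ 2 = 0 ∧
      StrictlySingular N ∧ ¬IsCompactOperator N ∧ ∀ T : Z →L[ℝ] Z, ∃ a b : ℝ,
        IsCompactOperator (T - (a • (1 : Z →L[ℝ] Z) + b • N)) := by
  obtain ⟨ν, hR⟩ := exists_rich (DualNumber ℝ)
  have hν : Adm ν := hR.toAdm
  refine ⟨Sp hν, inferInstance, inferInstance, inferInstance, inferInstance,
    smulL hν DualNumber.eps, ?_, fun Y hY c hc => exists_norm_smulL_eps_lt hR Y hY hc,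
    not_isCompactOperator_smulL_eps hR, fun T => ?_⟩
  · rw [pow_two]
    ext1 x
    rw [mul_apply_eq_comp, smulL_apply, smulL_apply, smul_smul, DualNumber.eps_mul_eps,
      zero_smul, zero_apply]
  · obtain ⟨a, ha⟩ := exists_isCompactOperator_sub hR T
    refine ⟨a.fst, a.snd, ?_⟩
    have e : a.fst • (1 : Sp hν →L[ℝ] Sp hν) + a.snd • smulL hν DualNumber.eps = smulL hν a :=
      ContinuousLinearMap.ext fun x => (dualNumber_smul a x).symm
    rwa [e]

end BourgainDelbaen

theorem stmt1 (k : ℕ) (hk : 2 ≤ k) :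
    ∃ (X : Type) (_ : NormedAddCommGroup X) (_ : NormedSpace ℝ X),
      CompleteSpace X ∧ TopologicalSpace.SeparableSpace X ∧ ¬FiniteDimensional ℝ X ∧
      ∃ S : X →L[ℝ] X, S ^ k = 0 ∧ S ^ (k - 1) ≠ 0 ∧
        StrictlySingular S ∧ ¬IsCompactOperator S ∧
        ∀ T : X →L[ℝ] X, ∃ (lam : Fin k → ℝ) (K : X →L[ℝ] X),
          IsCompactOperator K ∧ T = (∑ i : Fin k, lam i • S ^ (i : ℕ)) + K := by
  obtain ⟨Z, _, _, _, _, N, hN, hs, hc, h⟩ := BourgainDelbaen.exists_sq_eq_zero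
  exact BourgainDelbaen.exists_nilpotent hN hs hc h hk
end
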